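/- Assume S = S(a,b,c) is a finitely generated module over its center Z := Z(S). Then there exists a k-linear map ∂ : Z → Der_k(S) (each ∂_z a k-linear derivation of S) such that: (1) ∂_z(Z) ⊆ Z for every z ∈ Z; (2) the bracket {z, z'} := ∂_z(z') is antisymmetric, satisfies the Leibniz rule and the Jacobi identity, making Z a Poisson algebra; (3) ∂_g = 0, where g := c(c³−b³)·y³ + b(c³−a³)·yxz + a(b³−c³)·xyz + c(a³−c³)·x³ ∈ Z (so g lies in the Poisson center of Z); and (4) the bracket {·,·} on Z is not identically zero. -/

import Mathlib

noncomputable section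

/-- The defining relations of the 3-dimensional Sklyanin algebra `S(a,b,c)`:
`a·yz + b·zy + c·x²`, `a·zx + b·xz + c·y²`, `a·xy + b·yx + c·z²` are set to zero.
The generators `x, y, z` are the images of `FreeAlgebra.ι k 0, 1, 2`. -/
inductive SklyaninRel (k : Type*) [CommRing k] (a b c : k) :
    FreeAlgebra k (Fin 3) → FreeAlgebra k (Fin 3) → Prop
  | r1 : SklyaninRel k a b c
      (a • (FreeAlgebra.ι k 1 * FreeAlgebra.ι k 2) + b • (FreeAlgebra.ι k 2 * FreeAlgebra.ι k 1)
        + c • (FreeAlgebra.ι k 0 * FreeAlgebra.ι k 0)) 0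
  | r2 : SklyaninRel k a b c
      (a • (FreeAlgebra.ι k 2 * FreeAlgebra.ι k 0) + b • (FreeAlgebra.ι k 0 * FreeAlgebra.ι k 2)
        + c • (FreeAlgebra.ι k 1 * FreeAlgebra.ι k 1)) 0
  | r3 : SklyaninRel k a b c
      (a • (FreeAlgebra.ι k 0 * FreeAlgebra.ι k 1) + b • (FreeAlgebra.ι k 1 * FreeAlgebra.ι k 0)
        + c • (FreeAlgebra.ι k 2 * FreeAlgebra.ι k 2)) 0

/-- The 3-dimensional Sklyanin algebra `S(a,b,c)`: the quotient of the free algebra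
`k⟨x,y,z⟩` by the two-sided ideal generated by the three Sklyanin relations. -/
def Sklyanin (k : Type*) [CommRing k] (a b c : k) : Type _ := RingQuot (SklyaninRel k a b c)

instance (k : Type*) [CommRing k] (a b c : k) : Ring (Sklyanin k a b c) :=
  inferInstanceAs (Ring (RingQuot (SklyaninRel k a b c)))

instance (k : Type*) [CommRing k] (a b c : k) : Algebra k (Sklyanin k a b c) :=
  inferInstanceAs (Algebra k (RingQuot (SklyaninRel k a b c)))

namespace Sklyanin

variable (k : Type*) [CommRing k] (a b c : k)

/-- The generator `x` of `S(a,b,c)`. -/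
def X : Sklyanin k a b c := RingQuot.mkAlgHom k (SklyaninRel k a b c) (FreeAlgebra.ι k 0)
/-- The generator `y` of `S(a,b,c)`. -/
def Y : Sklyanin k a b c := RingQuot.mkAlgHom k (SklyaninRel k a b c) (FreeAlgebra.ι k 1)
/-- The generator `z` of `S(a,b,c)`. -/
def Z : Sklyanin k a b c := RingQuot.mkAlgHom k (SklyaninRel k a b c) (FreeAlgebra.ι k 2)

/-- The canonical central element
`g = c(c³−b³)y³ + b(c³−a³)yxz + a(b³−c³)xyz + c(a³−c³)x³` of `S(a,b,c)`. -/
def g : Sklyanin k a b c :=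
  (c * (c ^ 3 - b ^ 3)) • (Y k a b c * Y k a b c * Y k a b c)
    + (b * (c ^ 3 - a ^ 3)) • (Y k a b c * X k a b c * Z k a b c)
    + (a * (b ^ 3 - c ^ 3)) • (X k a b c * Y k a b c * Z k a b c)
    + (c * (a ^ 3 - c ^ 3)) • (X k a b c * X k a b c * X k a b c)

end Sklyanin

namespace Sklyanin

open Polynomial

variable {k : Type*} [Field k] {a b c : k}

/-- The family of the three generators. -/
def gen : Fin 3 → Sklyanin k a b c := ![X k a b c, Y k a b c, Z k a b c]

variable (k a b c) in
/-- The canonical projection from the free algebra. -/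
def mk : FreeAlgebra k (Fin 3) →ₐ[k] Sklyanin k a b c :=
  RingQuot.mkAlgHom k (SklyaninRel k a b c)

lemma mk_surjective : Function.Surjective (mk k a b c) :=
  RingQuot.mkAlgHom_surjective k _

lemma mk_ι (i : Fin 3) : mk k a b c (FreeAlgebra.ι k i) = gen i := by
  fin_cases i <;> rfl

lemma mk_rel {u v : FreeAlgebra k (Fin 3)} (h : SklyaninRel k a b c u v) :
    mk k a b c u = mk k a b c v :=
  RingQuot.mkAlgHom_rel k h

lemma rel_YZ : a • (Y k a b c * Z k a b c) + b • (Z k a b c * Y k a b c)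
    + c • (X k a b c * X k a b c) = 0 := by
  have := mk_rel (SklyaninRel.r1 (k := k) (a := a) (b := b) (c := c))
  simp only [map_add, map_smul, map_mul, map_zero, mk_ι] at this
  exact this

lemma rel_ZX : a • (Z k a b c * X k a b c) + b • (X k a b c * Z k a b c)
    + c • (Y k a b c * Y k a b c) = 0 := by
  have := mk_rel (SklyaninRel.r2 (k := k) (a := a) (b := b) (c := c))
  simp only [map_add, map_smul, map_mul, map_zero, mk_ι] at this
  exact this

lemma rel_XY : a • (X k a b c * Y k a b c) + b • (Y k a b c * X k a b c)
    + c • (Z k a b c * Z k a b c) = 0 := by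
  have := mk_rel (SklyaninRel.r3 (k := k) (a := a) (b := b) (c := c))
  simp only [map_add, map_smul, map_mul, map_zero, mk_ι] at this
  exact this

/-- The universal property of the Sklyanin algebra. -/
def lift {A : Type*} [Ring A] [Algebra k A] (f : Fin 3 → A)
    (h₁ : a • (f 1 * f 2) + b • (f 2 * f 1) + c • (f 0 * f 0) = 0)
    (h₂ : a • (f 2 * f 0) + b • (f 0 * f 2) + c • (f 1 * f 1) = 0)
    (h₃ : a • (f 0 * f 1) + b • (f 1 * f 0) + c • (f 2 * f 2) = 0) :
    Sklyanin k a b c →ₐ[k] A :=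
  RingQuot.liftAlgHom k ⟨FreeAlgebra.lift k f, by
    rintro _ _ (_ | _ | _) <;> simpa using by assumption⟩

section lift

variable {A : Type*} [Ring A] [Algebra k A] (f : Fin 3 → A)
    (h₁ : a • (f 1 * f 2) + b • (f 2 * f 1) + c • (f 0 * f 0) = 0)
    (h₂ : a • (f 2 * f 0) + b • (f 0 * f 2) + c • (f 1 * f 1) = 0)
    (h₃ : a • (f 0 * f 1) + b • (f 1 * f 0) + c • (f 2 * f 2) = 0)

lemma lift_X : lift f h₁ h₂ h₃ (X k a b c) = f 0 := by
  refine (RingQuot.liftAlgHom_mkAlgHom_apply ..).trans ?_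
  simp

lemma lift_Y : lift f h₁ h₂ h₃ (Y k a b c) = f 1 := by
  refine (RingQuot.liftAlgHom_mkAlgHom_apply ..).trans ?_
  simp

lemma lift_Z : lift f h₁ h₂ h₃ (Z k a b c) = f 2 := by
  refine (RingQuot.liftAlgHom_mkAlgHom_apply ..).trans ?_
  simp

end lift

lemma adjoin_range_gen : Algebra.adjoin k (Set.range (gen (k := k) (a := a) (b := b) (c := c))) = ⊤ := by
  have h : Set.range (gen (k := k) (a := a) (b := b) (c := c)) =
      mk k a b c '' Set.range (FreeAlgebra.ι k) := by
    rw [← Set.range_comp]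
    congr 1
    ext i
    exact (mk_ι i).symm
  rw [h, ← AlgHom.map_adjoin, FreeAlgebra.adjoin_range_ι, Algebra.map_top, AlgHom.range_eq_top]
  exact mk_surjective

variable (k a b c) in
/-- The space of linear forms in the generators. -/
def linForms : Submodule k (Sklyanin k a b c) := Submodule.span k (Set.range gen)

lemma gen_mem (i : Fin 3) : (gen i : Sklyanin k a b c) ∈ linForms k a b c :=
  Submodule.subset_span ⟨i, rfl⟩

lemma X_mem : X k a b c ∈ linForms k a b c := gen_mem 0
lemma Y_mem : Y k a b c ∈ linForms k a b c := gen_mem 1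
lemma Z_mem : Z k a b c ∈ linForms k a b c := gen_mem 2

lemma mem_linForms {v : Sklyanin k a b c} (hv : v ∈ linForms k a b c) :
    ∃ α β γ : k, v = α • X k a b c + β • Y k a b c + γ • Z k a b c := by
  obtain ⟨w, rfl⟩ := (Submodule.mem_span_range_iff_exists_fun k).1 hv
  exact ⟨w 0, w 1, w 2, by simp [Fin.sum_univ_three, gen]⟩

variable (k a b c) in
/-- The homogeneous component of degree `n`. -/
def deg (n : ℕ) : Submodule k (Sklyanin k a b c) := linForms k a b c ^ n

lemma mul_mem_deg {m n : ℕ} {u v : Sklyanin k a b c} (hu : u ∈ deg k a b c m)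
    (hv : v ∈ deg k a b c n) : u * v ∈ deg k a b c (m + n) := by
  rw [deg, pow_add]
  exact Submodule.mul_mem_mul hu hv

lemma deg_one : deg k a b c 1 = linForms k a b c := pow_one _

lemma mem_deg_zero {u : Sklyanin k a b c} (hu : u ∈ deg k a b c 0) :
    ∃ r : k, u = algebraMap k _ r := by
  rw [deg, pow_zero, Submodule.mem_one] at hu
  exact hu.imp fun _ h => h.symm

lemma algebraMap_mem_deg (r : k) : algebraMap k (Sklyanin k a b c) r ∈ deg k a b c 0 := by
  rw [deg, pow_zero, Submodule.mem_one]
  exact ⟨r, rfl⟩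

lemma mem_deg_succ {n : ℕ} {u : Sklyanin k a b c} (hu : u ∈ deg k a b c (n + 1)) :
    ∃ s ∈ deg k a b c n, ∃ t ∈ deg k a b c n, ∃ r ∈ deg k a b c n,
      u = X k a b c * s + Y k a b c * t + Z k a b c * r := by
  rw [deg, pow_succ'] at hu
  induction hu using Submodule.mul_induction_on' with
  | mem_mul_mem v hv w hw =>
    obtain ⟨α, β, γ, rfl⟩ := mem_linForms hv
    refine ⟨α • w, Submodule.smul_mem _ _ hw, β • w, Submodule.smul_mem _ _ hw,
      γ • w, Submodule.smul_mem _ _ hw, ?_⟩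
    simp only [add_mul, smul_mul_assoc, mul_smul_comm]
  | add u _ v _ hu hv =>
    obtain ⟨s, hs, t, ht, r, hr, rfl⟩ := hu
    obtain ⟨s', hs', t', ht', r', hr', rfl⟩ := hv
    refine ⟨s + s', add_mem hs hs', t + t', add_mem ht ht', r + r', add_mem hr hr', ?_⟩
    simp only [mul_add]
    abel

instance (n : ℕ) : Module.Finite k (deg k a b c n) := by
  refine Module.Finite.iff_fg.2 (Submodule.FG.pow ?_ n)
  exact Submodule.fg_span (Set.finite_range _)

variable (k a b c) in
/-- The algebra map recording the degree. -/
def gradeHom : Sklyanin k a b c →ₐ[k] (Sklyanin k a b c)[X] :=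
  lift (fun i => monomial 1 (gen i))
    (by simp only [monomial_mul_monomial, smul_monomial]
        rw [← map_add, ← map_add]; exact (congrArg _ rel_YZ).trans (map_zero _))
    (by simp only [monomial_mul_monomial, smul_monomial]
        rw [← map_add, ← map_add]; exact (congrArg _ rel_ZX).trans (map_zero _))
    (by simp only [monomial_mul_monomial, smul_monomial]
        rw [← map_add, ← map_add]; exact (congrArg _ rel_XY).trans (map_zero _))

lemma gradeHom_gen (i : Fin 3) :
    gradeHom k a b c (gen i) = monomial 1 (gen i) := by
  fin_cases i
  · exact lift_X ..
  · exact lift_Y ..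
  · exact lift_Z ..

lemma gradeHom_of_mem {n : ℕ} {u : Sklyanin k a b c} (hu : u ∈ deg k a b c n) :
    gradeHom k a b c u = monomial n u := by
  induction n generalizing u with
  | zero =>
    obtain ⟨r, rfl⟩ := mem_deg_zero hu
    simp only [AlgHom.commutes, monomial_zero_left]
    rfl
  | succ n ih =>
    obtain ⟨s, hs, t, ht, r, hr, rfl⟩ := mem_deg_succ hu
    have hX := gradeHom_gen (k := k) (a := a) (b := b) (c := c) 0
    have hY := gradeHom_gen (k := k) (a := a) (b := b) (c := c) 1
    have hZ := gradeHom_gen (k := k) (a := a) (b := b) (c := c) 2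
    simp only [gen, Matrix.cons_val] at hX hY hZ
    simp only [map_add, map_mul, ih hs, ih ht, ih hr, hX, hY, hZ, monomial_mul_monomial,
      Nat.add_comm 1 n]

/-- The homogeneous component of degree `n` of an element. -/
def comp (n : ℕ) : Sklyanin k a b c →ₗ[k] Sklyanin k a b c where
  toFun s := (gradeHom k a b c s).coeff n
  map_add' := by simp
  map_smul' := by simp

lemma comp_apply (n : ℕ) (s : Sklyanin k a b c) : comp n s = (gradeHom k a b c s).coeff n := rfl

lemma comp_of_mem {n : ℕ} {u : Sklyanin k a b c} (hu : u ∈ deg k a b c n) (m : ℕ) :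
    comp m u = if n = m then u else 0 := by
  rw [comp_apply, gradeHom_of_mem hu, coeff_monomial]

lemma comp_mem (n : ℕ) (s : Sklyanin k a b c) : comp n s ∈ deg k a b c n := by
  have hs : s ∈ Algebra.adjoin k (Set.range (gen (k := k) (a := a) (b := b) (c := c))) := by
    rw [adjoin_range_gen]; trivial
  induction hs using Algebra.adjoin_induction generalizing n with
  | mem x hx =>
    obtain ⟨i, rfl⟩ := hx
    rw [comp_of_mem (n := 1) (by rw [deg_one]; exact gen_mem i)]
    split_ifs with h
    · subst h; rw [deg_one]; exact gen_mem i
    · exact zero_mem _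
  | algebraMap r =>
    rw [comp_of_mem (algebraMap_mem_deg r)]
    split_ifs with h
    · subst h; exact algebraMap_mem_deg r
    · exact zero_mem _
  | add x y _ _ hx hy => rw [map_add]; exact add_mem (hx n) (hy n)
  | mul x y _ _ hx hy =>
    rw [comp_apply, map_mul, coeff_mul]
    refine sum_mem fun p hp => ?_
    rw [← Finset.HasAntidiagonal.mem_antidiagonal.1 hp]
    exact mul_mem_deg (hx _) (hy _)

lemma sum_comp (s : Sklyanin k a b c) :
    ∑ n ∈ (gradeHom k a b c s).support, comp n s = s := by
  let φ : (Sklyanin k a b c)[X] →+* Sklyanin k a b c :=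
    eval₂RingHom' (RingHom.id _) 1 fun _ => Commute.one_right _
  have hφ (s) : φ (gradeHom k a b c s) = s := by
    have hs : s ∈ Algebra.adjoin k (Set.range (gen (k := k) (a := a) (b := b) (c := c))) := by
      rw [adjoin_range_gen]; trivial
    induction hs using Algebra.adjoin_induction with
    | mem x hx =>
      obtain ⟨i, rfl⟩ := hx
      rw [gradeHom_gen]
      simp [φ, eval₂RingHom']
    | algebraMap r =>
      rw [gradeHom_of_mem (algebraMap_mem_deg r)]
      simp [φ, eval₂RingHom']
    | add x y _ _ hx hy => rw [map_add, map_add, hx, hy]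
    | mul x y _ _ hx hy => rw [map_mul, map_mul, hx, hy]
  conv_rhs => rw [← hφ s]
  simp [φ, eval₂RingHom', eval₂_eq_sum, sum_def, comp_apply]

/-- Injectivity of homogeneous decomposition. -/
lemma eq_zero_of_comp {s : Sklyanin k a b c} (h : ∀ n, comp n s = 0) : s = 0 := by
  rw [← sum_comp s, Finset.sum_eq_zero fun n _ => h n]

lemma comp_mul_of_mem {n : ℕ} {u : Sklyanin k a b c} (hu : u ∈ deg k a b c n)
    (s : Sklyanin k a b c) (m : ℕ) : comp (n + m) (u * s) = u * comp m s := by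
  rw [comp_apply, map_mul, gradeHom_of_mem hu, Nat.add_comm, coeff_monomial_mul]
  rfl

lemma comp_mul_of_mem_right {n : ℕ} {u : Sklyanin k a b c} (hu : u ∈ deg k a b c n)
    (s : Sklyanin k a b c) (m : ℕ) : comp (m + n) (s * u) = comp m s * u := by
  rw [comp_apply, map_mul, gradeHom_of_mem hu, coeff_mul_monomial]
  rfl

end Sklyanin

namespace Sklyanin

section central

variable {k S : Type*} [Field k] [Ring S] [Algebra k S] {a b c : k} {x y z : S}
  (h₁ : a • (y * z) + b • (z * y) + c • (x * x) = 0)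
  (h₂ : a • (z * x) + b • (x * z) + c • (y * y) = 0)
  (h₃ : a • (x * y) + b • (y * x) + c • (z * z) = 0)
include h₁ h₂ h₃

lemma commute_g_x : x * ((c * (c ^ 3 - b ^ 3)) • (y * y * y) + (b * (c ^ 3 - a ^ 3)) • (y * x * z)
        + (a * (b ^ 3 - c ^ 3)) • (x * y * z) + (c * (a ^ 3 - c ^ 3)) • (x * x * x)) = ((c * (c ^ 3 - b ^ 3)) • (y * y * y) + (b * (c ^ 3 - a ^ 3)) • (y * x * z)
        + (a * (b ^ 3 - c ^ 3)) • (x * y * z) + (c * (a ^ 3 - c ^ 3)) • (x * x * x)) * x := by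
  have key : x * ((c * (c ^ 3 - b ^ 3)) • (y * y * y) + (b * (c ^ 3 - a ^ 3)) • (y * x * z)
        + (a * (b ^ 3 - c ^ 3)) • (x * y * z) + (c * (a ^ 3 - c ^ 3)) • (x * x * x)) - ((c * (c ^ 3 - b ^ 3)) • (y * y * y) + (b * (c ^ 3 - a ^ 3)) • (y * x * z)
        + (a * (b ^ 3 - c ^ 3)) • (x * y * z) + (c * (a ^ 3 - c ^ 3)) • (x * x * x)) * x =
      -(a * c ^ 2) • ((a • (y * z) + b • (z * y) + c • (x * x)) * y * z)
        - (b ^ 2 * c) • ((a • (z * x) + b • (x * z) + c • (y * y)) * z * z)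
        - (a ^ 2 * b) • ((a • (x * y) + b • (y * x) + c • (z * z)) * x * z)
        + (b ^ 3) • (x * (a • (x * y) + b • (y * x) + c • (z * z)) * z)
        - (c ^ 3) • (y * (a • (z * x) + b • (x * z) + c • (y * y)) * x)
        - (a * b * c) • (y * (a • (x * y) + b • (y * x) + c • (z * z)) * y)
        + (a * b * c) • (z * (a • (z * x) + b • (x * z) + c • (y * y)) * z)
        + (c ^ 3) • (x * y * (a • (z * x) + b • (x * z) + c • (y * y)))
        - (b ^ 3) • (x * y * (a • (z * x) + b • (x * z) + c • (y * y)))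
        + (a ^ 2 * b) • (y * x * (a • (z * x) + b • (x * z) + c • (y * y)))
        + (b ^ 2 * c) • (y * y * (a • (x * y) + b • (y * x) + c • (z * z)))
        + (a * c ^ 2) • (y * z * (a • (y * z) + b • (z * y) + c • (x * x))) := by
    simp only [mul_add, add_mul, smul_mul_assoc, mul_smul_comm, mul_assoc]
    module
  rw [h₁, h₂, h₃] at key
  simpa [sub_eq_zero] using key

lemma commute_g_y : y * ((c * (c ^ 3 - b ^ 3)) • (y * y * y) + (b * (c ^ 3 - a ^ 3)) • (y * x * z)
        + (a * (b ^ 3 - c ^ 3)) • (x * y * z) + (c * (a ^ 3 - c ^ 3)) • (x * x * x)) = ((c * (c ^ 3 - b ^ 3)) • (y * y * y) + (b * (c ^ 3 - a ^ 3)) • (y * x * z)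
        + (a * (b ^ 3 - c ^ 3)) • (x * y * z) + (c * (a ^ 3 - c ^ 3)) • (x * x * x)) * y := by
  have key : y * ((c * (c ^ 3 - b ^ 3)) • (y * y * y) + (b * (c ^ 3 - a ^ 3)) • (y * x * z)
        + (a * (b ^ 3 - c ^ 3)) • (x * y * z) + (c * (a ^ 3 - c ^ 3)) • (x * x * x)) - ((c * (c ^ 3 - b ^ 3)) • (y * y * y) + (b * (c ^ 3 - a ^ 3)) • (y * x * z)
        + (a * (b ^ 3 - c ^ 3)) • (x * y * z) + (c * (a ^ 3 - c ^ 3)) • (x * x * x)) * y =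
      (a ^ 2 * c) • ((a • (y * z) + b • (z * y) + c • (x * x)) * z * z)
        + (b * c ^ 2) • ((a • (z * x) + b • (x * z) + c • (y * y)) * x * z)
        + (a * b ^ 2) • ((a • (x * y) + b • (y * x) + c • (z * z)) * y * z)
        + (c ^ 3) • (x * (a • (y * z) + b • (z * y) + c • (x * x)) * y)
        + (a * b * c) • (x * (a • (x * y) + b • (y * x) + c • (z * z)) * x)
        - (a ^ 3) • (y * (a • (x * y) + b • (y * x) + c • (z * z)) * z)
        - (a * b * c) • (z * (a • (y * z) + b • (z * y) + c • (x * x)) * z)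
        - (a ^ 2 * c) • (x * x * (a • (x * y) + b • (y * x) + c • (z * z)))
        - (a * b ^ 2) • (x * y * (a • (y * z) + b • (z * y) + c • (x * x)))
        - (b * c ^ 2) • (x * z * (a • (z * x) + b • (x * z) + c • (y * y)))
        - (c ^ 3) • (y * x * (a • (y * z) + b • (z * y) + c • (x * x)))
        + (a ^ 3) • (y * x * (a • (y * z) + b • (z * y) + c • (x * x))) := by
    simp only [mul_add, add_mul, smul_mul_assoc, mul_smul_comm, mul_assoc]
    module
  rw [h₁, h₂, h₃] at key
  simpa [sub_eq_zero] using key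

lemma commute_g_z : z * ((c * (c ^ 3 - b ^ 3)) • (y * y * y) + (b * (c ^ 3 - a ^ 3)) • (y * x * z)
        + (a * (b ^ 3 - c ^ 3)) • (x * y * z) + (c * (a ^ 3 - c ^ 3)) • (x * x * x)) = ((c * (c ^ 3 - b ^ 3)) • (y * y * y) + (b * (c ^ 3 - a ^ 3)) • (y * x * z)
        + (a * (b ^ 3 - c ^ 3)) • (x * y * z) + (c * (a ^ 3 - c ^ 3)) • (x * x * x)) * z := by
  have key : z * ((c * (c ^ 3 - b ^ 3)) • (y * y * y) + (b * (c ^ 3 - a ^ 3)) • (y * x * z)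
        + (a * (b ^ 3 - c ^ 3)) • (x * y * z) + (c * (a ^ 3 - c ^ 3)) • (x * x * x)) - ((c * (c ^ 3 - b ^ 3)) • (y * y * y) + (b * (c ^ 3 - a ^ 3)) • (y * x * z)
        + (a * (b ^ 3 - c ^ 3)) • (x * y * z) + (c * (a ^ 3 - c ^ 3)) • (x * x * x)) * z =
      (c ^ 3) • ((a • (y * z) + b • (z * y) + c • (x * x)) * x * z)
        - (a ^ 3) • ((a • (y * z) + b • (z * y) + c • (x * x)) * x * z)
        - (b ^ 2 * c) • ((a • (y * z) + b • (z * y) + c • (x * x)) * y * y)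
        + (a ^ 2 * c) • ((a • (z * x) + b • (x * z) + c • (y * y)) * x * x)
        + (b ^ 3) • ((a • (z * x) + b • (x * z) + c • (y * y)) * y * z)
        - (a * c ^ 2) • ((a • (x * y) + b • (y * x) + c • (z * z)) * x * y)
        - (b ^ 3) • (x * (a • (y * z) + b • (z * y) + c • (x * x)) * z)
        - (a * b * c) • (x * (a • (z * x) + b • (x * z) + c • (y * y)) * x)
        + (a * b * c) • (y * (a • (y * z) + b • (z * y) + c • (x * x)) * y)
        - (c ^ 3) • (y * (a • (z * x) + b • (x * z) + c • (y * y)) * z)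
        + (a ^ 3) • (y * (a • (z * x) + b • (x * z) + c • (y * y)) * z)
        + (c ^ 3) • (z * (a • (z * x) + b • (x * z) + c • (y * y)) * y)
        + (b ^ 2 * c) • (x * x * (a • (z * x) + b • (x * z) + c • (y * y)))
        + (a * c ^ 2) • (x * y * (a • (x * y) + b • (y * x) + c • (z * z)))
        - (a ^ 2 * c) • (y * y * (a • (y * z) + b • (z * y) + c • (x * x)))
        - (c ^ 3) • (z * x * (a • (y * z) + b • (z * y) + c • (x * x))) := by
    simp only [mul_add, add_mul, smul_mul_assoc, mul_smul_comm, mul_assoc]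
    module
  rw [h₁, h₂, h₃] at key
  simpa [sub_eq_zero] using key

end central

variable {k : Type*} [Field k] {a b c : k}

lemma mem_center_of_commute_gen {s : Sklyanin k a b c} (h : ∀ i, gen i * s = s * gen i) :
    s ∈ Subalgebra.center k (Sklyanin k a b c) := by
  rw [Subalgebra.mem_center_iff]
  intro t
  have ht : t ∈ Algebra.adjoin k (Set.range (gen (k := k) (a := a) (b := b) (c := c))) := by
    rw [adjoin_range_gen]; trivial
  induction ht using Algebra.adjoin_induction with
  | mem x hx => obtain ⟨i, rfl⟩ := hx; exact h i
  | algebraMap r => exact Algebra.commutes r s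
  | add x y _ _ hx hy => rw [add_mul, mul_add, hx, hy]
  | mul x y _ _ hx hy => rw [mul_assoc, hy, ← mul_assoc, hx, mul_assoc]

lemma g_mem_center : g k a b c ∈ Subalgebra.center k (Sklyanin k a b c) := by
  refine mem_center_of_commute_gen fun i => ?_
  fin_cases i
  · exact commute_g_x rel_YZ rel_ZX rel_XY
  · exact commute_g_y rel_YZ rel_ZX rel_XY
  · exact commute_g_z rel_YZ rel_ZX rel_XY

lemma g_comm (s : Sklyanin k a b c) : g k a b c * s = s * g k a b c :=
  ((Subalgebra.mem_center_iff.1 g_mem_center) s).symm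

lemma g_mem_deg : g k a b c ∈ deg k a b c 3 := by
  have h {u v w : Sklyanin k a b c} (hu : u ∈ linForms k a b c) (hv : v ∈ linForms k a b c)
      (hw : w ∈ linForms k a b c) (r : k) : r • (u * v * w) ∈ deg k a b c 3 := by
    rw [← deg_one] at hu hv hw
    exact Submodule.smul_mem _ _ (mul_mem_deg (mul_mem_deg hu hv) hw)
  exact add_mem (add_mem (add_mem (h Y_mem Y_mem Y_mem _) (h Y_mem X_mem Z_mem _))
    (h X_mem Y_mem Z_mem _)) (h X_mem X_mem X_mem _)

end Sklyanin

namespace Sklyanin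

section points

variable {B : Type*} [CommRing B] (a b c : B)

/-- The multilinearized Sklyanin relations at a pair of points. -/
structure Incident (p q : Fin 3 → B) : Prop where
  rel_yz : a * (p 1 * q 2) + b * (p 2 * q 1) + c * (p 0 * q 0) = 0
  rel_zx : a * (p 2 * q 0) + b * (p 0 * q 2) + c * (p 1 * q 1) = 0
  rel_xy : a * (p 0 * q 1) + b * (p 1 * q 0) + c * (p 2 * q 2) = 0

/-- The equation of the cubic curve of point modules. -/
def cubicForm (p : Fin 3 → B) : B :=
  (a ^ 3 + b ^ 3 + c ^ 3) * (p 0 * p 1 * p 2) - a * b * c * (p 0 ^ 3 + p 1 ^ 3 + p 2 ^ 3)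

/-- The cross products of pairs of rows of the matrix of the relations at a point. -/
def rowCross (p : Fin 3 → B) : Fin 3 → Fin 3 → B :=
  ![![c ^ 2 * p 1 * p 2 - a * b * p 0 ^ 2, b ^ 2 * p 0 * p 1 - a * c * p 2 ^ 2,
      a ^ 2 * p 0 * p 2 - b * c * p 1 ^ 2],
    ![a ^ 2 * p 0 * p 1 - b * c * p 2 ^ 2, c ^ 2 * p 0 * p 2 - a * b * p 1 ^ 2,
      b ^ 2 * p 1 * p 2 - a * c * p 0 ^ 2],
    ![b ^ 2 * p 0 * p 2 - a * c * p 1 ^ 2, a ^ 2 * p 1 * p 2 - b * c * p 0 ^ 2,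
      c ^ 2 * p 0 * p 1 - a * b * p 2 ^ 2]]

/-- The multilinearization of the central element `g`. -/
def gForm (p q r : Fin 3 → B) : B :=
  c * (c ^ 3 - b ^ 3) * (p 1 * q 1 * r 1) + b * (c ^ 3 - a ^ 3) * (p 1 * q 0 * r 2)
    + a * (b ^ 3 - c ^ 3) * (p 0 * q 1 * r 2) + c * (a ^ 3 - c ^ 3) * (p 0 * q 0 * r 0)

variable {a b c}

lemma Incident.swap {p q : Fin 3 → B} (h : Incident a b c p q) : Incident b a c q p where
  rel_yz := by linear_combination h.rel_yz
  rel_zx := by linear_combination h.rel_zx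
  rel_xy := by linear_combination h.rel_xy

lemma cubicForm_swap (p : Fin 3 → B) : cubicForm b a c p = cubicForm a b c p := by
  simp only [cubicForm]; ring

lemma incident_rowCross {p : Fin 3 → B} (h : cubicForm a b c p = 0) (α : Fin 3) :
    Incident a b c p (rowCross a b c p α) := by
  simp only [cubicForm] at h
  fin_cases α <;> constructor <;> simp [rowCross] <;>
    first | ring1 | linear_combination h

lemma Incident.cubicForm_mul {p q : Fin 3 → B} (h : Incident a b c p q) (i : Fin 3) :
    cubicForm a b c p * q i = 0 := by
  obtain ⟨h₁, h₂, h₃⟩ := h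
  have key : cubicForm a b c p * q i = rowCross a b c p 0 i *
      (a * (p 1 * q 2) + b * (p 2 * q 1) + c * (p 0 * q 0)) + rowCross a b c p 1 i *
      (a * (p 2 * q 0) + b * (p 0 * q 2) + c * (p 1 * q 1)) + rowCross a b c p 2 i *
      (a * (p 0 * q 1) + b * (p 1 * q 0) + c * (p 2 * q 2)) := by
    fin_cases i <;> simp [rowCross, cubicForm] <;> ring
  rw [key, h₁, h₂, h₃]
  ring

lemma Incident.cubicForm_left [IsDomain B] {p q : Fin 3 → B} (h : Incident a b c p q)
    (hq : q ≠ 0) : cubicForm a b c p = 0 := by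
  obtain ⟨i, hi⟩ := Function.ne_iff.1 hq
  exact (mul_eq_zero.1 (h.cubicForm_mul i)).resolve_right hi

lemma Incident.cubicForm_right [IsDomain B] {p q : Fin 3 → B} (h : Incident a b c p q)
    (hp : p ≠ 0) : cubicForm a b c q = 0 := by
  rw [← cubicForm_swap]
  exact h.swap.cubicForm_left hp

lemma Incident.rowCross_mul {p q : Fin 3 → B} (h : Incident a b c p q) (α i j : Fin 3) :
    rowCross a b c p α i * q j = rowCross a b c p α j * q i := by
  obtain ⟨h₁, h₂, h₃⟩ := h
  have key : ∀ α : Fin 3, rowCross a b c p α 0 * q 1 = rowCross a b c p α 1 * q 0 ∧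
      rowCross a b c p α 1 * q 2 = rowCross a b c p α 2 * q 1 ∧
      rowCross a b c p α 2 * q 0 = rowCross a b c p α 0 * q 2 := by
    intro α
    fin_cases α <;> simp [rowCross] <;> refine ⟨?_, ?_, ?_⟩
    · linear_combination c * p 2 * h₂ - b * p 0 * h₃
    · linear_combination b * p 1 * h₂ - a * p 2 * h₃
    · linear_combination a * p 0 * h₂ - c * p 1 * h₃
    · linear_combination a * p 1 * h₃ - c * p 2 * h₁
    · linear_combination c * p 0 * h₃ - b * p 1 * h₁
    · linear_combination b * p 2 * h₃ - a * p 0 * h₁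
    · linear_combination b * p 0 * h₁ - a * p 1 * h₂
    · linear_combination a * p 2 * h₁ - c * p 0 * h₂
    · linear_combination c * p 1 * h₁ - b * p 2 * h₂
  obtain ⟨k₁, k₂, k₃⟩ := key α
  fin_cases i <;> fin_cases j <;> simp_all

lemma exists_rowCross_ne_zero [IsDomain B] (habc : a * b * c ≠ 0)
    (hne : ¬ (a ^ 3 = c ^ 3 ∧ b ^ 3 = c ^ 3)) {p : Fin 3 → B} (hp : p ≠ 0) :
    ∃ α i, rowCross a b c p α i ≠ 0 := by
  by_contra! h
  have ha : a ≠ 0 := by rintro rfl; simp at habc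
  have hb : b ≠ 0 := by rintro rfl; simp at habc
  have e00 := h 0 0; have e01 := h 0 1; have e02 := h 0 2
  have e10 := h 1 0; have e11 := h 1 1; have e12 := h 1 2
  have e20 := h 2 0; have e21 := h 2 1; have e22 := h 2 2
  simp [rowCross] at e00 e01 e02 e10 e11 e12 e20 e21 e22
  obtain ⟨i, hi⟩ := Function.ne_iff.1 hp
  apply hne
  have key : a * p i ^ 2 * (b ^ 3 - c ^ 3) = 0 ∧ b * p i ^ 2 * (a ^ 3 - c ^ 3) = 0 := by
    fin_cases i
    · exact ⟨by dsimp; linear_combination c ^ 2 * e12 - b ^ 2 * e00,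
        by dsimp; linear_combination c ^ 2 * e21 - a ^ 2 * e00⟩
    · exact ⟨by dsimp; linear_combination c ^ 2 * e20 - b ^ 2 * e11,
        by dsimp; linear_combination c ^ 2 * e02 - a ^ 2 * e11⟩
    · exact ⟨by dsimp; linear_combination c ^ 2 * e01 - b ^ 2 * e22,
        by dsimp; linear_combination c ^ 2 * e10 - a ^ 2 * e22⟩
  have hi2 : p i ^ 2 ≠ 0 := pow_ne_zero _ hi
  constructor
  · exact sub_eq_zero.1 ((mul_eq_zero.1 key.2).resolve_left (mul_ne_zero hb hi2))
  · exact sub_eq_zero.1 ((mul_eq_zero.1 key.1).resolve_left (mul_ne_zero ha hi2))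

lemma gForm_rowCross {p : Fin 3 → B} (h : cubicForm a b c p = 0) (α β : Fin 3) :
    gForm a b c (rowCross b a c p α) p (rowCross a b c p β) = 0 := by
  simp only [cubicForm] at h
  fin_cases α <;> fin_cases β <;> simp [rowCross, gForm]
  · linear_combination (- a ^ 4 * b * p 0 ^ 2 + a * b * c ^ 3 * p 0 ^ 2 + b ^ 3 * c ^ 2 * p 1 * p 2 + - c ^ 5 * p 1 * p 2) * h
  · linear_combination (- a ^ 2 * b ^ 3 * p 0 * p 1 + a ^ 2 * c ^ 3 * p 0 * p 1) * h
  · linear_combination (a ^ 3 * b ^ 2 * p 0 * p 2 + - b ^ 2 * c ^ 3 * p 0 * p 2) * h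
  · linear_combination (a ^ 3 * b ^ 2 * p 0 * p 1 + - b ^ 2 * c ^ 3 * p 0 * p 1) * h
  · linear_combination (- a ^ 3 * c ^ 2 * p 0 * p 2 + a * b ^ 4 * p 1 ^ 2 + - a * b * c ^ 3 * p 1 ^ 2 + c ^ 5 * p 0 * p 2) * h
  · linear_combination (- a ^ 2 * b ^ 3 * p 1 * p 2 + a ^ 2 * c ^ 3 * p 1 * p 2) * h
  · linear_combination (- b ^ 4 * c * p 1 ^ 2 + b * c ^ 4 * p 1 ^ 2) * h
  · linear_combination (a ^ 4 * c * p 0 ^ 2 + - a * c ^ 4 * p 0 ^ 2) * h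
  · linear_combination (- a ^ 3 * c ^ 2 * p 0 * p 1 + b ^ 3 * c ^ 2 * p 0 * p 1) * h

lemma gForm_eq_zero [IsDomain B] (habc : a * b * c ≠ 0)
    (hne : ¬ (a ^ 3 = c ^ 3 ∧ b ^ 3 = c ^ 3)) {p q r : Fin 3 → B} (hpq : Incident a b c p q)
    (hqr : Incident a b c q r) (hq : q ≠ 0) (hΦ : cubicForm a b c q = 0) :
    gForm a b c p q r = 0 := by
  obtain ⟨β, j, hj⟩ := exists_rowCross_ne_zero habc hne hq
  obtain ⟨α, i, hi⟩ := exists_rowCross_ne_zero (a := b) (b := a) (c := c)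
    (by rwa [mul_comm b a]) (fun h => hne ⟨h.2, h.1⟩) hq
  have h₁ := fun l => hpq.swap.rowCross_mul α i l
  have h₂ := fun l => hqr.rowCross_mul β j l
  have key : rowCross b a c q α i * rowCross a b c q β j * gForm a b c p q r =
      p i * r j * gForm a b c (rowCross b a c q α) q (rowCross a b c q β) := by
    have hl (l m : Fin 3) : rowCross b a c q α i * rowCross a b c q β j * (p l * r m) =
        p i * r j * (rowCross b a c q α l * rowCross a b c q β m) := by
      linear_combination rowCross a b c q β j * r m * h₁ l + rowCross b a c q α l * p i * h₂ m
    simp only [gForm]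
    linear_combination c * (c ^ 3 - b ^ 3) * q 1 * hl 1 1 + b * (c ^ 3 - a ^ 3) * q 0 * hl 1 2
      + a * (b ^ 3 - c ^ 3) * q 1 * hl 0 2 + c * (a ^ 3 - c ^ 3) * q 0 * hl 0 0
  rw [gForm_rowCross hΦ, mul_zero] at key
  exact (mul_eq_zero.1 key).resolve_left (mul_ne_zero hi hj)

end points

end Sklyanin

namespace Sklyanin

section evaluation

variable {k : Type*} [Field k] {a b c : k} {A : Type*} [CommRing A] [Algebra k A]

variable (a b c) in
/-- A sequence of points consecutive members of which satisfy the multilinearized relations. -/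
def IsOrbit (P : ℕ → Fin 3 → A) : Prop :=
  ∀ j, Incident (algebraMap k A a) (algebraMap k A b) (algebraMap k A c) (P j) (P (j + 1))

variable (k) in
/-- The weighted shift operator attached to the `i`-th coordinate of a sequence of points. -/
def weightedShift (P : ℕ → Fin 3 → A) (i : Fin 3) : Module.End k (ℕ → A) where
  toFun f j := P j i * f (j + 1)
  map_add' f f' := by ext j; simp [mul_add]
  map_smul' r f := by ext j; simp

lemma weightedShift_apply (P : ℕ → Fin 3 → A) (i : Fin 3) (f : ℕ → A) (j : ℕ) :
    weightedShift k P i f j = P j i * f (j + 1) := rfl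

/-- The representation of the Sklyanin algebra attached to an orbit. -/
def IsOrbit.rep {P : ℕ → Fin 3 → A} (hP : IsOrbit a b c P) :
    Sklyanin k a b c →ₐ[k] Module.End k (ℕ → A) :=
  lift (weightedShift k P)
    (by
      ext f j
      simp only [LinearMap.add_apply, LinearMap.smul_apply, Module.End.mul_apply, Pi.add_apply,
        Pi.smul_apply, weightedShift_apply, LinearMap.zero_apply, Pi.zero_apply]
      simp only [Algebra.smul_def]
      linear_combination f (j + 2) * (hP j).rel_yz)
    (by
      ext f j
      simp only [LinearMap.add_apply, LinearMap.smul_apply, Module.End.mul_apply, Pi.add_apply,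
        Pi.smul_apply, weightedShift_apply, LinearMap.zero_apply, Pi.zero_apply]
      simp only [Algebra.smul_def]
      linear_combination f (j + 2) * (hP j).rel_zx)
    (by
      ext f j
      simp only [LinearMap.add_apply, LinearMap.smul_apply, Module.End.mul_apply, Pi.add_apply,
        Pi.smul_apply, weightedShift_apply, LinearMap.zero_apply, Pi.zero_apply]
      simp only [Algebra.smul_def]
      linear_combination f (j + 2) * (hP j).rel_xy)

variable {P : ℕ → Fin 3 → A} (hP : IsOrbit a b c P)

lemma IsOrbit.rep_gen (i : Fin 3) : hP.rep (gen i) = weightedShift k P i := by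
  fin_cases i
  · exact lift_X ..
  · exact lift_Y ..
  · exact lift_Z ..

/-- The evaluation of an element along an orbit, starting at the `j`-th point. -/
def IsOrbit.ev (j : ℕ) : Sklyanin k a b c →ₗ[k] A :=
  (LinearMap.proj j ∘ₗ LinearMap.applyₗ (1 : ℕ → A)) ∘ₗ hP.rep.toLinearMap

lemma IsOrbit.ev_apply (j : ℕ) (u : Sklyanin k a b c) : hP.ev j u = hP.rep u 1 j := rfl

lemma IsOrbit.ev_gen_mul (j : ℕ) (i : Fin 3) (u : Sklyanin k a b c) :
    hP.ev j (gen i * u) = P j i * hP.ev (j + 1) u := by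
  rw [ev_apply, map_mul, hP.rep_gen]
  rfl

lemma IsOrbit.ev_X_mul (j : ℕ) (u : Sklyanin k a b c) :
    hP.ev j (X k a b c * u) = P j 0 * hP.ev (j + 1) u := hP.ev_gen_mul j 0 u

lemma IsOrbit.ev_Y_mul (j : ℕ) (u : Sklyanin k a b c) :
    hP.ev j (Y k a b c * u) = P j 1 * hP.ev (j + 1) u := hP.ev_gen_mul j 1 u

lemma IsOrbit.ev_Z_mul (j : ℕ) (u : Sklyanin k a b c) :
    hP.ev j (Z k a b c * u) = P j 2 * hP.ev (j + 1) u := hP.ev_gen_mul j 2 u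

lemma IsOrbit.ev_one (j : ℕ) : hP.ev j 1 = 1 := by
  rw [ev_apply, map_one hP.rep]
  rfl

lemma IsOrbit.ev_gen (j : ℕ) (i : Fin 3) : hP.ev j (gen i) = P j i := by
  rw [← mul_one (gen i), ev_gen_mul, ev_one, mul_one]

lemma IsOrbit.ev_X (j : ℕ) : hP.ev j (X k a b c) = P j 0 := hP.ev_gen j 0
lemma IsOrbit.ev_Y (j : ℕ) : hP.ev j (Y k a b c) = P j 1 := hP.ev_gen j 1
lemma IsOrbit.ev_Z (j : ℕ) : hP.ev j (Z k a b c) = P j 2 := hP.ev_gen j 2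

lemma IsOrbit.ev_algebraMap (j : ℕ) (r : k) : hP.ev j (algebraMap k _ r) = algebraMap k A r := by
  rw [Algebra.algebraMap_eq_smul_one, map_smul, ev_one, Algebra.algebraMap_eq_smul_one]

lemma IsOrbit.ev_mul {n : ℕ} {u : Sklyanin k a b c} (hu : u ∈ deg k a b c n)
    (v : Sklyanin k a b c) (j : ℕ) : hP.ev j (u * v) = hP.ev j u * hP.ev (j + n) v := by
  induction n generalizing u j with
  | zero =>
    obtain ⟨r, rfl⟩ := mem_deg_zero hu
    rw [← Algebra.smul_def, map_smul, ev_algebraMap, Algebra.smul_def, add_zero]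
  | succ n ih =>
    obtain ⟨s, hs, t, ht, r, hr, rfl⟩ := mem_deg_succ hu
    simp only [add_mul, mul_assoc, map_add, ev_X_mul, ev_Y_mul, ev_Z_mul, ih hs, ih ht, ih hr,
      Nat.add_right_comm j 1 n, add_assoc j n 1]

/-- Evaluation along orbits whose points are proportional after a base change and a shift. -/
lemma IsOrbit.ev_of_proportional {B : Type*} [CommRing B] [Algebra k B] {Q : ℕ → Fin 3 → B}
    (hQ : IsOrbit a b c Q) (φ : A →ₐ[k] B) (β : ℕ → B) (m : ℕ)
    (h : ∀ j i, Q j i = β j * φ (P (j + m) i)) {n : ℕ} {u : Sklyanin k a b c}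
    (hu : u ∈ deg k a b c n) (j : ℕ) :
    hQ.ev j u = (∏ i ∈ Finset.range n, β (j + i)) * φ (hP.ev (j + m) u) := by
  induction n generalizing u j with
  | zero =>
    obtain ⟨r, rfl⟩ := mem_deg_zero hu
    simp [ev_algebraMap]
  | succ n ih =>
    obtain ⟨s, hs, t, ht, r, hr, rfl⟩ := mem_deg_succ hu
    have e : ∏ i ∈ Finset.range (n + 1), β (j + i) =
        (∏ i ∈ Finset.range n, β (j + 1 + i)) * β j := by
      rw [Finset.prod_range_succ', add_zero]
      congr 1
      exact Finset.prod_congr rfl fun i _ => congrArg β (by ring)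
    have e' : j + 1 + m = j + m + 1 := by ring
    simp only [map_add, ev_X_mul, ev_Y_mul, ev_Z_mul, ih hs, ih ht, ih hr, h, map_mul,
      e, e']
    ring

lemma IsOrbit.ev_g [IsDomain A] [FaithfulSMul k A] (habc : a * b * c ≠ 0)
    (hne : ¬ (a ^ 3 = c ^ 3 ∧ b ^ 3 = c ^ 3)) (j : ℕ) (h : P (j + 1) ≠ 0)
    (h' : P (j + 2) ≠ 0) : hP.ev j (g k a b c) = 0 := by
  have hinj := FaithfulSMul.algebraMap_injective k A
  have key := gForm_eq_zero (a := algebraMap k A a) (b := algebraMap k A b)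
    (c := algebraMap k A c) (by simpa only [← map_mul] using (map_ne_zero_iff _ hinj).2 habc)
    (by simpa only [← map_pow, hinj.eq_iff] using hne) (hP j) (hP (j + 1)) h
    ((hP (j + 1)).cubicForm_left h')
  rw [← key]
  simp only [g, gForm, mul_assoc (G := Sklyanin k a b c), map_add, map_smul, ev_X_mul, ev_Y_mul, ev_X, ev_Y, ev_Z]
  simp only [Algebra.smul_def, map_mul, map_sub, map_pow]
  ring

end evaluation

end Sklyanin

namespace Sklyanin

section pointModules

variable {k : Type*} [Field k] {a b c : k}

lemma exists_incident (habc : a * b * c ≠ 0) (hne : ¬ (a ^ 3 = c ^ 3 ∧ b ^ 3 = c ^ 3))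
    {p : Fin 3 → k} (hp : p ≠ 0) (hΦ : cubicForm a b c p = 0) :
    ∃ q : Fin 3 → k, q ≠ 0 ∧ Incident a b c p q := by
  obtain ⟨α, i, hi⟩ := exists_rowCross_ne_zero habc hne hp
  exact ⟨_, Function.ne_iff.2 ⟨i, hi⟩, incident_rowCross hΦ α⟩

lemma exists_incident' (habc : a * b * c ≠ 0) (hne : ¬ (a ^ 3 = c ^ 3 ∧ b ^ 3 = c ^ 3))
    {p : Fin 3 → k} (hp : p ≠ 0) (hΦ : cubicForm a b c p = 0) :
    ∃ q : Fin 3 → k, q ≠ 0 ∧ Incident a b c q p := by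
  obtain ⟨q, hq, h⟩ := exists_incident (a := b) (b := a) (c := c) (by rwa [mul_comm b a])
    (fun h => hne ⟨h.2, h.1⟩) hp (by rwa [cubicForm_swap])
  exact ⟨q, hq, h.swap⟩

/-- Every point of the cubic is the start of an orbit. -/
lemma exists_orbit_zero (habc : a * b * c ≠ 0) (hne : ¬ (a ^ 3 = c ^ 3 ∧ b ^ 3 = c ^ 3))
    {p : Fin 3 → k} (hp : p ≠ 0) (hΦ : cubicForm a b c p = 0) :
    ∃ P : ℕ → Fin 3 → k, IsOrbit a b c P ∧ (∀ j, P j ≠ 0) ∧ P 0 = p := by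
  let E := {p : Fin 3 → k // p ≠ 0 ∧ cubicForm a b c p = 0}
  have hnext (e : E) : ∃ f : E, Incident a b c e.1 f.1 := by
    obtain ⟨q, hq, h⟩ := exists_incident habc hne e.2.1 e.2.2
    exact ⟨⟨q, hq, h.cubicForm_right e.2.1⟩, h⟩
  choose next hnext using hnext
  let s : ℕ → E := fun n => Nat.rec ⟨p, hp, hΦ⟩ (fun _ e => next e) n
  exact ⟨fun n => (s n).1, fun j => hnext (s j), fun j => (s j).2.1, rfl⟩

lemma IsOrbit.exists_prepend (habc : a * b * c ≠ 0)
    (hne : ¬ (a ^ 3 = c ^ 3 ∧ b ^ 3 = c ^ 3)) (m : ℕ) {F : ℕ → Fin 3 → k}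
    (hF : IsOrbit a b c F) (hF0 : ∀ j, F j ≠ 0) :
    ∃ P : ℕ → Fin 3 → k, IsOrbit a b c P ∧ (∀ j, P j ≠ 0) ∧ ∀ j, P (j + m) = F j := by
  induction m generalizing F with
  | zero => exact ⟨F, hF, hF0, fun _ => rfl⟩
  | succ m ih =>
    obtain ⟨q, hq, h⟩ := exists_incident' habc hne (hF0 0) ((hF 0).cubicForm_left (hF0 1))
    obtain ⟨P, hP, hP0, hPF⟩ := ih (F := fun n => Nat.casesOn n q F)
      (by rintro (_ | j); exacts [h, hF j]) (by rintro (_ | j); exacts [hq, hF0 j])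
    exact ⟨P, hP, hP0, fun j => by rw [add_comm m 1, ← add_assoc, hPF]⟩

/-- There are orbits passing through a given point of the cubic at a given time. -/
lemma exists_orbit (habc : a * b * c ≠ 0) (hne : ¬ (a ^ 3 = c ^ 3 ∧ b ^ 3 = c ^ 3)) (m : ℕ)
    {p : Fin 3 → k} (hp : p ≠ 0) (hΦ : cubicForm a b c p = 0) :
    ∃ P : ℕ → Fin 3 → k, IsOrbit a b c P ∧ (∀ j, P j ≠ 0) ∧ P m = p := by
  obtain ⟨F, hF, hF0, rfl⟩ := exists_orbit_zero habc hne hp hΦ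
  obtain ⟨P, hP, hP0, h⟩ := hF.exists_prepend habc hne m hF0
  exact ⟨P, hP, hP0, by rw [← h, zero_add]⟩

variable (a b c) in
/-- The linear forms vanishing at a point. -/
def pointForms (p : Fin 3 → k) : Submodule k (Sklyanin k a b c) :=
  Submodule.span k (Set.range fun ij : Fin 3 × Fin 3 => p ij.1 • gen ij.2 - p ij.2 • gen ij.1)

lemma pointForms_mem (p : Fin 3 → k) (i j : Fin 3) :
    p i • gen j - p j • gen i ∈ pointForms a b c p :=
  Submodule.subset_span ⟨(i, j), rfl⟩

lemma pointForms_le (p : Fin 3 → k) : pointForms a b c p ≤ linForms k a b c := by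
  refine Submodule.span_le.2 ?_
  rintro _ ⟨⟨i, j⟩, rfl⟩
  exact sub_mem (Submodule.smul_mem _ _ (gen_mem _)) (Submodule.smul_mem _ _ (gen_mem _))

lemma pointForms_smul_le {ν : k} (hν : ν ≠ 0) (p : Fin 3 → k) :
    pointForms a b c p ≤ pointForms a b c (ν • p) := by
  refine Submodule.span_le.2 ?_
  rintro _ ⟨⟨i, j⟩, rfl⟩
  have := Submodule.smul_mem _ ν⁻¹ (pointForms_mem (a := a) (b := b) (c := c) (ν • p) i j)
  simpa [smul_sub, smul_smul, hν] using this

/-- Modulo the forms vanishing at `p`, left multiplication by a linear form only depends on its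
value at `p`. -/
lemma smul_sum_sub_mem (p : Fin 3 → k) (l : Fin 3) (M : Submodule k (Sklyanin k a b c))
    (t : Fin 3 → Sklyanin k a b c) (ht : ∀ i, t i ∈ M) :
    p l • ∑ i, gen i * t i - gen l * ∑ i, p i • t i ∈ pointForms a b c p * M := by
  have : p l • ∑ i, gen i * t i - gen l * ∑ i, p i • t i =
      ∑ i, (p l • gen i - p i • gen l) * t i := by
    simp only [Finset.smul_sum, Finset.mul_sum, ← Finset.sum_sub_distrib, sub_mul,
      smul_mul_assoc, mul_smul_comm]
  rw [this]
  exact sum_mem fun i _ => Submodule.mul_mem_mul (pointForms_mem p l i) (ht i)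

variable (k a b c) in
/-- The coefficients of the defining relations: `∑ i, gen i * relCoeff j i = 0`. -/
def relCoeff : Fin 3 → Fin 3 → Sklyanin k a b c :=
  ![![c • X k a b c, a • Z k a b c, b • Y k a b c], ![b • Z k a b c, c • Y k a b c, a • X k a b c],
    ![a • Y k a b c, b • X k a b c, c • Z k a b c]]

lemma relCoeff_mem (j i : Fin 3) : relCoeff k a b c j i ∈ linForms k a b c := by
  fin_cases j <;> fin_cases i <;> refine Submodule.smul_mem _ _ ?_ <;>
    first | exact X_mem | exact Y_mem | exact Z_mem

lemma sum_gen_mul_relCoeff (j : Fin 3) : ∑ i, gen i * relCoeff k a b c j i = 0 := by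
  fin_cases j
  · rw [← rel_YZ]; simp [Fin.sum_univ_three, gen, relCoeff]; abel
  · rw [← rel_ZX]; simp [Fin.sum_univ_three, gen, relCoeff]; abel
  · rw [← rel_XY]; simp [Fin.sum_univ_three, gen, relCoeff]

lemma gen_mul_relForm_mem (p : Fin 3 → k) (l j : Fin 3) :
    gen l * ∑ i, p i • relCoeff k a b c j i ∈ pointForms a b c p * linForms k a b c := by
  have := smul_sum_sub_mem p l (linForms k a b c) (relCoeff k a b c j) (relCoeff_mem j)
  rw [sum_gen_mul_relCoeff, smul_zero, zero_sub] at this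
  exact neg_mem_iff.1 this

lemma pointForms_rowCross_le (p : Fin 3 → k) (α : Fin 3) :
    pointForms a b c (rowCross a b c p α) ≤
      Submodule.span k (Set.range fun j => ∑ i, p i • relCoeff k a b c j i) := by
  refine Submodule.span_le.2 ?_
  set M : Submodule k (Sklyanin k a b c) :=
    Submodule.span k (Set.range fun j => ∑ i, p i • relCoeff k a b c j i)
  have hM {s : Sklyanin k a b c} (h : ∃ u v w : k, s = u • ∑ i, p i • relCoeff k a b c 0 i +
      v • ∑ i, p i • relCoeff k a b c 1 i + w • ∑ i, p i • relCoeff k a b c 2 i) : s ∈ M := by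
    obtain ⟨u, v, w, rfl⟩ := h
    exact add_mem (add_mem (Submodule.smul_mem _ _ (Submodule.subset_span ⟨0, rfl⟩))
      (Submodule.smul_mem _ _ (Submodule.subset_span ⟨1, rfl⟩)))
      (Submodule.smul_mem _ _ (Submodule.subset_span ⟨2, rfl⟩))
  have key : rowCross a b c p α 0 • Y k a b c - rowCross a b c p α 1 • X k a b c ∈ M ∧
      rowCross a b c p α 1 • Z k a b c - rowCross a b c p α 2 • Y k a b c ∈ M ∧
      rowCross a b c p α 2 • X k a b c - rowCross a b c p α 0 • Z k a b c ∈ M := by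
    refine ⟨hM ?_, hM ?_, hM ?_⟩ <;> simp only [Fin.sum_univ_three, relCoeff, rowCross] <;>
      fin_cases α <;> simp only [Fin.mk_zero, Fin.mk_one, Fin.reduceFinMk, Matrix.cons_val]
    · exact ⟨0, c * p 2, -(b * p 0), by module⟩
    · exact ⟨-(c * p 2), 0, a * p 1, by module⟩
    · exact ⟨b * p 0, -(a * p 1), 0, by module⟩
    · exact ⟨0, b * p 1, -(a * p 2), by module⟩
    · exact ⟨-(b * p 1), 0, c * p 0, by module⟩
    · exact ⟨a * p 2, -(c * p 0), 0, by module⟩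
    · exact ⟨0, a * p 0, -(c * p 1), by module⟩
    · exact ⟨-(a * p 0), 0, b * p 2, by module⟩
    · exact ⟨c * p 1, -(b * p 2), 0, by module⟩
  obtain ⟨h₁, h₂, h₃⟩ := key
  have hneg {r s : k} {u v : Sklyanin k a b c} (h : r • u - s • v ∈ M) : s • v - r • u ∈ M := by
    rw [← neg_sub]; exact neg_mem h
  rintro _ ⟨⟨i, j⟩, rfl⟩
  fin_cases i <;> fin_cases j
  · simp
  · exact h₁
  · exact hneg h₃
  · exact hneg h₁
  · simp
  · exact h₂
  · exact h₃
  · exact hneg h₂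
  · simp

lemma gen_mul_pointForms_mem (habc : a * b * c ≠ 0)
    (hne : ¬ (a ^ 3 = c ^ 3 ∧ b ^ 3 = c ^ 3)) {p q : Fin 3 → k} (hp : p ≠ 0) (hq : q ≠ 0)
    (h : Incident a b c p q) (l : Fin 3) {v : Sklyanin k a b c} (hv : v ∈ pointForms a b c q) :
    gen l * v ∈ pointForms a b c p * linForms k a b c := by
  obtain ⟨α, i, hi⟩ := exists_rowCross_ne_zero habc hne hp
  obtain ⟨m, hqm : q m ≠ 0⟩ := Function.ne_iff.1 hq
  have hmi : rowCross a b c p α m ≠ 0 := by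
    intro h0
    have := h.rowCross_mul α i m
    rw [h0, zero_mul] at this
    exact (mul_ne_zero hi hqm) this
  have hpar : rowCross a b c p α = (rowCross a b c p α m / q m) • q := by
    ext j
    have := h.rowCross_mul α j m
    simp only [Pi.smul_apply, smul_eq_mul]
    field_simp
    linear_combination this
  have hv' : v ∈ pointForms a b c (rowCross a b c p α) := by
    rw [hpar]
    exact pointForms_smul_le (div_ne_zero hmi hqm) q hv
  replace hv' := pointForms_rowCross_le p α hv'
  clear hv
  induction hv' using Submodule.span_induction with
  | mem x hx => obtain ⟨j, rfl⟩ := hx; exact gen_mul_relForm_mem p l j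
  | zero => rw [mul_zero]; exact zero_mem _
  | add x y _ _ hx hy => rw [mul_add]; exact add_mem hx hy
  | smul r x _ hx => rw [mul_smul_comm]; exact Submodule.smul_mem _ _ hx

/-- The annihilator of the generator of a point module is generated in degree one. -/
lemma IsOrbit.mem_pointForms_mul (habc : a * b * c ≠ 0)
    (hne : ¬ (a ^ 3 = c ^ 3 ∧ b ^ 3 = c ^ 3)) {P : ℕ → Fin 3 → k} (hP : IsOrbit a b c P)
    (hP0 : ∀ j, P j ≠ 0) {n : ℕ} {u : Sklyanin k a b c} (hu : u ∈ deg k a b c (n + 1)) (j : ℕ)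
    (h : hP.ev j u = 0) : u ∈ pointForms a b c (P j) * deg k a b c n := by
  obtain ⟨l, hl : P j l ≠ 0⟩ := Function.ne_iff.1 (hP0 j)
  have hsum {n : ℕ} {u : Sklyanin k a b c} (hu : u ∈ deg k a b c (n + 1)) :
      ∃ t : Fin 3 → Sklyanin k a b c, (∀ i, t i ∈ deg k a b c n) ∧ u = ∑ i, gen i * t i := by
    obtain ⟨s, hs, t, ht, r, hr, rfl⟩ := mem_deg_succ hu
    refine ⟨![s, t, r], ?_, by simp [Fin.sum_univ_three, gen]⟩
    intro i
    fin_cases i <;> assumption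
  induction n generalizing u j l with
  | zero =>
    obtain ⟨t, ht, rfl⟩ := hsum hu
    have h₁ := smul_sum_sub_mem (P j) l _ t ht
    have h₂ : ∑ i, P j i • t i = 0 := by
      choose r hr using fun i => mem_deg_zero (ht i)
      simp only [map_sum, ev_gen_mul, hr, ev_algebraMap, Algebra.algebraMap_self,
        RingHom.id_apply] at h
      simp only [hr, Algebra.smul_def, ← map_mul, ← map_sum, h, map_zero]
    rw [h₂, mul_zero, sub_zero] at h₁
    exact (Submodule.smul_mem_iff _ hl).1 h₁
  | succ n ih =>
    obtain ⟨t, ht, rfl⟩ := hsum hu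
    have h₁ := smul_sum_sub_mem (P j) l _ t ht
    have h₂ : hP.ev (j + 1) (∑ i, P j i • t i) = 0 := by
      rw [← h]
      simp only [map_sum, ev_gen_mul, map_smul, smul_eq_mul]
    obtain ⟨l', hl'⟩ := Function.ne_iff.1 (hP0 (j + 1))
    have h₃ := ih (sum_mem fun i _ => Submodule.smul_mem _ (P j i) (ht i)) (j + 1) h₂ l' hl'
    have h₄ : gen l * ∑ i, P j i • t i ∈ pointForms a b c (P j) * deg k a b c (n + 1) := by
      rw [deg, pow_succ', ← mul_assoc]
      generalize ∑ i, P j i • t i = w at h₃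
      induction h₃ using Submodule.mul_induction_on' with
      | mem_mul_mem v hv w hw =>
        rw [← mul_assoc]
        exact Submodule.mul_mem_mul
          (gen_mul_pointForms_mem habc hne (hP0 j) (hP0 (j + 1)) (hP j) l hv) hw
      | add x _ y _ hx hy => rw [mul_add]; exact add_mem hx hy
    exact (Submodule.smul_mem_iff _ hl).1 (by simpa using add_mem h₁ h₄)

end pointModules

end Sklyanin

namespace Sklyanin

open Polynomial

section basePoints

variable {k : Type*} [Field k] {a b c : k}

lemma exists_primitive_cube_root (k : Type*) [Field k] [IsAlgClosed k] :
    ∃ ζ : k, 1 + ζ + ζ ^ 2 = 0 := by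
  have h : (Polynomial.X ^ 2 + Polynomial.X + 1 : Polynomial k).degree = 2 := by compute_degree!
  obtain ⟨ζ, hζ⟩ := IsAlgClosed.exists_root _ (by rw [h]; exact two_ne_zero)
  refine ⟨ζ, ?_⟩
  simp only [Polynomial.IsRoot.def, Polynomial.eval_add, Polynomial.eval_pow, Polynomial.eval_X,
    Polynomial.eval_one] at hζ
  linear_combination hζ

/-- The powers of the cube roots of unity separate three coefficients. -/
lemma eq_zero_of_cube_roots [IsAlgClosed k] [CharZero k] {A B C : k}
    (h : ∀ ω : k, ω ^ 3 = 1 → A + B * ω + C * ω ^ 2 = 0) : A = 0 ∧ B = 0 ∧ C = 0 := by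
  obtain ⟨ζ, hζ⟩ := exists_primitive_cube_root k
  have hζ3 : ζ ^ 3 = 1 := by linear_combination (ζ - 1) * hζ
  have h₀ := h 1 (one_pow 3)
  have h₁ := h ζ hζ3
  have h₂ := h (ζ ^ 2) (by rw [← pow_mul, mul_comm, pow_mul, hζ3, one_pow])
  have h3 : (3 : k) ≠ 0 := three_ne_zero
  refine ⟨?_, ?_, ?_⟩ <;> refine (mul_eq_zero.1 ?_).resolve_left h3
  · linear_combination h₀ + h₁ + h₂ - (B + C * (1 + ζ ^ 2 - ζ)) * hζ
  · linear_combination h₀ + ζ ^ 2 * h₁ + ζ * h₂ -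
      (A + C * (ζ ^ 2 - ζ + 1) + 2 * B * (ζ - 1) + C * ζ ^ 2 * (ζ - 1)) * hζ
  · linear_combination h₀ + ζ * h₁ + ζ ^ 2 * h₂ -
      (A + B * (1 - ζ + ζ ^ 2) + C * (ζ - 1) * (ζ ^ 3 + 2)) * hζ

variable (a b c) in
/-- Vanishing at the three points `(0 : 1 : -ω)` of the cubic. -/
def BaseVanish (u : Sklyanin k a b c) : Prop :=
  ∀ ω : k, ω ^ 3 = 1 → ∀ (P : ℕ → Fin 3 → k) (hP : IsOrbit a b c P), (∀ j, P j ≠ 0) →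
    P 0 = ![0, 1, -ω] → hP.ev 0 u = 0

lemma exists_base_orbit (habc : a * b * c ≠ 0) (hne : ¬ (a ^ 3 = c ^ 3 ∧ b ^ 3 = c ^ 3)) {ω : k}
    (hω : ω ^ 3 = 1) (m : ℕ) :
    ∃ P : ℕ → Fin 3 → k, IsOrbit a b c P ∧ (∀ j, P j ≠ 0) ∧ P m = ![0, 1, -ω] := by
  refine exists_orbit habc hne m (Function.ne_iff.2 ⟨1, one_ne_zero⟩) ?_
  simp only [cubicForm, Matrix.cons_val]
  linear_combination a * b * c * hω

lemma IsOrbit.base_one (habc : a * b * c ≠ 0) {P : ℕ → Fin 3 → k} (hP : IsOrbit a b c P)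
    (hP0 : ∀ j, P j ≠ 0) {ω : k} (h : P 0 = ![0, 1, -ω]) :
    ∃ τ : k, τ ≠ 0 ∧ P 1 = τ • ![c, a * ω, b * ω ^ 2] := by
  obtain ⟨⟨ha, hb⟩, hc⟩ : (a ≠ 0 ∧ b ≠ 0) ∧ c ≠ 0 := by simpa using habc
  obtain ⟨h₁, h₂, h₃⟩ := hP 0
  simp only [h, Matrix.cons_val, Algebra.algebraMap_self, RingHom.id_apply, zero_add] at h₁ h₂ h₃
  have key : P 1 = (P 1 0 / c) • ![c, a * ω, b * ω ^ 2] := by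
    ext i
    fin_cases i <;> simp
    · field_simp
    · field_simp; linear_combination h₂
    · field_simp
      apply mul_left_cancel₀ ha
      linear_combination c * h₁ + b * ω * h₂
  refine ⟨_, ?_, key⟩
  intro h0
  rw [h0, zero_smul] at key
  exact hP0 1 key

lemma IsOrbit.base_two (habc : a * b * c ≠ 0) (hne : ¬ (a ^ 3 = c ^ 3 ∧ b ^ 3 = c ^ 3))
    {P : ℕ → Fin 3 → k} (hP : IsOrbit a b c P)
    (hP0 : ∀ j, P j ≠ 0) {ω : k} (hω : ω ^ 3 = 1) (h : P 0 = ![0, 1, -ω]) :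
    ∃ σ : k, σ ≠ 0 ∧ P 2 = σ • ![c * (a ^ 3 - b ^ 3), b * (c ^ 3 - a ^ 3) * ω,
      a * (b ^ 3 - c ^ 3) * ω ^ 2] := by
  obtain ⟨⟨ha, hb⟩, hc⟩ : (a ≠ 0 ∧ b ≠ 0) ∧ c ≠ 0 := by simpa using habc
  obtain ⟨τ, hτ, hP1⟩ := hP.base_one habc hP0 h
  have hω0 : ω ≠ 0 := by rintro rfl; simp at hω
  set v : Fin 3 → k := ![c * (a ^ 3 - b ^ 3), b * (c ^ 3 - a ^ 3) * ω,
      a * (b ^ 3 - c ^ 3) * ω ^ 2] with hv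
  have hcross : rowCross a b c (P 1) 1 = (τ ^ 2 * ω) • v := by
    rw [hP1, hv]
    ext i
    fin_cases i <;> simp [rowCross]
    · linear_combination - τ ^ 2 * b ^ 3 * c * ω * hω
    · ring
    · linear_combination τ ^ 2 * a * c ^ 3 * hω
  have hpar := (hP 1).rowCross_mul 1
  simp only [Algebra.algebraMap_self, RingHom.id_apply, hcross, Pi.smul_apply, smul_eq_mul,
    mul_assoc, mul_right_inj' (pow_ne_zero 2 hτ), mul_right_inj' hω0] at hpar
  obtain ⟨i, hi⟩ : ∃ i, v i ≠ 0 := by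
    by_contra! h0
    have h1 := h0 1
    have h2 := h0 2
    simp [hv, hb, ha, hω0, sub_eq_zero] at h1 h2
    exact hne ⟨h1.symm, h2⟩
  have key : P 2 = (P 2 i / v i) • v := by
    ext j
    have := hpar i j
    simp only [Pi.smul_apply, smul_eq_mul]
    field_simp
    linear_combination this
  refine ⟨_, ?_, key⟩
  intro h0
  rw [h0, zero_smul] at key
  exact hP0 2 key

end basePoints

end Sklyanin

namespace Sklyanin

section cross

variable {k E : Type*} [Field k] [AddCommGroup E] [Module k E]

lemma sum_mem_of_cross (M : Submodule k E) {w₀ w₁ w₂ : E} {r₀ r₁ r₂ s₀ s₁ s₂ α₀ α₁ α₂ : k}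
    (hr : r₀ • w₀ + r₁ • w₁ + r₂ • w₂ ∈ M) (hs : s₀ • w₀ + s₁ • w₁ + s₂ • w₂ ∈ M)
    (hne : ¬ (r₁ * s₂ - r₂ * s₁ = 0 ∧ r₂ * s₀ - r₀ * s₂ = 0 ∧ r₀ * s₁ - r₁ * s₀ = 0))
    (h : α₀ * (r₁ * s₂ - r₂ * s₁) + α₁ * (r₂ * s₀ - r₀ * s₂) + α₂ * (r₀ * s₁ - r₁ * s₀) = 0) :
    α₀ • w₀ + α₁ • w₁ + α₂ • w₂ ∈ M := by
  have key {φ u v : k} {w : E} (hφ : φ ≠ 0)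
      (e : φ • (α₀ • w₀ + α₁ • w₁ + α₂ • w₂) = u • (r₀ • w₀ + r₁ • w₁ + r₂ • w₂) +
        v • (s₀ • w₀ + s₁ • w₁ + s₂ • w₂) + (α₀ * (r₁ * s₂ - r₂ * s₁) +
        α₁ * (r₂ * s₀ - r₀ * s₂) + α₂ * (r₀ * s₁ - r₁ * s₀)) • w) :
      α₀ • w₀ + α₁ • w₁ + α₂ • w₂ ∈ M := by
    rw [h, zero_smul, add_zero] at e
    refine (Submodule.smul_mem_iff _ hφ).1 ?_
    rw [e]
    exact add_mem (Submodule.smul_mem _ _ hr) (Submodule.smul_mem _ _ hs)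
  by_cases h₀ : r₁ * s₂ - r₂ * s₁ = 0
  · by_cases h₁ : r₂ * s₀ - r₀ * s₂ = 0
    · have h₂ : r₀ * s₁ - r₁ * s₀ ≠ 0 := fun h₂ => hne ⟨h₀, h₁, h₂⟩
      exact key (u := α₀ * s₁ - α₁ * s₀) (v := α₁ * r₀ - α₀ * r₁) (w := w₂) h₂ (by module)
    · exact key (u := α₂ * s₀ - α₀ * s₂) (v := α₀ * r₂ - α₂ * r₀) (w := w₁) h₁ (by module)
  · exact key (u := α₁ * s₂ - α₂ * s₁) (v := α₂ * r₁ - α₁ * r₂) (w := w₀) h₀ (by module)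

lemma mem_of_cube_roots [IsAlgClosed k] [CharZero k] (M : Submodule k E) {A B C : E}
    (h : ∀ ω : k, ω ^ 3 = 1 → A + ω • B + ω ^ 2 • C ∈ M) : A ∈ M := by
  obtain ⟨ζ, hζ⟩ := exists_primitive_cube_root k
  have hζ3 : ζ ^ 3 = 1 := by linear_combination (ζ - 1) * hζ
  have h' := add_mem (add_mem (h 1 (one_pow 3)) (h ζ hζ3))
    (h (ζ ^ 2) (by rw [← pow_mul, mul_comm, pow_mul, hζ3, one_pow]))
  have e : A + (1 : k) • B + (1 : k) ^ 2 • C + (A + ζ • B + ζ ^ 2 • C) +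
      (A + ζ ^ 2 • B + (ζ ^ 2) ^ 2 • C) =
      (3 : k) • A + (1 + ζ + ζ ^ 2) • (B + (1 - ζ + ζ ^ 2) • C) := by module
  rw [e, hζ, zero_smul, add_zero] at h'
  exact (Submodule.smul_mem_iff _ three_ne_zero).1 h'

end cross

section baseLocus

variable {k : Type*} [Field k] {a b c : k}

lemma Y_mul_X (hb : b ≠ 0) (t : Sklyanin k a b c) : Y k a b c * (X k a b c * t) =
    (-(a / b)) • (X k a b c * (Y k a b c * t)) + (-(c / b)) • (Z k a b c * (Z k a b c * t)) := by
  have h : b⁻¹ • ((a • (X k a b c * Y k a b c) + b • (Y k a b c * X k a b c)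
      + c • (Z k a b c * Z k a b c)) * t) = 0 := by rw [rel_XY]; simp
  simp only [add_mul, smul_mul_assoc, mul_assoc] at h
  rw [← sub_eq_zero, ← h, ← mul_inv_cancel_left₀ hb b⁻¹]
  match_scalars <;> field_simp

lemma Z_mul_X (ha : a ≠ 0) (t : Sklyanin k a b c) : Z k a b c * (X k a b c * t) =
    (-(b / a)) • (X k a b c * (Z k a b c * t)) + (-(c / a)) • (Y k a b c * (Y k a b c * t)) := by
  have h : a⁻¹ • ((a • (Z k a b c * X k a b c) + b • (X k a b c * Z k a b c)
      + c • (Y k a b c * Y k a b c)) * t) = 0 := by rw [rel_ZX]; simp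
  simp only [add_mul, smul_mul_assoc, mul_assoc] at h
  rw [← sub_eq_zero, ← h]
  match_scalars <;> field_simp

lemma Z_mul_Y (hb : b ≠ 0) (t : Sklyanin k a b c) : Z k a b c * (Y k a b c * t) =
    (-(a / b)) • (Y k a b c * (Z k a b c * t)) + (-(c / b)) • (X k a b c * (X k a b c * t)) := by
  have h : b⁻¹ • ((a • (Y k a b c * Z k a b c) + b • (Z k a b c * Y k a b c)
      + c • (X k a b c * X k a b c)) * t) = 0 := by rw [rel_YZ]; simp
  simp only [add_mul, smul_mul_assoc, mul_assoc] at h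
  rw [← sub_eq_zero, ← h]
  match_scalars <;> field_simp

lemma X_mem_deg : X k a b c ∈ deg k a b c 1 := by rw [deg_one]; exact X_mem

lemma Y_mem_deg : Y k a b c ∈ deg k a b c 1 := by rw [deg_one]; exact Y_mem

lemma Z_mem_deg : Z k a b c ∈ deg k a b c 1 := by rw [deg_one]; exact Z_mem

lemma X_mul_mem {n : ℕ} {t : Sklyanin k a b c} (ht : t ∈ deg k a b c n) :
    X k a b c * t ∈ deg k a b c (n + 1) := by
  rw [add_comm]; exact mul_mem_deg X_mem_deg ht

lemma Y_mul_mem {n : ℕ} {t : Sklyanin k a b c} (ht : t ∈ deg k a b c n) :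
    Y k a b c * t ∈ deg k a b c (n + 1) := by
  rw [add_comm]; exact mul_mem_deg Y_mem_deg ht

lemma Z_mul_mem {n : ℕ} {t : Sklyanin k a b c} (ht : t ∈ deg k a b c n) :
    Z k a b c * t ∈ deg k a b c (n + 1) := by
  rw [add_comm]; exact mul_mem_deg Z_mem_deg ht

/-- Modulo left multiples of `x`, everything is a combination of `yy`, `yz` and `zz`. -/
lemma exists_normalForm (habc : a * b * c ≠ 0) {n : ℕ} {u : Sklyanin k a b c}
    (hu : u ∈ deg k a b c (n + 2)) :
    ∃ u' ∈ deg k a b c (n + 1), ∃ s₁ ∈ deg k a b c n, ∃ s₂ ∈ deg k a b c n,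
      ∃ s₃ ∈ deg k a b c n, u = X k a b c * u' + Y k a b c * (Y k a b c * s₁) +
        Y k a b c * (Z k a b c * s₂) + Z k a b c * (Z k a b c * s₃) := by
  obtain ⟨⟨ha, hb⟩, hc⟩ : (a ≠ 0 ∧ b ≠ 0) ∧ c ≠ 0 := by simpa using habc
  obtain ⟨s, hs, t, ht, r, hr, rfl⟩ := mem_deg_succ hu
  obtain ⟨t₀, ht₀, t₁, ht₁, t₂, ht₂, rfl⟩ := mem_deg_succ ht
  obtain ⟨r₀, hr₀, r₁, hr₁, r₂, hr₂, rfl⟩ := mem_deg_succ hr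
  refine ⟨s + (-(a / b)) • (Y k a b c * t₀) + (-(b / a)) • (Z k a b c * r₀) +
    (-(c / b)) • (X k a b c * r₁), ?_, t₁ + (-(c / a)) • r₀, ?_, t₂ + (-(a / b)) • r₁, ?_,
    r₂ + (-(c / b)) • t₀, ?_, ?_⟩
  · exact add_mem (add_mem (add_mem hs (Submodule.smul_mem _ _ (Y_mul_mem ht₀)))
      (Submodule.smul_mem _ _ (Z_mul_mem hr₀))) (Submodule.smul_mem _ _ (X_mul_mem hr₁))
  · exact add_mem ht₁ (Submodule.smul_mem _ _ hr₀)
  · exact add_mem ht₂ (Submodule.smul_mem _ _ hr₁)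
  · exact add_mem hr₂ (Submodule.smul_mem _ _ ht₀)
  · simp only [mul_add, mul_smul_comm, Y_mul_X hb, Z_mul_X ha, Z_mul_Y hb]
    module

lemma IsOrbit.ev_normalForm (habc : a * b * c ≠ 0) {P : ℕ → Fin 3 → k} (hP : IsOrbit a b c P)
    (hP0 : ∀ j, P j ≠ 0) {ω : k} (hω : ω ^ 3 = 1) (h : P 0 = ![0, 1, -ω])
    {u s₁ s₂ s₃ : Sklyanin k a b c} (h0 : hP.ev 0 (X k a b c * u + Y k a b c * (Y k a b c * s₁) +
        Y k a b c * (Z k a b c * s₂) + Z k a b c * (Z k a b c * s₃)) = 0) :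
    a * ω * hP.ev 2 s₁ + b * ω ^ 2 * hP.ev 2 s₂ - b * hP.ev 2 s₃ = 0 := by
  obtain ⟨τ, hτ, h₁⟩ := hP.base_one habc hP0 h
  simp only [map_add, ev_X_mul, ev_Y_mul, ev_Z_mul, zero_add, h, h₁, Pi.smul_apply,
    Matrix.cons_val, smul_eq_mul] at h0
  apply mul_left_cancel₀ hτ
  linear_combination h0 + τ * b * hP.ev 2 s₃ * hω

variable [IsAlgClosed k] [CharZero k]

lemma BaseVanish.of_deg_one (habc : a * b * c ≠ 0) (hne : ¬ (a ^ 3 = c ^ 3 ∧ b ^ 3 = c ^ 3))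
    {u : Sklyanin k a b c} (hu : u ∈ deg k a b c 1) (h : BaseVanish a b c u) :
    ∃ s ∈ deg k a b c 0, u = X k a b c * s := by
  rw [deg_one] at hu
  obtain ⟨α, β, γ, rfl⟩ := mem_linForms hu
  obtain ⟨hβ, hγ, -⟩ := eq_zero_of_cube_roots (A := β) (B := -γ) (C := 0) fun ω hω => by
    obtain ⟨P, hP, hP0, hPω⟩ := exists_base_orbit habc hne hω 0
    have := h ω hω P hP hP0 hPω
    simp only [map_add, map_smul, IsOrbit.ev_X, IsOrbit.ev_Y, IsOrbit.ev_Z, hPω,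
      Matrix.cons_val, smul_eq_mul] at this
    linear_combination this
  refine ⟨algebraMap k _ α, algebraMap_mem_deg α, ?_⟩
  rw [← Algebra.commutes, ← Algebra.smul_def, hβ, neg_eq_zero.1 hγ]
  simp

lemma BaseVanish.of_deg_two (habc : a * b * c ≠ 0) (hne : ¬ (a ^ 3 = c ^ 3 ∧ b ^ 3 = c ^ 3))
    {u : Sklyanin k a b c} (hu : u ∈ deg k a b c 2) (h : BaseVanish a b c u) :
    ∃ s ∈ deg k a b c 1, u = X k a b c * s := by
  obtain ⟨⟨ha, hb⟩, hc⟩ : (a ≠ 0 ∧ b ≠ 0) ∧ c ≠ 0 := by simpa using habc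
  obtain ⟨u', hu', s₁, hs₁, s₂, hs₂, s₃, hs₃, rfl⟩ := exists_normalForm habc hu
  refine ⟨u', hu', ?_⟩
  obtain ⟨r₁, rfl⟩ := mem_deg_zero hs₁
  obtain ⟨r₂, rfl⟩ := mem_deg_zero hs₂
  obtain ⟨r₃, rfl⟩ := mem_deg_zero hs₃
  obtain ⟨h₃, h₁, h₂⟩ := eq_zero_of_cube_roots (A := -(b * r₃)) (B := a * r₁) (C := b * r₂)
    fun ω hω => by
      obtain ⟨P, hP, hP0, hPω⟩ := exists_base_orbit habc hne hω 0
      have := hP.ev_normalForm habc hP0 hω hPω (h ω hω P hP hP0 hPω)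
      simp only [IsOrbit.ev_algebraMap, Algebra.algebraMap_self, RingHom.id_apply] at this
      linear_combination this
  simp only [neg_eq_zero, mul_eq_zero, ha, hb, false_or] at h₁ h₂ h₃
  simp [h₁, h₂, h₃]

end baseLocus

end Sklyanin

namespace Sklyanin

section baseLocus

variable {k : Type*} [Field k] {a b c : k}

variable (k a b c) in
/-- The degree `n + 3` part of `x S + g S`. -/
def baseIdeal (n : ℕ) : Submodule k (Sklyanin k a b c) :=
  (deg k a b c (n + 2)).map (LinearMap.mulLeft k (X k a b c)) ⊔
    (deg k a b c n).map (LinearMap.mulLeft k (g k a b c))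

lemma mem_baseIdeal {n : ℕ} {u : Sklyanin k a b c} :
    u ∈ baseIdeal k a b c n ↔ ∃ s ∈ deg k a b c (n + 2), ∃ w ∈ deg k a b c n,
      u = X k a b c * s + g k a b c * w := by
  simp only [baseIdeal, Submodule.mem_sup, Submodule.mem_map, LinearMap.mulLeft_apply]
  constructor
  · rintro ⟨_, ⟨s, hs, rfl⟩, _, ⟨w, hw, rfl⟩, rfl⟩
    exact ⟨s, hs, w, hw, rfl⟩
  · rintro ⟨s, hs, w, hw, rfl⟩
    exact ⟨_, ⟨s, hs, rfl⟩, _, ⟨w, hw, rfl⟩, rfl⟩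

lemma X_mul_mem_baseIdeal {n : ℕ} {s : Sklyanin k a b c} (hs : s ∈ deg k a b c (n + 2)) :
    X k a b c * s ∈ baseIdeal k a b c n :=
  mem_baseIdeal.2 ⟨s, hs, 0, zero_mem _, by simp⟩

lemma mul_mem_baseIdeal {m n : ℕ} {u t : Sklyanin k a b c} (hu : u ∈ baseIdeal k a b c m)
    (ht : t ∈ deg k a b c n) : u * t ∈ baseIdeal k a b c (m + n) := by
  obtain ⟨s, hs, w, hw, rfl⟩ := mem_baseIdeal.1 hu
  refine mem_baseIdeal.2 ⟨s * t, ?_, w * t, mul_mem_deg hw ht, by noncomm_ring⟩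
  rw [add_right_comm]
  exact mul_mem_deg hs ht

variable (habc : a * b * c ≠ 0) (hne : ¬ (a ^ 3 = c ^ 3 ∧ b ^ 3 = c ^ 3))

section cubicWords

include hne

lemma weight_one_mem (habc : a * b * c ≠ 0) {α β γ : k}
    (h : α * (a ^ 2 * (b ^ 3 - c ^ 3)) + β * (b ^ 2 * (c ^ 3 - a ^ 3)) +
      γ * (b * c * (b ^ 3 - a ^ 3)) = 0) :
    α • (Y k a b c * (Y k a b c * Z k a b c)) + β • (Y k a b c * (Z k a b c * Y k a b c)) +
    γ • (Z k a b c * (Z k a b c * X k a b c)) ∈ baseIdeal k a b c 0 := by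
  obtain ⟨⟨ha, hb⟩, hc⟩ : (a ≠ 0 ∧ b ≠ 0) ∧ c ≠ 0 := by simpa using habc
  refine sum_mem_of_cross _ (r₀ := a * b) (r₁ := b ^ 2) (r₂ := -c ^ 2) (s₀ := -(b ^ 2 * c))
    (s₁ := -(a ^ 2 * c)) (s₂ := a ^ 2 * b) ?_ ?_ ?_ (by linear_combination h)
  · have e : (a * b) • (Y k a b c * (Y k a b c * Z k a b c)) +
        b ^ 2 • (Y k a b c * (Z k a b c * Y k a b c)) +
        (-c ^ 2) • (Z k a b c * (Z k a b c * X k a b c)) =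
        X k a b c * ((a * c) • (Y k a b c * X k a b c)) := by
      have h₁ := congrArg (Y k a b c * ·) (rel_YZ (a := a) (b := b) (c := c))
      have h₂ := congrArg (· * X k a b c) (rel_XY (a := a) (b := b) (c := c))
      simp only [mul_add, add_mul, smul_mul_assoc, mul_smul_comm, mul_assoc, mul_zero,
        zero_mul] at h₁ h₂ ⊢
      linear_combination (norm := module) b • h₁ - c • h₂
    rw [e]
    exact X_mul_mem_baseIdeal (Submodule.smul_mem _ _ (Y_mul_mem X_mem_deg))
  · have e : (-(b ^ 2 * c)) • (Y k a b c * (Y k a b c * Z k a b c)) +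
        (-(a ^ 2 * c)) • (Y k a b c * (Z k a b c * Y k a b c)) +
        (a ^ 2 * b) • (Z k a b c * (Z k a b c * X k a b c)) =
        X k a b c * (b ^ 3 • (Z k a b c * Z k a b c) + (a * c ^ 2) • (X k a b c * Y k a b c)) := by
      have h₁ := congrArg (Z k a b c * ·) (rel_ZX (a := a) (b := b) (c := c))
      have h₂ := congrArg (· * Z k a b c) (rel_ZX (a := a) (b := b) (c := c))
      have h₃ := congrArg (· * Y k a b c) (rel_YZ (a := a) (b := b) (c := c))
      simp only [mul_add, add_mul, smul_mul_assoc, mul_smul_comm, mul_assoc, mul_zero,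
        zero_mul] at h₁ h₂ h₃ ⊢
      linear_combination (norm := module) (a * b) • h₁ - b ^ 2 • h₂ - (a * c) • h₃
    rw [e]
    exact X_mul_mem_baseIdeal (add_mem (Submodule.smul_mem _ _ (Z_mul_mem Z_mem_deg))
      (Submodule.smul_mem _ _ (X_mul_mem Y_mem_deg)))
  · rintro ⟨h₁, h₂, -⟩
    have e₁ : a ^ 2 * (b ^ 3 - c ^ 3) = 0 := by linear_combination h₁
    have e₂ : b ^ 2 * (c ^ 3 - a ^ 3) = 0 := by linear_combination h₂
    simp only [mul_eq_zero, pow_eq_zero_iff two_ne_zero, ha, hb, false_or, sub_eq_zero] at e₁ e₂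
    exact hne ⟨e₂.symm, e₁⟩

lemma weight_two_mem (habc : a * b * c ≠ 0) {α β γ : k}
    (h : α * (b ^ 2 * (a ^ 3 - c ^ 3)) + β * (a * b * (b ^ 3 - c ^ 3)) +
      γ * (a * c * (a ^ 3 - b ^ 3)) = 0) :
    α • (Z k a b c * (Z k a b c * Y k a b c)) + β • (Y k a b c * (Z k a b c * Z k a b c)) +
    γ • (Y k a b c * (Y k a b c * X k a b c)) ∈ baseIdeal k a b c 0 := by
  obtain ⟨⟨ha, hb⟩, hc⟩ : (a ≠ 0 ∧ b ≠ 0) ∧ c ≠ 0 := by simpa using habc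
  refine sum_mem_of_cross _ (r₀ := -(a * c)) (r₁ := b * c) (r₂ := b ^ 2) (s₀ := a * b ^ 2)
    (s₁ := -a ^ 3) (s₂ := -(b * c ^ 2)) ?_ ?_ ?_ (by linear_combination h)
  · have e : (-(a * c)) • (Z k a b c * (Z k a b c * Y k a b c)) +
        (b * c) • (Y k a b c * (Z k a b c * Z k a b c)) +
        b ^ 2 • (Y k a b c * (Y k a b c * X k a b c)) =
        X k a b c * (a ^ 2 • (Y k a b c * Y k a b c)) := by
      have h₁ := congrArg (Y k a b c * ·) (rel_XY (a := a) (b := b) (c := c))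
      have h₂ := congrArg (· * Y k a b c) (rel_XY (a := a) (b := b) (c := c))
      simp only [mul_add, add_mul, smul_mul_assoc, mul_smul_comm, mul_assoc, mul_zero,
        zero_mul] at h₁ h₂ ⊢
      linear_combination (norm := module) b • h₁ - a • h₂
    rw [e]
    exact X_mul_mem_baseIdeal (Submodule.smul_mem _ _ (Y_mul_mem Y_mem_deg))
  · have e : (a * b ^ 2) • (Z k a b c * (Z k a b c * Y k a b c)) +
        (-a ^ 3) • (Y k a b c * (Z k a b c * Z k a b c)) +
        (-(b * c ^ 2)) • (Y k a b c * (Y k a b c * X k a b c)) =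
        X k a b c * ((a ^ 2 * c) • (X k a b c * Z k a b c) +
        (b ^ 2 * c) • (Z k a b c * X k a b c)) := by
      have h₁ := congrArg (Z k a b c * ·) (rel_YZ (a := a) (b := b) (c := c))
      have h₂ := congrArg (· * Z k a b c) (rel_YZ (a := a) (b := b) (c := c))
      have h₃ := congrArg (· * X k a b c) (rel_ZX (a := a) (b := b) (c := c))
      simp only [mul_add, add_mul, smul_mul_assoc, mul_smul_comm, mul_assoc, mul_zero,
        zero_mul] at h₁ h₂ h₃ ⊢
      linear_combination (norm := module) (a * b) • h₁ - a ^ 2 • h₂ - (b * c) • h₃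
    rw [e]
    exact X_mul_mem_baseIdeal (add_mem (Submodule.smul_mem _ _ (X_mul_mem Z_mem_deg))
      (Submodule.smul_mem _ _ (Z_mul_mem X_mem_deg)))
  · rintro ⟨h₁, h₂, -⟩
    have e₁ : b ^ 2 * (a ^ 3 - c ^ 3) = 0 := by linear_combination h₁
    have e₂ : b * a * (b ^ 3 - c ^ 3) = 0 := by linear_combination h₂
    simp only [mul_eq_zero, pow_eq_zero_iff two_ne_zero, ha, hb, false_or, sub_eq_zero]
      at e₁ e₂
    exact hne ⟨e₁, e₂⟩

lemma weight_zero_mem (habc : a * b * c ≠ 0) {α β γ : k}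
    (h : α * (a * (c ^ 3 - a ^ 3)) + β * (a * (c ^ 3 - b ^ 3)) +
      γ * (c * (a ^ 3 - b ^ 3)) = 0) :
    α • (Y k a b c * (Y k a b c * Y k a b c)) + β • (Z k a b c * (Z k a b c * Z k a b c)) +
    γ • (Y k a b c * (Z k a b c * X k a b c)) ∈ baseIdeal k a b c 0 := by
  obtain ⟨⟨ha, hb⟩, hc⟩ : (a ≠ 0 ∧ b ≠ 0) ∧ c ≠ 0 := by simpa using habc
  refine sum_mem_of_cross _ (r₀ := c) (r₁ := -c) (r₂ := a) (s₀ := c * (c ^ 3 - b ^ 3))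
    (s₁ := -(c * (c ^ 3 - a ^ 3))) (s₂ := 0) ?_ ?_ ?_ (by linear_combination c * h)
  · have e : c • (Y k a b c * (Y k a b c * Y k a b c)) +
        (-c) • (Z k a b c * (Z k a b c * Z k a b c)) + a • (Y k a b c * (Z k a b c * X k a b c)) =
        X k a b c * (a • (Y k a b c * Z k a b c)) := by
      have h₁ := congrArg (Y k a b c * ·) (rel_ZX (a := a) (b := b) (c := c))
      have h₂ := congrArg (· * Z k a b c) (rel_XY (a := a) (b := b) (c := c))
      simp only [mul_add, add_mul, smul_mul_assoc, mul_smul_comm, mul_assoc, mul_zero,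
        zero_mul] at h₁ h₂ ⊢
      linear_combination (norm := module) h₁ - h₂
    rw [e]
    exact X_mul_mem_baseIdeal (Submodule.smul_mem _ _ (Y_mul_mem Z_mem_deg))
  · refine mem_baseIdeal.2 ⟨(a * (c ^ 3 - a ^ 3) - a * (b ^ 3 - c ^ 3)) • (Y k a b c * Z k a b c) -
      (c * (a ^ 3 - c ^ 3)) • (X k a b c * X k a b c),
      sub_mem (Submodule.smul_mem _ _ (Y_mul_mem Z_mem_deg))
      (Submodule.smul_mem _ _ (X_mul_mem X_mem_deg)), 1, ?_, ?_⟩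
    · rw [← map_one (algebraMap k (Sklyanin k a b c))]
      exact algebraMap_mem_deg 1
    · have h₂ := congrArg (· * Z k a b c) (rel_XY (a := a) (b := b) (c := c))
      simp only [mul_sub, add_mul, smul_mul_assoc, mul_smul_comm, mul_assoc, zero_mul, g,
        mul_one] at h₂ ⊢
      linear_combination (norm := module) (-(c ^ 3 - a ^ 3)) • h₂
  · rintro ⟨h₁, h₂, -⟩
    have e₁ : a * c * (c ^ 3 - a ^ 3) = 0 := by linear_combination h₁
    have e₂ : a * c * (c ^ 3 - b ^ 3) = 0 := by linear_combination h₂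
    simp only [mul_eq_zero, ha, hc, false_or, sub_eq_zero] at e₁ e₂
    exact hne ⟨e₁.symm, e₂.symm⟩

end cubicWords

variable [IsAlgClosed k] [CharZero k]

include habc hne

lemma BaseVanish.of_deg_three {u : Sklyanin k a b c} (hu : u ∈ deg k a b c 3)
    (h : BaseVanish a b c u) : u ∈ baseIdeal k a b c 0 := by
  obtain ⟨⟨ha, hb⟩, hc⟩ : (a ≠ 0 ∧ b ≠ 0) ∧ c ≠ 0 := by simpa using habc
  obtain ⟨u', hu', s₁, hs₁, s₂, hs₂, s₃, hs₃, rfl⟩ := exists_normalForm (n := 1) habc hu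
  rw [deg_one] at hs₁ hs₂ hs₃
  obtain ⟨α₁, β₁, γ₁, rfl⟩ := mem_linForms hs₁
  obtain ⟨α₂, β₂, γ₂, rfl⟩ := mem_linForms hs₂
  obtain ⟨α₃, β₃, γ₃, rfl⟩ := mem_linForms hs₃
  obtain ⟨h₀, h₁, h₂⟩ := eq_zero_of_cube_roots
    (A := γ₁ * a * (a * (b ^ 3 - c ^ 3)) + β₂ * b * (b * (c ^ 3 - a ^ 3)) -
      α₃ * b * (c * (a ^ 3 - b ^ 3)))
    (B := α₁ * a * (c * (a ^ 3 - b ^ 3)) + γ₂ * b * (a * (b ^ 3 - c ^ 3)) -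
      β₃ * b * (b * (c ^ 3 - a ^ 3)))
    (C := β₁ * a * (b * (c ^ 3 - a ^ 3)) + α₂ * b * (c * (a ^ 3 - b ^ 3)) -
      γ₃ * b * (a * (b ^ 3 - c ^ 3))) fun ω hω => by
    obtain ⟨P, hP, hP0, hPω⟩ := exists_base_orbit habc hne hω 0
    obtain ⟨σ, hσ, hP2⟩ := hP.base_two habc hne hP0 hω hPω
    have := hP.ev_normalForm habc hP0 hω hPω (h ω hω P hP hP0 hPω)
    simp only [map_add, map_smul, IsOrbit.ev_X, IsOrbit.ev_Y, IsOrbit.ev_Z, hP2, Pi.smul_apply,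
      Matrix.cons_val, smul_eq_mul] at this
    apply mul_left_cancel₀ hσ
    linear_combination this - σ * (γ₁ * a * (a * (b ^ 3 - c ^ 3)) +
      β₂ * b * (b * (c ^ 3 - a ^ 3)) + ω * γ₂ * b * (a * (b ^ 3 - c ^ 3))) * hω
  have e : X k a b c * u' + Y k a b c * (Y k a b c * (α₁ • X k a b c + β₁ • Y k a b c +
      γ₁ • Z k a b c)) + Y k a b c * (Z k a b c * (α₂ • X k a b c + β₂ • Y k a b c +
      γ₂ • Z k a b c)) +
      Z k a b c * (Z k a b c * (α₃ • X k a b c + β₃ • Y k a b c + γ₃ • Z k a b c)) =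
      X k a b c * u' +
      (γ₁ • (Y k a b c * (Y k a b c * Z k a b c)) + β₂ • (Y k a b c * (Z k a b c * Y k a b c)) +
      α₃ • (Z k a b c * (Z k a b c * X k a b c))) +
      (β₃ • (Z k a b c * (Z k a b c * Y k a b c)) + γ₂ • (Y k a b c * (Z k a b c * Z k a b c)) +
      α₁ • (Y k a b c * (Y k a b c * X k a b c))) +
      (β₁ • (Y k a b c * (Y k a b c * Y k a b c)) + γ₃ • (Z k a b c * (Z k a b c * Z k a b c)) +
      α₂ • (Y k a b c * (Z k a b c * X k a b c))) := by
    simp only [mul_add, mul_smul_comm]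
    module
  rw [e]
  refine add_mem (add_mem (add_mem (X_mul_mem_baseIdeal hu') ?_) ?_) ?_
  · exact weight_one_mem hne habc (by linear_combination h₀)
  · exact weight_two_mem hne habc (by linear_combination h₁)
  · refine weight_zero_mem hne habc (mul_left_cancel₀ hb ?_)
    linear_combination h₂

/-- The quadratic form vanishing along the two base orbits other than the one of `ω`. -/
lemma quadric_mul_mem {ω : k} (hω : ω ^ 3 = 1) {P : ℕ → Fin 3 → k} (hP : IsOrbit a b c P)
    (hP0 : ∀ j, P j ≠ 0) (hPω : P 0 = ![0, 1, -ω]) {l : Sklyanin k a b c}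
    (hl : l ∈ pointForms a b c (P 2)) :
    ((ω ^ 2 * b) • (Y k a b c * Y k a b c) + (ω * a) • (Y k a b c * Z k a b c) -
    a • (Z k a b c * Z k a b c)) * l ∈ baseIdeal k a b c 0 := by
  have hf : (ω ^ 2 * b) • (Y k a b c * Y k a b c) + (ω * a) • (Y k a b c * Z k a b c) -
      a • (Z k a b c * Z k a b c) ∈ deg k a b c 2 :=
    sub_mem (add_mem (Submodule.smul_mem _ _ (Y_mul_mem Y_mem_deg))
      (Submodule.smul_mem _ _ (Y_mul_mem Z_mem_deg))) (Submodule.smul_mem _ _ (Z_mul_mem Z_mem_deg))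
  have hl1 : l ∈ deg k a b c 1 := by rw [deg_one]; exact pointForms_le _ hl
  refine BaseVanish.of_deg_three habc hne (mul_mem_deg hf hl1) fun ω' hω' Q hQ hQ0 hQω => ?_
  rw [hQ.ev_mul hf, mul_eq_zero]
  obtain rfl | hωω := eq_or_ne ω' ω
  · right
    obtain ⟨σ, hσ, hP2⟩ := hP.base_two habc hne hP0 hω hPω
    obtain ⟨σ', hσ', hQ2⟩ := hQ.base_two habc hne hQ0 hω hQω
    have hQP : Q 2 = (σ' / σ) • P 2 := by
      rw [hP2, hQ2, smul_smul, div_mul_cancel₀ _ hσ]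
    have hle : pointForms a b c (P 2) ≤ LinearMap.ker (hQ.ev 2) := by
      refine Submodule.span_le.2 ?_
      rintro _ ⟨⟨i, j⟩, rfl⟩
      simp only [SetLike.mem_coe, LinearMap.mem_ker, map_sub, map_smul, IsOrbit.ev_gen, hQP,
        Pi.smul_apply, smul_eq_mul]
      ring
    exact hle hl
  · left
    obtain ⟨τ, hτ, h₁⟩ := hQ.base_one habc hQ0 hQω
    have key : ω ^ 2 + ω * ω' + ω' ^ 2 = 0 := by
      apply mul_left_cancel₀ (sub_ne_zero.2 hωω)
      linear_combination hω' - hω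
    simp only [map_add, map_sub, map_smul, IsOrbit.ev_Y_mul, IsOrbit.ev_Z_mul, IsOrbit.ev_Y,
      IsOrbit.ev_Z, zero_add, h₁, hQω, Pi.smul_apply, Matrix.cons_val, smul_eq_mul]
    linear_combination τ * a * b * ω' * key

lemma BaseVanish.mem_baseIdeal (n : ℕ) {u : Sklyanin k a b c} (hu : u ∈ deg k a b c (n + 3))
    (h : BaseVanish a b c u) : u ∈ baseIdeal k a b c n := by
  obtain _ | n := n
  · exact h.of_deg_three habc hne hu
  obtain ⟨⟨ha, hb⟩, hc⟩ : (a ≠ 0 ∧ b ≠ 0) ∧ c ≠ 0 := by simpa using habc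
  obtain ⟨u', hu', s₁, hs₁, s₂, hs₂, s₃, hs₃, rfl⟩ :=
    exists_normalForm (n := n + 2) habc (by convert hu using 1)
  have key : (a * b) • (Y k a b c * (Y k a b c * s₁) + Y k a b c * (Z k a b c * s₂) +
      Z k a b c * (Z k a b c * s₃)) ∈
      baseIdeal k a b c (n + 1) := by
    refine mem_of_cube_roots _ (B := b ^ 2 • (Y k a b c * (Y k a b c * s₂)) -
      (a * b) • (Y k a b c * (Z k a b c * s₃)) -
      a ^ 2 • (Z k a b c * (Z k a b c * s₁))) (C := (-b ^ 2) • (Y k a b c * (Y k a b c * s₃)) +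
      a ^ 2 • (Y k a b c * (Z k a b c * s₁)) -
      (a * b) • (Z k a b c * (Z k a b c * s₂))) fun ω hω => ?_
    obtain ⟨P, hP, hP0, hPω⟩ := exists_base_orbit habc hne hω 0
    set s := (a * ω) • s₁ + (b * ω ^ 2) • s₂ - b • s₃ with hs
    have hs2 : s ∈ deg k a b c (n + 2) := sub_mem (add_mem (Submodule.smul_mem _ _ hs₁)
      (Submodule.smul_mem _ _ hs₂)) (Submodule.smul_mem _ _ hs₃)
    have hev : hP.ev 2 s = 0 := by
      have := hP.ev_normalForm habc hP0 hω hPω (h ω hω P hP hP0 hPω)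
      simpa [hs] using this
    have hsm := hP.mem_pointForms_mul habc hne hP0 hs2 2 hev
    have hmul : ∀ t ∈ pointForms a b c (P 2) * deg k a b c (n + 1),
        ((ω ^ 2 * b) • (Y k a b c * Y k a b c) + (ω * a) • (Y k a b c * Z k a b c) -
        a • (Z k a b c * Z k a b c)) * t ∈
          baseIdeal k a b c (n + 1) := fun t ht => by
      induction ht using Submodule.mul_induction_on' with
      | mem_mul_mem l hl t ht =>
        rw [← mul_assoc, add_comm n, ← zero_add (1 + n), add_comm 1 n]
        exact mul_mem_baseIdeal (quadric_mul_mem habc hne hω hP hP0 hPω hl) ht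
      | add u _ v _ hu hv => rw [mul_add]; exact add_mem hu hv
    have hfs := hmul s hsm
    convert hfs using 1
    have e : (0 : k) = ω ^ 3 - 1 := by rw [hω, sub_self]
    rw [← add_zero (_ + _), ← zero_smul k ((a * b) • (Y k a b c * (Y k a b c * s₁)) +
      (b ^ 2 * ω) • (Y k a b c * (Y k a b c * s₂)) + (a * b) • (Y k a b c * (Z k a b c * s₂))),
      e, hs]
    simp only [mul_add, add_mul, sub_mul, mul_sub, smul_mul_assoc, mul_smul_comm, mul_assoc]
    module
  rw [add_assoc, add_assoc, ← add_assoc (Y k a b c * _)]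
  exact add_mem (X_mul_mem_baseIdeal hu')
    ((Submodule.smul_mem_iff _ (mul_ne_zero ha hb)).1 key)

end baseLocus

end Sklyanin

namespace Sklyanin

open Polynomial

section genericOrbit

variable {k : Type*} [Field k] {a b c : k}

section uniqueness

lemma Incident.eq_smul {p q q' : Fin 3 → k} (habc : a * b * c ≠ 0)
    (hne : ¬ (a ^ 3 = c ^ 3 ∧ b ^ 3 = c ^ 3)) (hp : p ≠ 0) (hq' : q' ≠ 0)
    (h : Incident a b c p q) (h' : Incident a b c p q') : ∃ β : k, q = β • q' := by
  obtain ⟨α, i, hi⟩ := exists_rowCross_ne_zero habc hne hp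
  have e := h.rowCross_mul α
  have e' := h'.rowCross_mul α
  obtain ⟨l, hl⟩ := Function.ne_iff.1 hq'
  have hi' : q' i ≠ 0 := fun h0 => by
    have := e' i l
    rw [h0, mul_zero] at this
    exact (mul_ne_zero hi hl) this
  refine ⟨q i / q' i, ?_⟩
  ext j
  rw [Pi.smul_apply, smul_eq_mul]
  field_simp
  apply mul_left_cancel₀ hi
  linear_combination q' i * e i j - q i * e' i j

lemma Incident.smul_left {p q : Fin 3 → k} (h : Incident a b c p q) (β : k) :
    Incident a b c (β • p) q := by
  obtain ⟨h₁, h₂, h₃⟩ := h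
  constructor <;> simp only [Pi.smul_apply, smul_eq_mul]
  · linear_combination β * h₁
  · linear_combination β * h₂
  · linear_combination β * h₃

lemma IsOrbit.exists_eq_smul (habc : a * b * c ≠ 0)
    (hne : ¬ (a ^ 3 = c ^ 3 ∧ b ^ 3 = c ^ 3)) {P Q : ℕ → Fin 3 → k} (hP : IsOrbit a b c P)
    (hP0 : ∀ j, P j ≠ 0) (hQ : IsOrbit a b c Q) (hQ0 : ∀ j, Q j ≠ 0) (h : P 0 = Q 0) :
    ∃ β : ℕ → k, ∀ j, P j = β j • Q j := by
  suffices ∀ j, ∃ β : k, P j = β • Q j from Classical.skolem.1 this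
  intro j
  induction j with
  | zero => exact ⟨1, by rw [h, one_smul]⟩
  | succ j ih =>
    obtain ⟨β, hβ⟩ := ih
    refine (hP j).eq_smul habc hne (hP0 j) (hQ0 _) ?_
    rw [hβ]
    exact (hQ j).smul_left β

end uniqueness

lemma cubicForm_map {A B : Type*} [CommRing A] [CommRing B] (φ : A →+* B) (r s t : A)
    (p : Fin 3 → A) : cubicForm (φ r) (φ s) (φ t) (φ ∘ p) = φ (cubicForm r s t p) := by
  simp [cubicForm]

lemma rowCross_map {A B : Type*} [CommRing A] [CommRing B] (φ : A →+* B) (r s t : A)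
    (p : Fin 3 → A) (α i : Fin 3) :
    rowCross (φ r) (φ s) (φ t) (φ ∘ p) α i = φ (rowCross r s t p α i) := by
  fin_cases α <;> fin_cases i <;> simp [rowCross]

lemma IsOrbit.map {A B : Type*} [CommRing A] [CommRing B] [Algebra k A] [Algebra k B]
    {P : ℕ → Fin 3 → A} (hP : IsOrbit a b c P) (φ : A →ₐ[k] B) :
    IsOrbit a b c fun j => φ ∘ P j := by
  intro j
  obtain ⟨h₁, h₂, h₃⟩ := hP j
  replace h₁ := congrArg φ h₁
  replace h₂ := congrArg φ h₂
  replace h₃ := congrArg φ h₃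
  simp only [map_add, map_mul, AlgHom.commutes, map_zero] at h₁ h₂ h₃
  exact ⟨h₁, h₂, h₃⟩

section cubicRing

/-- A root of `T³ - r y T + (y³ + 1)` over `k[y]` is linear, which forces `r³ = 27`. -/
lemma cube_eq_of_root {r : k} {p : Polynomial k} (h : p ^ 3 - Polynomial.C r * Polynomial.X * p +
    (Polynomial.X ^ 3 + 1) = 0) : r ^ 3 = 27 := by
  have hd : p.natDegree = 1 := by
    have h3 : (Polynomial.X ^ 3 + 1 : Polynomial k).natDegree = 3 := by compute_degree!
    have h1 : (Polynomial.C r * Polynomial.X * p).natDegree ≤ p.natDegree + 1 :=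
      Polynomial.natDegree_mul_le.trans (by
        have : (Polynomial.C r * Polynomial.X).natDegree ≤ 1 := by compute_degree
        omega)
    have hp : (p ^ 3).natDegree = 3 * p.natDegree := Polynomial.natDegree_pow p 3
    have e₁ : p ^ 3 = Polynomial.C r * Polynomial.X * p - (Polynomial.X ^ 3 + 1) := by
      linear_combination h
    have e₂ : Polynomial.X ^ 3 + 1 = Polynomial.C r * Polynomial.X * p - p ^ 3 := by
      linear_combination h
    have d₁ : (p ^ 3).natDegree ≤ max (Polynomial.C r * Polynomial.X * p).natDegree
        (Polynomial.X ^ 3 + 1 : Polynomial k).natDegree := by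
      rw [e₁]; exact Polynomial.natDegree_sub_le _ _
    have d₂ : (Polynomial.X ^ 3 + 1 : Polynomial k).natDegree ≤
        max (Polynomial.C r * Polynomial.X * p).natDegree (p ^ 3).natDegree := by
      rw [e₂]; exact Polynomial.natDegree_sub_le _ _
    omega
  obtain ⟨α, hα, β, rfl⟩ := Polynomial.natDegree_eq_one.1 hd
  have h₀ := congrArg (Polynomial.coeff · 0) h
  have h₁ := congrArg (Polynomial.coeff · 1) h
  have h₂ := congrArg (Polynomial.coeff · 2) h
  have h₃ := congrArg (Polynomial.coeff · 3) h
  have e : (Polynomial.C α * Polynomial.X + Polynomial.C β) ^ 3 - Polynomial.C r * Polynomial.X *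
      (Polynomial.C α * Polynomial.X + Polynomial.C β) + (Polynomial.X ^ 3 + 1) =
      Polynomial.C (α ^ 3 + 1) * Polynomial.X ^ 3 + Polynomial.C (3 * α ^ 2 * β - r * α) *
      Polynomial.X ^ 2 + Polynomial.C (3 * α * β ^ 2 - r * β) * Polynomial.X +
      Polynomial.C (β ^ 3 + 1) := by
    simp only [map_add, map_sub, map_mul, map_pow, map_one, Polynomial.C_ofNat]
    ring
  rw [e] at h₀ h₁ h₂ h₃
  simp only [Polynomial.coeff_add, Polynomial.coeff_C_mul, Polynomial.coeff_X_pow,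
    Polynomial.coeff_X, Polynomial.coeff_C, Polynomial.coeff_zero] at h₀ h₁ h₂ h₃
  norm_num at h₀ h₁ h₂ h₃
  have : r = 3 * α * β := by
    apply mul_left_cancel₀ hα
    linear_combination -h₂
  rw [this]
  linear_combination 27 * β ^ 3 * h₃ - 27 * h₀

variable (k a b c) in
/-- The equation of the cubic curve of point modules, as a monic polynomial in the first
coordinate. -/
def cubicPoly : Polynomial (MvPolynomial (Fin 2) k) :=
  Polynomial.X ^ 3 - Polynomial.C (MvPolynomial.C ((a ^ 3 + b ^ 3 + c ^ 3) / (a * b * c)) *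
    MvPolynomial.X 0 * MvPolynomial.X 1) * Polynomial.X +
    Polynomial.C (MvPolynomial.X 0 ^ 3 + MvPolynomial.X 1 ^ 3)

lemma natDegree_cubicPoly : (cubicPoly k a b c).natDegree = 3 := by
  unfold cubicPoly; compute_degree!

lemma monic_cubicPoly : (cubicPoly k a b c).Monic := by
  unfold cubicPoly; monicity!

lemma irreducible_cubicPoly (habc : a * b * c ≠ 0)
    (hdeg : (3 * a * b * c) ^ 3 ≠ (a ^ 3 + b ^ 3 + c ^ 3) ^ 3) :
    Irreducible (cubicPoly k a b c) := by
  rw [monic_cubicPoly.irreducible_iff_roots_eq_zero_of_degree_le_three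
    (by rw [natDegree_cubicPoly]; norm_num) natDegree_cubicPoly.le]
  refine Multiset.eq_zero_of_forall_notMem fun q hq => hdeg ?_
  have hq' := Polynomial.isRoot_of_mem_roots hq
  simp only [cubicPoly, Polynomial.IsRoot.def, Polynomial.eval_add, Polynomial.eval_sub,
    Polynomial.eval_mul, Polynomial.eval_pow, Polynomial.eval_X, Polynomial.eval_C] at hq'
  have h := congrArg (MvPolynomial.aeval ![(Polynomial.X : Polynomial k), 1]) hq'
  simp only [map_add, map_sub, map_mul, map_pow, MvPolynomial.aeval_X, Matrix.cons_val, map_zero,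
    MvPolynomial.aeval_C, one_pow, mul_one] at h
  have := cube_eq_of_root h
  rw [div_pow, div_eq_iff (pow_ne_zero 3 habc)] at this
  linear_combination -this

/-- The cubic cone has a generic point with values in a domain. -/
lemma exists_generic_point (habc : a * b * c ≠ 0) :
    ∃ p : Fin 3 → AdjoinRoot (cubicPoly k a b c),
      cubicForm (algebraMap k _ a) (algebraMap k _ b) (algebraMap k _ c) p = 0 ∧
      ∀ q : Fin 3 → k, cubicForm a b c q = 0 →
        ∃ φ : AdjoinRoot (cubicPoly k a b c) →ₐ[k] k, ∀ i, φ (p i) = q i := by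
  refine ⟨![AdjoinRoot.root _, AdjoinRoot.of _ (MvPolynomial.X 0),
    AdjoinRoot.of _ (MvPolynomial.X 1)], ?_, fun q hq => ?_⟩
  · have h : AdjoinRoot.mk (cubicPoly k a b c) (Polynomial.X ^ 3 - Polynomial.C (MvPolynomial.C
        ((a ^ 3 + b ^ 3 + c ^ 3) / (a * b * c)) * MvPolynomial.X 0 * MvPolynomial.X 1) *
        Polynomial.X + Polynomial.C (MvPolynomial.X 0 ^ 3 + MvPolynomial.X 1 ^ 3)) = 0 :=
      AdjoinRoot.mk_self
    have hC (r : k) : AdjoinRoot.of (cubicPoly k a b c) (MvPolynomial.C r) =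
      algebraMap k _ r := rfl
    simp only [map_add, map_sub, map_mul, map_pow, AdjoinRoot.mk_X, AdjoinRoot.mk_C, hC] at h
    have e := congrArg (algebraMap k (AdjoinRoot (cubicPoly k a b c)))
      (div_mul_cancel₀ (a ^ 3 + b ^ 3 + c ^ 3) habc)
    simp only [map_add, map_mul, map_pow] at e
    simp only [cubicForm, Matrix.cons_val]
    linear_combination -(algebraMap k _ a * algebraMap k _ b * algebraMap k _ c) * h -
      AdjoinRoot.root (cubicPoly k a b c) * AdjoinRoot.of _ (MvPolynomial.X 0) *
        AdjoinRoot.of _ (MvPolynomial.X 1) * e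
  · refine ⟨AdjoinRoot.liftAlgHom _ (MvPolynomial.aeval ![q 1, q 2]) (q 0) ?_, fun i => ?_⟩
    · simp only [cubicForm] at hq
      simp only [cubicPoly, Polynomial.eval₂_add, Polynomial.eval₂_sub, Polynomial.eval₂_mul,
        Polynomial.eval₂_pow, Polynomial.eval₂_X, Polynomial.eval₂_C]
      simp
      apply mul_left_cancel₀ habc
      linear_combination -hq - q 0 * q 1 * q 2 *
        div_mul_cancel₀ (a ^ 3 + b ^ 3 + c ^ 3) habc
    · fin_cases i <;> simp

end cubicRing

/-- The orbit obtained by following a generic combination of the rows of the relation matrix. -/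
def genericOrbit {C : Type*} [CommRing C] [Algebra k C] (a b c : k) (p : Fin 3 → C) :
    ℕ → Fin 3 → Polynomial C
  | 0 => Polynomial.C ∘ p
  | j + 1 => ∑ α : Fin 3, (Polynomial.X : Polynomial C) ^ (α : ℕ) •
      rowCross (algebraMap k (Polynomial C) a) (algebraMap k _ b) (algebraMap k _ c)
        (genericOrbit a b c p j) α

lemma Incident.sum_smul {B : Type*} [CommRing B] {r s t : B} {p : Fin 3 → B} {q : Fin 3 → Fin 3 → B}
    (h : ∀ α, Incident r s t p (q α)) (l : Fin 3 → B) :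
    Incident r s t p (∑ α, l α • q α) := by
  constructor <;> simp only [Fin.sum_univ_three, Pi.add_apply, Pi.smul_apply, smul_eq_mul]
  · linear_combination l 0 * (h 0).rel_yz + l 1 * (h 1).rel_yz + l 2 * (h 2).rel_yz
  · linear_combination l 0 * (h 0).rel_zx + l 1 * (h 1).rel_zx + l 2 * (h 2).rel_zx
  · linear_combination l 0 * (h 0).rel_xy + l 1 * (h 1).rel_xy + l 2 * (h 2).rel_xy

lemma rowCross_eq_smul (habc : a * b * c ≠ 0) (hne : ¬ (a ^ 3 = c ^ 3 ∧ b ^ 3 = c ^ 3))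
    {p q : Fin 3 → k} (hp : p ≠ 0) (hq : q ≠ 0) (h : Incident a b c p q) :
    ∃ ν : Fin 3 → k, ν ≠ 0 ∧ ∀ α, rowCross a b c p α = ν α • q := by
  have hex (α : Fin 3) : ∃ ν : k, rowCross a b c p α = ν • q :=
    (incident_rowCross (h.cubicForm_left hq) α).eq_smul habc hne hp hq h
  choose ν hν using hex
  refine ⟨ν, ?_, hν⟩
  rintro rfl
  obtain ⟨α, i, hi⟩ := exists_rowCross_ne_zero habc hne hp
  simp [hν] at hi

lemma rowCross_smul {B : Type*} [CommRing B] (r s t β : B) (p : Fin 3 → B) (α : Fin 3) :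
    rowCross r s t (β • p) α = β ^ 2 • rowCross r s t p α := by
  ext i
  fin_cases α <;> fin_cases i <;> simp [rowCross] <;> ring

lemma genericOrbit_specialize (habc : a * b * c ≠ 0) (hne : ¬ (a ^ 3 = c ^ 3 ∧ b ^ 3 = c ^ 3))
    {C : Type*} [CommRing C] [Algebra k C] {p : Fin 3 → C} {Q : ℕ → Fin 3 → k}
    (hQ : IsOrbit a b c Q) (hQ0 : ∀ j, Q j ≠ 0) {φ : C →ₐ[k] k} (hφ : ∀ i, φ (p i) = Q 0 i)
    (j : ℕ) : ∃ β : Polynomial k, β ≠ 0 ∧ ∀ i,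
      Polynomial.mapAlgHom φ (genericOrbit a b c p j i) = β * Polynomial.C (Q j i) := by
  induction j with
  | zero => exact ⟨1, one_ne_zero, fun i => by simp [genericOrbit, hφ]⟩
  | succ j ih =>
    obtain ⟨β, hβ, h⟩ := ih
    obtain ⟨ν, hν, hνQ⟩ := rowCross_eq_smul habc hne (hQ0 j) (hQ0 (j + 1)) (hQ j)
    refine ⟨β ^ 2 * ∑ α : Fin 3, Polynomial.C (ν α) * Polynomial.X ^ (α : ℕ),
      mul_ne_zero (pow_ne_zero 2 hβ) fun h0 => hν ?_, fun i => ?_⟩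
    · have hc (n : ℕ) := congrArg (Polynomial.coeff · n) h0
      simp only [Fin.sum_univ_three, Polynomial.coeff_add, Polynomial.coeff_C_mul_X_pow,
        Polynomial.coeff_zero] at hc
      ext α
      fin_cases α
      · simpa using hc 0
      · simpa using hc 1
      · simpa using hc 2
    · have hcomp : Polynomial.mapAlgHom φ ∘ genericOrbit a b c p j =
          β • (algebraMap k (Polynomial k) ∘ Q j) := by
        ext1 i; exact h i
      have key (α : Fin 3) : Polynomial.mapAlgHom φ (rowCross (algebraMap k (Polynomial C) a)
          (algebraMap k _ b) (algebraMap k _ c) (genericOrbit a b c p j) α i) =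
          β ^ 2 * (Polynomial.C (ν α) * Polynomial.C (Q (j + 1) i)) := by
        have := rowCross_map (Polynomial.mapAlgHom φ : Polynomial C →+* Polynomial k)
          (algebraMap k _ a) (algebraMap k _ b) (algebraMap k _ c) (genericOrbit a b c p j) α i
        simp only [RingHom.coe_coe, AlgHom.commutes] at this
        rw [← this, hcomp, rowCross_smul, Pi.smul_apply, rowCross_map, smul_eq_mul]
        congr 1
        rw [show rowCross a b c (Q j) α = _ from hνQ α]
        simp
      simp only [genericOrbit, Fin.sum_univ_three, Pi.add_apply, Pi.smul_apply, smul_eq_mul,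
        map_add, map_mul, map_pow, key]
      simp only [Polynomial.coe_mapAlgHom, Polynomial.map_X]
      ring

/-- There is an orbit in a domain that specializes to every orbit, up to scaling. -/
lemma exists_genericOrbit (habc : a * b * c ≠ 0)
    (hdeg : (3 * a * b * c) ^ 3 ≠ (a ^ 3 + b ^ 3 + c ^ 3) ^ 3)
    (hne : ¬ (a ^ 3 = c ^ 3 ∧ b ^ 3 = c ^ 3)) :
    ∃ G : ℕ → Fin 3 → Polynomial (AdjoinRoot (cubicPoly k a b c)), ∃ hG : IsOrbit a b c G,
      (∀ m, G m 0 ≠ 0) ∧ ∀ (n m : ℕ) (u : Sklyanin k a b c), u ∈ deg k a b c n → hG.ev m u = 0 →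
        ∀ (Q : ℕ → Fin 3 → k) (hQ : IsOrbit a b c Q), (∀ j, Q j ≠ 0) → hQ.ev m u = 0 := by
  have := Fact.mk (irreducible_cubicPoly habc hdeg)
  obtain ⟨p, hp, hspec⟩ := exists_generic_point habc
  have hdom : IsDomain (AdjoinRoot (cubicPoly k a b c)) :=
    AdjoinRoot.isDomain_of_prime (irreducible_cubicPoly habc hdeg).prime
  have hG0 (m : ℕ) : genericOrbit a b c p m 0 ≠ 0 := fun h0 => by
    obtain ⟨Q, hQ, hQ0, hQm⟩ := exists_orbit (p := ![c, a, b]) habc hne m (fun h => by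
      have := congrFun h 0
      simp only [Matrix.cons_val, Pi.zero_apply] at this
      simp [this] at habc) (by simp only [cubicForm, Matrix.cons_val]; ring)
    obtain ⟨φ, hφ⟩ := hspec (Q 0) ((hQ 0).cubicForm_left (hQ0 1))
    obtain ⟨β, hβ, h⟩ := genericOrbit_specialize habc hne hQ hQ0 hφ m
    have := h 0
    rw [h0, map_zero, hQm] at this
    have hc : c ≠ 0 := by rintro rfl; simp at habc
    simp [hβ, hc] at this
  have hΦ (j : ℕ) : cubicForm (algebraMap k _ a) (algebraMap k _ b) (algebraMap k _ c)
      (genericOrbit a b c p j) = 0 := by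
    induction j with
    | zero =>
      have := cubicForm_map Polynomial.C (algebraMap k _ a) (algebraMap k _ b)
        (algebraMap k _ c) p
      rwa [hp, map_zero] at this
    | succ j ih =>
      exact (Incident.sum_smul (fun α => incident_rowCross ih α) _).cubicForm_right
        fun h => hG0 j (congrFun h 0)
  have hG : IsOrbit a b c (genericOrbit a b c p) := fun j =>
    Incident.sum_smul (fun α => incident_rowCross (hΦ j) α) _
  refine ⟨genericOrbit a b c p, hG, hG0, fun n m u hu h0 Q hQ hQ0 => ?_⟩
  obtain ⟨φ, hφ⟩ := hspec (Q 0) ((hQ 0).cubicForm_left (hQ0 1))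
  choose β hβ h using genericOrbit_specialize habc hne hQ hQ0 hφ
  have h₁ := hG.ev_of_proportional (hG.map (Polynomial.mapAlgHom φ)) (Polynomial.mapAlgHom φ)
    (fun _ => 1) 0 (by simp) hu m
  have h₂ := hQ.ev_of_proportional (hG.map (Polynomial.mapAlgHom φ))
    (Algebra.ofId k (Polynomial k)) β 0 (fun j i => h j i) hu m
  rw [h₁, add_zero, h0, map_zero, mul_zero, eq_comm, mul_eq_zero] at h₂
  have h₃ := h₂.resolve_left (Finset.prod_ne_zero_iff.2 fun i _ => hβ _)
  exact (map_eq_zero_iff _ (algebraMap k (Polynomial k)).injective).1 h₃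

end genericOrbit

end Sklyanin

namespace Sklyanin

open Polynomial

section centralPart

variable {k : Type*} [Field k] {a b c : k}

variable (k a b c) in
/-- The degree `n` part of `g S`. -/
def gDeg : ℕ → Submodule k (Sklyanin k a b c)
  | n + 3 => (deg k a b c n).map (LinearMap.mulLeft k (g k a b c))
  | _ => ⊥

lemma mem_gDeg_add_three {n : ℕ} {u : Sklyanin k a b c} :
    u ∈ gDeg k a b c (n + 3) ↔ ∃ w ∈ deg k a b c n, g k a b c * w = u := Iff.rfl

lemma mem_gDeg {n : ℕ} {u : Sklyanin k a b c} :
    u ∈ gDeg k a b c n ↔ u = 0 ∨ ∃ m w, n = m + 3 ∧ w ∈ deg k a b c m ∧ u = g k a b c * w := by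
  match n with
  | 0 | 1 | 2 => simp [gDeg]
  | n + 3 =>
    rw [mem_gDeg_add_three]
    constructor
    · rintro ⟨w, hw, rfl⟩
      exact .inr ⟨n, w, rfl, hw, rfl⟩
    · rintro (rfl | ⟨m, w, hm, hw, rfl⟩)
      · exact ⟨0, zero_mem _, mul_zero _⟩
      · obtain rfl : n = m := by omega
        exact ⟨w, hw, rfl⟩

lemma gDeg_le (n : ℕ) : gDeg k a b c n ≤ deg k a b c n := fun u hu => by
  obtain rfl | ⟨m, w, rfl, hw, rfl⟩ := mem_gDeg.1 hu
  · exact zero_mem _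
  · rw [add_comm]; exact mul_mem_deg g_mem_deg hw

instance (n : ℕ) : Module.Finite k (gDeg k a b c n) :=
  Submodule.finiteDimensional_of_le (gDeg_le n)

lemma mul_mem_gDeg {m n : ℕ} {u w : Sklyanin k a b c} (hu : u ∈ deg k a b c m)
    (hw : w ∈ gDeg k a b c n) : u * w ∈ gDeg k a b c (m + n) := by
  obtain rfl | ⟨l, v, rfl, hv, rfl⟩ := mem_gDeg.1 hw
  · rw [mul_zero]; exact zero_mem _
  · rw [← add_assoc]
    exact mem_gDeg_add_three.2 ⟨u * v, mul_mem_deg hu hv, by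
      rw [← mul_assoc, ← mul_assoc, g_comm]⟩

lemma IsOrbit.ev_eq_zero_of_eq (habc : a * b * c ≠ 0)
    (hne : ¬ (a ^ 3 = c ^ 3 ∧ b ^ 3 = c ^ 3)) {P Q : ℕ → Fin 3 → k} (hP : IsOrbit a b c P)
    (hP0 : ∀ j, P j ≠ 0) (hQ : IsOrbit a b c Q) (hQ0 : ∀ j, Q j ≠ 0) (h : P 0 = Q 0) {n : ℕ}
    {u : Sklyanin k a b c} (hu : u ∈ deg k a b c n) (h0 : hQ.ev 0 u = 0) : hP.ev 0 u = 0 := by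
  obtain ⟨β, hβ⟩ := hP.exists_eq_smul habc hne hP0 hQ hQ0 h
  rw [hQ.ev_of_proportional hP (AlgHom.id k k) β 0 (fun j i => by simp [hβ]) hu 0]
  simp [h0]

variable [IsAlgClosed k] [CharZero k]

lemma BaseVanish.exists_sub_mem (habc : a * b * c ≠ 0)
    (hne : ¬ (a ^ 3 = c ^ 3 ∧ b ^ 3 = c ^ 3)) {n : ℕ} {u : Sklyanin k a b c}
    (hu : u ∈ deg k a b c (n + 1)) (h : BaseVanish a b c u) :
    ∃ s ∈ deg k a b c n, ∃ w ∈ gDeg k a b c (n + 1), u = X k a b c * s + w := by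
  match n with
  | 0 =>
    obtain ⟨s, hs, rfl⟩ := h.of_deg_one habc hne hu
    exact ⟨s, hs, 0, zero_mem _, by simp⟩
  | 1 =>
    obtain ⟨s, hs, rfl⟩ := h.of_deg_two habc hne hu
    exact ⟨s, hs, 0, zero_mem _, by simp⟩
  | n + 2 =>
    obtain ⟨s, hs, w, hw, rfl⟩ := Sklyanin.mem_baseIdeal.1 (h.mem_baseIdeal habc hne n hu)
    exact ⟨s, hs, _, mem_gDeg_add_three.2 ⟨w, hw, rfl⟩, rfl⟩

/-- There is an orbit in a domain along which exactly the multiples of `g` vanish. -/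
lemma exists_detecting_orbit (habc : a * b * c ≠ 0)
    (hdeg : (3 * a * b * c) ^ 3 ≠ (a ^ 3 + b ^ 3 + c ^ 3) ^ 3)
    (hne : ¬ (a ^ 3 = c ^ 3 ∧ b ^ 3 = c ^ 3)) :
    ∃ G : ℕ → Fin 3 → Polynomial (AdjoinRoot (cubicPoly k a b c)), ∃ hG : IsOrbit a b c G,
      (∀ m, G m ≠ 0) ∧ ∀ (n m : ℕ) (u : Sklyanin k a b c), u ∈ deg k a b c n →
        (hG.ev m u = 0 ↔ u ∈ gDeg k a b c n) := by
  have hdom : IsDomain (AdjoinRoot (cubicPoly k a b c)) :=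
    AdjoinRoot.isDomain_of_prime (irreducible_cubicPoly habc hdeg).prime
  obtain ⟨G, hG, hG0, hspec⟩ := exists_genericOrbit habc hdeg hne
  have hGm (m : ℕ) : G m ≠ 0 := fun h => hG0 m (congrFun h 0)
  have hgw (n m : ℕ) (w : Sklyanin k a b c) (hw : w ∈ gDeg k a b c n) : hG.ev m w = 0 := by
    obtain rfl | ⟨l, w, rfl, hw, rfl⟩ := mem_gDeg.1 hw
    · exact map_zero _
    · rw [hG.ev_mul g_mem_deg, hG.ev_g habc hne m (hGm _) (hGm _), zero_mul]
  refine ⟨G, hG, hGm, fun n m u hu => ⟨fun h => ?_, hgw n m u⟩⟩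
  induction n generalizing m u with
  | zero =>
    obtain ⟨r, rfl⟩ := mem_deg_zero hu
    rw [hG.ev_algebraMap, map_eq_zero_iff _ (FaithfulSMul.algebraMap_injective k _)] at h
    rw [h, map_zero]
    exact zero_mem _
  | succ n ih =>
    have hbase : BaseVanish a b c u := fun ω hω P hP hP0 hPω => by
      obtain ⟨Q, hQ, hQ0, hQP⟩ := hP.exists_prepend habc hne m hP0
      have h₁ := hQ.ev_of_proportional hP (AlgHom.id k k) (fun _ => 1) m
        (fun j i => by simp [hQP]) hu 0
      simpa [hspec _ m u hu h Q hQ hQ0] using h₁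
    obtain ⟨s, hs, w, hw, rfl⟩ := hbase.exists_sub_mem habc hne hu
    rw [map_add, hgw _ m w hw, add_zero, hG.ev_X_mul, mul_eq_zero] at h
    refine add_mem ?_ hw
    rw [add_comm]
    exact mul_mem_gDeg X_mem_deg (ih (m + 1) s hs (h.resolve_left (hG0 m)))

/-- The ideal `g S` is prime on homogeneous elements. -/
lemma mem_gDeg_or_mem_gDeg (habc : a * b * c ≠ 0)
    (hdeg : (3 * a * b * c) ^ 3 ≠ (a ^ 3 + b ^ 3 + c ^ 3) ^ 3)
    (hne : ¬ (a ^ 3 = c ^ 3 ∧ b ^ 3 = c ^ 3)) {m n : ℕ} {u v : Sklyanin k a b c}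
    (hu : u ∈ deg k a b c m) (hv : v ∈ deg k a b c n) (h : u * v ∈ gDeg k a b c (m + n)) :
    u ∈ gDeg k a b c m ∨ v ∈ gDeg k a b c n := by
  have hdom : IsDomain (AdjoinRoot (cubicPoly k a b c)) :=
    AdjoinRoot.isDomain_of_prime (irreducible_cubicPoly habc hdeg).prime
  obtain ⟨G, hG, -, hker⟩ := exists_detecting_orbit habc hdeg hne
  rw [← hker _ 0 _ (mul_mem_deg hu hv), hG.ev_mul hu, mul_eq_zero] at h
  exact h.imp (hker _ _ _ hu).1 (hker _ _ _ hv).1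

/-- If all three multiples `xu`, `yu`, `zu` vanish, then `u` is a multiple of `g`. -/
lemma mem_gDeg_of_gen_mul_eq_zero (habc : a * b * c ≠ 0)
    (hdeg : (3 * a * b * c) ^ 3 ≠ (a ^ 3 + b ^ 3 + c ^ 3) ^ 3)
    (hne : ¬ (a ^ 3 = c ^ 3 ∧ b ^ 3 = c ^ 3)) {n : ℕ} {u : Sklyanin k a b c}
    (hu : u ∈ deg k a b c n) (h : ∀ i, gen i * u = 0) : u ∈ gDeg k a b c n := by
  have hdom : IsDomain (AdjoinRoot (cubicPoly k a b c)) :=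
    AdjoinRoot.isDomain_of_prime (irreducible_cubicPoly habc hdeg).prime
  obtain ⟨G, hG, hG0, hker⟩ := exists_detecting_orbit habc hdeg hne
  obtain ⟨i, hi⟩ := Function.ne_iff.1 (hG0 0)
  have := hG.ev_gen_mul 0 i u
  rw [h, map_zero, eq_comm, mul_eq_zero] at this
  exact (hker _ _ _ hu).1 (this.resolve_left hi)

section dimension

lemma exists_deg_le_sup (habc : a * b * c ≠ 0) (hne : ¬ (a ^ 3 = c ^ 3 ∧ b ^ 3 = c ^ 3)) (n : ℕ) :
    ∃ E : Submodule k (Sklyanin k a b c), Module.Finite k E ∧ Module.finrank k E ≤ 3 ∧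
      deg k a b c (n + 1) ≤ (deg k a b c n).map (LinearMap.mulLeft k (X k a b c)) ⊔
        gDeg k a b c (n + 1) ⊔ E := by
  obtain ⟨ζ, hζ⟩ := exists_primitive_cube_root k
  have hζ3 : ζ ^ 3 = 1 := by linear_combination (ζ - 1) * hζ
  have hω (i : Fin 3) : (ζ ^ (i : ℕ)) ^ 3 = 1 := by rw [← pow_mul, mul_comm, pow_mul, hζ3, one_pow]
  choose P hP hP0 hPω using fun i => exists_base_orbit habc hne (hω i) 0
  let f : Sklyanin k a b c →ₗ[k] (Fin 3 → k) := LinearMap.pi fun i => (hP i).ev 0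
  let K := LinearMap.ker (f.domRestrict (deg k a b c (n + 1)))
  obtain ⟨E, hE⟩ := K.exists_isCompl
  refine ⟨E.map (deg k a b c (n + 1)).subtype, inferInstance, ?_, fun u hu => ?_⟩
  · have h₁ := Submodule.finrank_add_eq_of_isCompl hE
    have h₂ := LinearMap.finrank_range_add_finrank_ker (f.domRestrict (deg k a b c (n + 1)))
    have h₃ := Submodule.finrank_le (LinearMap.range (f.domRestrict (deg k a b c (n + 1))))
    have h₄ := Submodule.finrank_map_le (deg k a b c (n + 1)).subtype E
    rw [Module.finrank_fin_fun] at h₃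
    change Module.finrank k K + _ = _ at h₁
    change _ + Module.finrank k K = _ at h₂
    omega
  · obtain ⟨v, hv, e, he, hve⟩ := Submodule.mem_sup.1
      (hE.sup_eq_top ▸ Submodule.mem_top : (⟨u, hu⟩ : deg k a b c (n + 1)) ∈ K ⊔ E)
    obtain rfl : v.1 + e.1 = u := congrArg Subtype.val hve
    refine Submodule.add_mem_sup ?_ ⟨e, he, rfl⟩
    have hbase : BaseVanish a b c v.1 := fun ω hω' Q hQ hQ0 hQω => by
      obtain ⟨i, rfl⟩ : ∃ i : Fin 3, ζ ^ (i : ℕ) = ω := by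
        have : (ω - 1) * ((ω - ζ) * (ω - ζ ^ 2)) = 0 := by
          linear_combination hω' + hζ3 * (ω - 1) + (ω - ω ^ 2) * hζ
        rcases mul_eq_zero.1 this with h | h
        · exact ⟨0, by simpa using (sub_eq_zero.1 h).symm⟩
        rcases mul_eq_zero.1 h with h | h
        · exact ⟨1, by simpa using (sub_eq_zero.1 h).symm⟩
        · exact ⟨2, by simpa using (sub_eq_zero.1 h).symm⟩
      exact hQ.ev_eq_zero_of_eq habc hne hQ0 (hP i) (hP0 i) (hQω.trans (hPω i).symm) v.2
        (congrFun hv i)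
    obtain ⟨s, hs, w, hw, e⟩ := hbase.exists_sub_mem habc hne v.2
    rw [e]
    exact Submodule.add_mem_sup ⟨s, hs, rfl⟩ hw

lemma finrank_deg_le (habc : a * b * c ≠ 0) (hne : ¬ (a ^ 3 = c ^ 3 ∧ b ^ 3 = c ^ 3)) (n : ℕ) :
    Module.finrank k (deg k a b c (n + 1)) ≤
      Module.finrank k (gDeg k a b c (n + 1)) + 3 * (n + 1) := by
  suffices ∃ D : Submodule k (Sklyanin k a b c), Module.Finite k D ∧
      Module.finrank k D ≤ 3 * (n + 1) ∧ deg k a b c (n + 1) ≤ gDeg k a b c (n + 1) ⊔ D by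
    obtain ⟨D, _, hD, hle⟩ := this
    have h₁ := Submodule.finrank_mono hle
    have h₂ := Submodule.finrank_add_le_finrank_add_finrank (gDeg k a b c (n + 1)) D
    omega
  induction n with
  | zero =>
    refine ⟨deg k a b c 1, inferInstance, ?_, le_sup_right⟩
    rw [deg_one]
    exact finrank_range_le_card gen
  | succ n ih =>
    obtain ⟨D, _, hD, hle⟩ := ih
    obtain ⟨E, _, hE, hle'⟩ := exists_deg_le_sup habc hne (n + 1)
    refine ⟨D.map (LinearMap.mulLeft k (X k a b c)) ⊔ E, inferInstance, ?_, hle'.trans ?_⟩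
    · have := Submodule.finrank_add_le_finrank_add_finrank
        (D.map (LinearMap.mulLeft k (X k a b c))) E
      have := Submodule.finrank_map_le (LinearMap.mulLeft k (X k a b c)) D
      omega
    · refine sup_le (sup_le ?_ le_sup_left) (le_sup_right.trans le_sup_right)
      refine (Submodule.map_mono hle).trans ?_
      rw [Submodule.map_sup]
      refine sup_le (le_sup_of_le_left ?_) (le_sup_of_le_right le_sup_left)
      rintro _ ⟨w, hw, rfl⟩
      rw [add_comm]
      exact mul_mem_gDeg X_mem_deg hw

end dimension

end centralPart

end Sklyanin

namespace Sklyanin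

open Polynomial

section koszul

variable {k : Type*} [Field k] {a b c : k}

variable (k a b c) in
/-- The map `s ↦ x s₀ + y s₁ + z s₂`. -/
def genMap : (Fin 3 → Sklyanin k a b c) →ₗ[k] Sklyanin k a b c :=
  LinearMap.lsum k _ k fun i => LinearMap.mulLeft k (gen i)

lemma genMap_apply (v : Fin 3 → Sklyanin k a b c) : genMap k a b c v = ∑ i, gen i * v i := by
  simp [genMap]

variable (k a b c) in
/-- The syzygies generated by the defining relations. -/
def relMap : (Fin 3 → Sklyanin k a b c) →ₗ[k] (Fin 3 → Sklyanin k a b c) :=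
  LinearMap.pi fun i => LinearMap.lsum k _ k fun j => LinearMap.mulLeft k (relCoeff k a b c j i)

lemma relMap_apply (t : Fin 3 → Sklyanin k a b c) (i : Fin 3) :
    relMap k a b c t i = ∑ j, relCoeff k a b c j i * t j := by
  simp [relMap]

lemma sum_relCoeff_mul_gen (i : Fin 3) : ∑ j, relCoeff k a b c j i * gen j = 0 := by
  fin_cases i
  · rw [← rel_YZ]; simp [Fin.sum_univ_three, gen, relCoeff]; abel
  · rw [← rel_ZX]; simp [Fin.sum_univ_three, gen, relCoeff]; abel
  · rw [← rel_XY]; simp [Fin.sum_univ_three, gen, relCoeff, add_comm]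

lemma relMap_gen_mul (u : Sklyanin k a b c) : relMap k a b c (fun j => gen j * u) = 0 := by
  ext i
  simp only [relMap_apply, ← mul_assoc, ← Finset.sum_mul, sum_relCoeff_mul_gen, zero_mul,
    Pi.zero_apply]

variable (k a b c) in
/-- The action of the generators on `S × (S³ / im relMap)`. -/
def syzygyAction (i : Fin 3) : Module.End k
    (Sklyanin k a b c × (Fin 3 → Sklyanin k a b c) ⧸ LinearMap.range (relMap k a b c)) :=
  LinearMap.prod (LinearMap.mulLeft k (gen i) ∘ₗ LinearMap.fst k _ _)
    ((LinearMap.range (relMap k a b c)).mkQ ∘ₗ LinearMap.single k _ i ∘ₗ LinearMap.fst k _ _)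

lemma syzygyAction_apply (i : Fin 3)
    (m : Sklyanin k a b c × (Fin 3 → Sklyanin k a b c) ⧸ LinearMap.range (relMap k a b c)) :
    syzygyAction k a b c i m =
      (gen i * m.1, (LinearMap.range (relMap k a b c)).mkQ (Pi.single i m.1)) := rfl

lemma syzygyAction_aux (j : Fin 3) {α β γ : k} {l m n p q r : Fin 3}
    (h₁ : α • (gen l * gen m) + β • (gen n * gen p) + γ • (gen q * gen r : Sklyanin k a b c) = 0)
    (h₂ : ∀ u : Sklyanin k a b c, α • Pi.single (M := fun _ => Sklyanin k a b c) l (gen m * u) +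
      β • Pi.single (M := fun _ => Sklyanin k a b c) n (gen p * u) +
      γ • Pi.single (M := fun _ => Sklyanin k a b c) q (gen r * u) =
        relMap k a b c (Pi.single j u)) :
    α • (syzygyAction k a b c l * syzygyAction k a b c m) +
      β • (syzygyAction k a b c n * syzygyAction k a b c p) +
      γ • (syzygyAction k a b c q * syzygyAction k a b c r) = 0 := by
  refine LinearMap.ext fun v => Prod.ext ?_ ?_
  · have := congrArg (· * v.1) h₁
    simpa [syzygyAction_apply, add_mul, mul_assoc] using this
  · simp only [LinearMap.add_apply, LinearMap.smul_apply, Module.End.mul_apply,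
      syzygyAction_apply, Prod.snd_add, Prod.smul_snd, LinearMap.zero_apply, Prod.snd_zero,
      ← map_smul, ← map_add, h₂]
    exact (Submodule.Quotient.mk_eq_zero _).2 ⟨_, rfl⟩

lemma gen_mem_deg (i : Fin 3) : (gen i : Sklyanin k a b c) ∈ deg k a b c 1 :=
  by rw [deg_one]; exact gen_mem i

lemma relCoeff_mem_deg (j i : Fin 3) : relCoeff k a b c j i ∈ deg k a b c 1 :=
  by rw [deg_one]; exact relCoeff_mem j i

/-- Exactness of the Koszul complex at the second step. -/
lemma mem_range_relMap {v : Fin 3 → Sklyanin k a b c} (h : genMap k a b c v = 0) :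
    v ∈ LinearMap.range (relMap k a b c) := by
  set N := LinearMap.range (relMap k a b c) with hN
  let ψ : Sklyanin k a b c →ₐ[k] Module.End k _ := lift (syzygyAction k a b c)
    (syzygyAction_aux 0 rel_YZ fun u => by
      ext i; fin_cases i <;> simp [relMap_apply, Fin.sum_univ_three, relCoeff, gen])
    (syzygyAction_aux 1 rel_ZX fun u => by
      ext i; fin_cases i <;> simp [relMap_apply, Fin.sum_univ_three, relCoeff, gen])
    (syzygyAction_aux 2 rel_XY fun u => by
      ext i; fin_cases i <;> simp [relMap_apply, Fin.sum_univ_three, relCoeff, gen])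
  have hψ (i : Fin 3) : ψ (gen i) = syzygyAction k a b c i := by
    fin_cases i
    · exact lift_X ..
    · exact lift_Y ..
    · exact lift_Z ..
  have hψ1 (s : Sklyanin k a b c) : ∀ m, (ψ s m).1 = s * m.1 := by
    have hs : s ∈ Algebra.adjoin k (Set.range (gen (k := k) (a := a) (b := b) (c := c))) := by
      rw [adjoin_range_gen]; trivial
    induction hs using Algebra.adjoin_induction with
    | mem x hx =>
      obtain ⟨i, rfl⟩ := hx
      intro m
      rw [hψ, syzygyAction_apply]
    | algebraMap r => intro m; simp [Algebra.smul_def]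
    | add x y _ _ hx hy => intro m; simp [hx, hy, add_mul]
    | mul x y _ _ hx hy => intro m; simp [hx, hy, mul_assoc]
  have key : ψ (genMap k a b c v) (1, 0) = (genMap k a b c v, N.mkQ v) := by
    rw [genMap_apply, map_sum, LinearMap.sum_apply]
    simp only [map_mul, Module.End.mul_apply, hψ, syzygyAction_apply, hψ1, mul_one]
    refine Prod.ext (by simp [Prod.fst_sum]) ?_
    rw [Prod.snd_sum, ← map_sum, Finset.univ_sum_single]
  rw [h, map_zero, LinearMap.zero_apply] at key
  exact (Submodule.Quotient.mk_eq_zero _).1 (congrArg Prod.snd key).symm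

lemma exists_relMap_eq {n : ℕ} {v : Fin 3 → Sklyanin k a b c}
    (hv : ∀ i, v i ∈ deg k a b c (n + 1)) (h : genMap k a b c v = 0) :
    ∃ t, (∀ j, t j ∈ deg k a b c n) ∧ relMap k a b c t = v := by
  obtain ⟨t, rfl⟩ := mem_range_relMap h
  refine ⟨fun j => comp n (t j), fun j => comp_mem _ _, funext fun i => ?_⟩
  have := comp_of_mem (hv i) (n + 1)
  rw [if_pos rfl] at this
  rw [← this, relMap_apply, relMap_apply, map_sum]
  refine Finset.sum_congr rfl fun j _ => ?_
  rw [add_comm, comp_mul_of_mem (relCoeff_mem_deg j i)]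

lemma eq_zero_of_genMap {v : Fin 3 → Sklyanin k a b c}
    (hv : ∀ i, v i ∈ deg k a b c 0) (h : genMap k a b c v = 0) : v = 0 := by
  obtain ⟨t, rfl⟩ := mem_range_relMap h
  funext i
  have := comp_of_mem (hv i) 0
  rw [if_pos rfl] at this
  rw [← this, relMap_apply, map_sum]
  refine Finset.sum_eq_zero fun j _ => ?_
  rw [comp_apply, map_mul, Polynomial.mul_coeff_zero, ← comp_apply, ← comp_apply,
    comp_of_mem (relCoeff_mem_deg j i), if_neg one_ne_zero, zero_mul]

instance : Nontrivial (Sklyanin k a b c) :=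
  (lift (A := k) (0 : Fin 3 → k) (by simp) (by simp) (by simp)).toRingHom.domain_nontrivial

section finrank

variable (k a b c) in
/-- The restriction of `genMap` to vectors of degree `n`. -/
def genMapDeg (n : ℕ) : (Fin 3 → deg k a b c n) →ₗ[k] Sklyanin k a b c :=
  genMap k a b c ∘ₗ (deg k a b c n).subtype.compLeft (Fin 3)

variable (k a b c) in
/-- The restriction of `relMap` to vectors of degree `n`. -/
def relMapDeg (n : ℕ) : (Fin 3 → deg k a b c n) →ₗ[k] (Fin 3 → Sklyanin k a b c) :=
  relMap k a b c ∘ₗ (deg k a b c n).subtype.compLeft (Fin 3)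

lemma range_genMapDeg (n : ℕ) : LinearMap.range (genMapDeg k a b c n) = deg k a b c (n + 1) := by
  refine le_antisymm ?_ fun u hu => ?_
  · rintro _ ⟨v, rfl⟩
    change genMap k a b c _ ∈ _
    rw [genMap_apply]
    refine sum_mem fun i _ => ?_
    rw [add_comm]
    exact mul_mem_deg (gen_mem_deg i) (v i).2
  · obtain ⟨s, hs, t, ht, r, hr, rfl⟩ := mem_deg_succ hu
    refine ⟨![⟨s, hs⟩, ⟨t, ht⟩, ⟨r, hr⟩], ?_⟩
    change genMap k a b c _ = _
    simp [genMap_apply, Fin.sum_univ_three, gen]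

lemma finrank_deg_succ (n : ℕ) : Module.finrank k (deg k a b c (n + 1)) +
    Module.finrank k (LinearMap.ker (genMapDeg k a b c n)) =
      3 * Module.finrank k (deg k a b c n) := by
  rw [← range_genMapDeg, LinearMap.finrank_range_add_finrank_ker, Module.finrank_pi_fintype]
  simp

lemma finrank_ker_genMapDeg_le (n : ℕ) :
    Module.finrank k (LinearMap.ker (genMapDeg k a b c (n + 1))) ≤
      Module.finrank k (LinearMap.range (relMapDeg k a b c n)) := by
  let f : LinearMap.ker (genMapDeg k a b c (n + 1)) →ₗ[k] LinearMap.range (relMapDeg k a b c n) :=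
    ((deg k a b c (n + 1)).subtype.compLeft (Fin 3) ∘ₗ Submodule.subtype _).codRestrict _
      fun v => by
        obtain ⟨t, ht, htv⟩ := exists_relMap_eq (fun i => (v.1 i).2) v.2
        exact ⟨fun i => ⟨t i, ht i⟩, htv⟩
  refine LinearMap.finrank_le_finrank_of_injective (f := f) fun v w h => ?_
  refine Subtype.ext (funext fun i => Subtype.ext ?_)
  exact congrFun (congrArg Subtype.val h) i

lemma finrank_range_relMapDeg (n : ℕ) :
    Module.finrank k (LinearMap.range (relMapDeg k a b c n)) +
      Module.finrank k (LinearMap.ker (relMapDeg k a b c n)) =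
      3 * Module.finrank k (deg k a b c n) := by
  rw [LinearMap.finrank_range_add_finrank_ker, Module.finrank_pi_fintype]
  simp

lemma finrank_le_ker_relMapDeg {n : ℕ}
    (h : ∀ u ∈ deg k a b c n, (∀ i, gen i * u = 0) → u = 0) :
    Module.finrank k (deg k a b c n) ≤
      Module.finrank k (LinearMap.ker (relMapDeg k a b c (n + 1))) := by
  let f : deg k a b c n →ₗ[k] LinearMap.ker (relMapDeg k a b c (n + 1)) :=
    { toFun u := ⟨fun i => ⟨gen i * u.1, by
        rw [add_comm]; exact mul_mem_deg (gen_mem_deg i) u.2⟩,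
        by
          rw [LinearMap.mem_ker, ← relMap_gen_mul u.1]; rfl⟩
      map_add' u v := by ext; simp [mul_add]
      map_smul' r u := by ext; simp }
  refine LinearMap.finrank_le_finrank_of_injective (f := f) ?_
  rw [injective_iff_map_eq_zero]
  intro u hu
  refine Subtype.ext (h u u.2 fun i => ?_)
  exact congrArg (fun w : LinearMap.ker (relMapDeg k a b c (n + 1)) => (w.1 i).1) hu

lemma finrank_deg_zero : Module.finrank k (deg k a b c 0) = 1 := by
  rw [deg, pow_zero, Submodule.one_eq_span]
  exact finrank_span_singleton one_ne_zero

lemma finrank_deg_one : Module.finrank k (deg k a b c 1) = 3 := by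
  have h := finrank_deg_succ (k := k) (a := a) (b := b) (c := c) 0
  have : LinearMap.ker (genMapDeg k a b c 0) = ⊥ := by
    refine LinearMap.ker_eq_bot'.2 fun v hv => funext fun i => Subtype.ext ?_
    exact congrFun (eq_zero_of_genMap (fun i => (v i).2) hv) i
  rw [this, finrank_bot, finrank_deg_zero] at h
  exact h

lemma finrank_deg_two_ge : 6 ≤ Module.finrank k (deg k a b c 2) := by
  have h₁ := finrank_deg_succ (k := k) (a := a) (b := b) (c := c) 1
  have h₂ := finrank_ker_genMapDeg_le (k := k) (a := a) (b := b) (c := c) 0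
  have h₃ := finrank_range_relMapDeg (k := k) (a := a) (b := b) (c := c) 0
  rw [finrank_deg_one] at h₁
  rw [finrank_deg_zero] at h₃
  simp only [Nat.reduceAdd] at *
  omega

lemma finrank_deg_add_three_ge {n : ℕ}
    (h : ∀ u ∈ deg k a b c n, (∀ i, gen i * u = 0) → u = 0) :
    3 * Module.finrank k (deg k a b c (n + 2)) + Module.finrank k (deg k a b c n) ≤
      Module.finrank k (deg k a b c (n + 3)) + 3 * Module.finrank k (deg k a b c (n + 1)) := by
  have h₁ := finrank_deg_succ (k := k) (a := a) (b := b) (c := c) (n + 2)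
  have h₂ := finrank_ker_genMapDeg_le (k := k) (a := a) (b := b) (c := c) (n + 1)
  have h₃ := finrank_range_relMapDeg (k := k) (a := a) (b := b) (c := c) (n + 1)
  have h₄ := finrank_le_ker_relMapDeg h
  change Module.finrank k (deg k a b c (n + 3)) + _ = _ at h₁
  change Module.finrank k (LinearMap.ker (genMapDeg k a b c (n + 2))) ≤ _ at h₂
  omega

lemma finrank_gDeg_le (n : ℕ) :
    Module.finrank k (gDeg k a b c (n + 3)) ≤ Module.finrank k (deg k a b c n) :=
  Submodule.finrank_map_le _ _

end finrank

end koszul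

section domain

variable {k : Type*} [Field k] [IsAlgClosed k] [CharZero k] {a b c : k}

/-- The Hilbert series of `S`, and regularity of `g`. -/
lemma hilbert_aux (habc : a * b * c ≠ 0)
    (hdeg : (3 * a * b * c) ^ 3 ≠ (a ^ 3 + b ^ 3 + c ^ 3) ^ 3)
    (hne : ¬ (a ^ 3 = c ^ 3 ∧ b ^ 3 = c ^ 3)) (m : ℕ) :
    2 * Module.finrank k (deg k a b c m) = (m + 1) * (m + 2) ∧
    2 * Module.finrank k (deg k a b c (m + 1)) = (m + 2) * (m + 3) ∧
    2 * Module.finrank k (deg k a b c (m + 2)) = (m + 3) * (m + 4) ∧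
    ∀ j < m, ∀ u ∈ deg k a b c j, g k a b c * u = 0 → u = 0 := by
  induction m with
  | zero =>
    have h := finrank_deg_le habc hne 1
    have h₂ := finrank_deg_two_ge (k := k) (a := a) (b := b) (c := c)
    rw [show gDeg k a b c (1 + 1) = ⊥ from rfl, finrank_bot] at h
    rw [finrank_deg_zero, finrank_deg_one]
    refine ⟨rfl, rfl, ?_, by omega⟩
    change Module.finrank k (deg k a b c 2) ≤ _ at h
    change 2 * Module.finrank k (deg k a b c 2) = _
    omega
  | succ m ih =>
    obtain ⟨h₀, h₁, h₂, hreg⟩ := ih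
    have hsoc (j : ℕ) : j ≤ m → ∀ u ∈ deg k a b c j, (∀ i, gen i * u = 0) → u = 0 := by
      induction j using Nat.strong_induction_on with
      | _ j ih =>
        intro hj u hu h
        obtain rfl | ⟨l, w, rfl, hw, rfl⟩ :=
          mem_gDeg.1 (mem_gDeg_of_gen_mul_eq_zero habc hdeg hne hu h)
        · rfl
        · rw [ih l (by omega) (by omega) w hw fun i => ?_, mul_zero]
          refine hreg (1 + l) (by omega) _ (mul_mem_deg (gen_mem_deg i) hw) ?_
          rw [← mul_assoc, g_comm, mul_assoc]
          exact h i
    have h₃ := finrank_deg_add_three_ge (hsoc m le_rfl)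
    have h₄ := finrank_deg_le habc hne (m + 2)
    have h₅ := finrank_gDeg_le (k := k) (a := a) (b := b) (c := c) m
    change Module.finrank k (deg k a b c (m + 3)) ≤ Module.finrank k (gDeg k a b c (m + 3)) + _
      at h₄
    refine ⟨h₁, h₂, ?_, ?_⟩
    · change 2 * Module.finrank k (deg k a b c (m + 3)) = _
      nlinarith
    · intro j hj u hu hgu
      obtain hj | rfl := Nat.lt_succ_iff_lt_or_eq.1 hj
      · exact hreg j hj u hu hgu
      have hle : Module.finrank k (deg k a b c j) ≤ Module.finrank k (gDeg k a b c (j + 3)) := by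
        nlinarith
      let f := (LinearMap.mulLeft k (g k a b c)).domRestrict (deg k a b c j)
      have hf : LinearMap.range f = gDeg k a b c (j + 3) := LinearMap.range_domRestrict _ _
      have := LinearMap.finrank_range_add_finrank_ker f
      rw [hf] at this
      have hker : LinearMap.ker f = ⊥ := Submodule.finrank_eq_zero.1 (by omega)
      exact congrArg Subtype.val (LinearMap.ker_eq_bot'.1 hker ⟨u, hu⟩ hgu)

lemma eq_zero_of_g_mul (habc : a * b * c ≠ 0)
    (hdeg : (3 * a * b * c) ^ 3 ≠ (a ^ 3 + b ^ 3 + c ^ 3) ^ 3)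
    (hne : ¬ (a ^ 3 = c ^ 3 ∧ b ^ 3 = c ^ 3)) {m : ℕ} {u : Sklyanin k a b c}
    (hu : u ∈ deg k a b c m) (h : g k a b c * u = 0) : u = 0 :=
  (hilbert_aux habc hdeg hne (m + 1)).2.2.2 m (by omega) u hu h

lemma eq_zero_or_eq_zero_of_mul (habc : a * b * c ≠ 0)
    (hdeg : (3 * a * b * c) ^ 3 ≠ (a ^ 3 + b ^ 3 + c ^ 3) ^ 3)
    (hne : ¬ (a ^ 3 = c ^ 3 ∧ b ^ 3 = c ^ 3)) {m n : ℕ} {u v : Sklyanin k a b c}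
    (hu : u ∈ deg k a b c m) (hv : v ∈ deg k a b c n) (h : u * v = 0) : u = 0 ∨ v = 0 := by
  induction hN : m + n using Nat.strong_induction_on generalizing m n u v with
  | _ N ih =>
    obtain hu' | hv' := mem_gDeg_or_mem_gDeg habc hdeg hne hu hv (h ▸ zero_mem _)
    · obtain rfl | ⟨l, w, rfl, hw, rfl⟩ := mem_gDeg.1 hu'
      · exact .inl rfl
      have : w * v = 0 := eq_zero_of_g_mul habc hdeg hne (mul_mem_deg hw hv) (by rw [← mul_assoc, h])
      exact (ih (l + n) (by omega) hw hv this rfl).imp_left fun h => by rw [h, mul_zero]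
    · obtain rfl | ⟨l, w, rfl, hw, rfl⟩ := mem_gDeg.1 hv'
      · exact .inr rfl
      have : u * w = 0 := eq_zero_of_g_mul habc hdeg hne (mul_mem_deg hu hw) (by
        rw [← mul_assoc, g_comm, mul_assoc, h])
      exact (ih (m + l) (by omega) hu hw this rfl).imp_right fun h => by rw [h, mul_zero]

lemma noZeroDivisors (habc : a * b * c ≠ 0)
    (hdeg : (3 * a * b * c) ^ 3 ≠ (a ^ 3 + b ^ 3 + c ^ 3) ^ 3)
    (hne : ¬ (a ^ 3 = c ^ 3 ∧ b ^ 3 = c ^ 3)) : NoZeroDivisors (Sklyanin k a b c) := by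
  have hinj (s : Sklyanin k a b c) (h : gradeHom k a b c s = 0) : s = 0 :=
    eq_zero_of_comp fun n => by rw [comp_apply, h, Polynomial.coeff_zero]
  refine ⟨fun {s t} h => ?_⟩
  by_contra! hst
  have hs : (gradeHom k a b c s).leadingCoeff ≠ 0 := 
    Polynomial.leadingCoeff_ne_zero.2 (mt (hinj s) hst.1)
  have ht : (gradeHom k a b c t).leadingCoeff ≠ 0 := 
    Polynomial.leadingCoeff_ne_zero.2 (mt (hinj t) hst.2)
  have := Polynomial.coeff_mul_degree_add_degree (gradeHom k a b c s) (gradeHom k a b c t)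
  rw [← map_mul, h, map_zero, Polynomial.coeff_zero] at this
  exact (eq_zero_or_eq_zero_of_mul habc hdeg hne (comp_mem _ s) (comp_mem _ t) this.symm).elim hs ht

end domain

end Sklyanin

namespace Sklyanin

open Polynomial

section center

variable {k : Type*} [Field k] {a b c : k}

lemma comp_mem_center {s : Sklyanin k a b c} (hs : s ∈ Subalgebra.center k (Sklyanin k a b c))
    (n : ℕ) : comp n s ∈ Subalgebra.center k (Sklyanin k a b c) := by
  refine mem_center_of_commute_gen fun i => ?_
  rw [← comp_mul_of_mem (gen_mem_deg i), ← comp_mul_of_mem_right (gen_mem_deg i), add_comm,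
    Subalgebra.mem_center_iff.1 hs]

lemma comp_mul (n : ℕ) (s t : Sklyanin k a b c) :
    comp n (s * t) = ∑ p ∈ Finset.HasAntidiagonal.antidiagonal n, comp p.1 s * comp p.2 t := by
  rw [comp_apply, map_mul, Polynomial.coeff_mul]
  rfl

lemma comp_g_mul_mem (n : ℕ) (s : Sklyanin k a b c) : comp n (g k a b c * s) ∈ gDeg k a b c n := by
  by_cases hn : 3 ≤ n
  · obtain ⟨m, rfl⟩ := Nat.exists_eq_add_of_le' hn
    rw [add_comm m, comp_mul_of_mem g_mem_deg, add_comm]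
    exact mem_gDeg_add_three.2 ⟨_, comp_mem _ _, rfl⟩
  · rw [comp_mul, Finset.sum_eq_zero fun p hp => ?_]
    · exact zero_mem _
    · have := Finset.HasAntidiagonal.mem_antidiagonal.1 hp
      rw [comp_of_mem g_mem_deg, if_neg (by omega), zero_mul]

lemma exists_comp_bound (T : Finset (Sklyanin k a b c)) :
    ∃ L, ∀ s ∈ T, ∀ n, L ≤ n → comp n s = 0 := by
  refine ⟨T.sup (fun s => (gradeHom k a b c s).natDegree) + 1, fun s hs n hn => ?_⟩
  refine Polynomial.coeff_eq_zero_of_natDegree_lt (lt_of_lt_of_le ?_ hn)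
  exact Nat.lt_succ_of_le (Finset.le_sup (f := fun s => (gradeHom k a b c s).natDegree) hs)

lemma pow_mem_deg {n : ℕ} {u : Sklyanin k a b c} (hu : u ∈ deg k a b c n) (m : ℕ) :
    u ^ m ∈ deg k a b c (n * m) := by
  rw [deg, pow_mul]
  exact Submodule.pow_mem_pow _ hu m

/-- If the center is one-dimensional modulo `g` in every degree and `S` is finite over it, then
`S / gS` has bounded Hilbert function. -/
lemma exists_finrank_bound
    (hfin : Module.Finite (Subalgebra.center k (Sklyanin k a b c)) (Sklyanin k a b c))
    (ζ : ℕ → Sklyanin k a b c)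
    (hζ : ∀ n, ∀ z ∈ Subalgebra.center k (Sklyanin k a b c), z ∈ deg k a b c n →
      ∃ r : k, z - r • ζ n ∈ gDeg k a b c n) :
    ∃ N, ∀ n, Module.finrank k (deg k a b c n) ≤ N + Module.finrank k (gDeg k a b c n) := by
  classical
  obtain ⟨T, hT⟩ := hfin
  obtain ⟨L, hL⟩ := exists_comp_bound T
  refine ⟨(T ×ˢ Finset.range L).card, fun n => ?_⟩
  let W : Finset (Sklyanin k a b c) :=
    (T ×ˢ Finset.range L).image fun p => comp p.2 p.1 * ζ (n - p.2)
  have hle : deg k a b c n ≤ Submodule.span k W ⊔ gDeg k a b c n := by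
    intro u hu
    have hcomp : comp n u = u := by rw [comp_of_mem hu, if_pos rfl]
    obtain ⟨f, -, rfl⟩ := Submodule.mem_span_finset.1 (hT ▸ Submodule.mem_top :
      u ∈ Submodule.span (Subalgebra.center k (Sklyanin k a b c)) T)
    rw [← hcomp, map_sum]
    refine sum_mem fun t ht => ?_
    change comp n ((f t : Sklyanin k a b c) * t) ∈ _
    rw [comp_mul]
    refine sum_mem fun p hp => ?_
    obtain hp := Finset.HasAntidiagonal.mem_antidiagonal.1 hp
    have hc := comp_mem_center (f t).2 p.1
    rw [← Subalgebra.mem_center_iff.1 hc]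
    by_cases hpL : p.2 < L
    · obtain ⟨r, hr⟩ := hζ p.1 _ hc (comp_mem _ _)
      rw [← add_sub_cancel (r • ζ p.1) (comp p.1 (f t : Sklyanin k a b c)), mul_add, mul_smul_comm]
      refine Submodule.add_mem_sup (Submodule.smul_mem _ _ (Submodule.subset_span ?_)) ?_
      · refine Finset.mem_image.2 ⟨(t, p.2), by simp [ht, hpL], ?_⟩
        rw [← hp, Nat.add_sub_cancel]
      · rw [← hp, add_comm]
        exact mul_mem_gDeg (comp_mem _ _) hr
    · rw [hL t ht _ (not_lt.1 hpL), zero_mul]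
      exact zero_mem _
  have h₁ := Submodule.finrank_mono hle
  have h₂ := Submodule.finrank_add_le_finrank_add_finrank (Submodule.span k (W : Set _))
    (gDeg k a b c n)
  have h₃ := finrank_span_finset_le_card (R := k) W
  have h₄ : W.card ≤ (T ×ˢ Finset.range L).card := Finset.card_image_le
  simp only [Set.finrank] at h₃
  omega

variable {d : ℕ} {z : Fin 2 → Subalgebra.center k (Sklyanin k a b c)}

lemma aeval_mem_deg (hz : ∀ i, (z i : Sklyanin k a b c) ∈ deg k a b c d) {n : ℕ}
    {F : MvPolynomial (Fin 2) k} (hF : F.IsHomogeneous n) :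
    (MvPolynomial.aeval z F : Sklyanin k a b c) ∈ deg k a b c (d * n) := by
  rw [MvPolynomial.aeval_def, MvPolynomial.eval₂_eq', AddSubmonoidClass.coe_finsetSum]
  refine sum_mem fun m hm => ?_
  obtain rfl : m.weight 1 = n := hF (MvPolynomial.mem_support_iff.1 hm)
  rw [← Algebra.smul_def, Fin.prod_univ_two, Finsupp.weight_apply, Finsupp.sum_fintype _ _ (by simp),
    Fin.sum_univ_two]
  refine Submodule.smul_mem _ _ ?_
  simp only [Pi.one_apply, smul_eq_mul, mul_one, mul_add]
  exact mul_mem_deg (pow_mem_deg (hz 0) _) (pow_mem_deg (hz 1) _)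

lemma comp_aeval (hd : d ≠ 0) (hz : ∀ i, (z i : Sklyanin k a b c) ∈ deg k a b c d) (n : ℕ)
    (F : MvPolynomial (Fin 2) k) :
    comp (d * n) (MvPolynomial.aeval z F : Sklyanin k a b c) =
      MvPolynomial.aeval z (MvPolynomial.homogeneousComponent n F) := by
  have (m : ℕ) : comp (d * n) (MvPolynomial.aeval z (MvPolynomial.homogeneousComponent m F) :
      Sklyanin k a b c) = if m = n then
        (MvPolynomial.aeval z (MvPolynomial.homogeneousComponent m F) : Sklyanin k a b c) else 0 := by
    rw [comp_of_mem (aeval_mem_deg hz (MvPolynomial.homogeneousComponent_isHomogeneous m F))]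
    simp [hd]
  conv_lhs => rw [← MvPolynomial.sum_homogeneousComponent F, map_sum,
    AddSubmonoidClass.coe_finsetSum, map_sum]
  simp only [this, Finset.sum_ite_eq', Finset.mem_range]
  split_ifs with h
  · rfl
  · rw [MvPolynomial.homogeneousComponent_eq_zero _ _ (by omega), map_zero]; rfl

end center

section independent

variable {k : Type*} [Field k] [IsAlgClosed k] [CharZero k] {a b c : k}

/-- The center contains two elements of the same degree which are independent modulo `g`. -/
lemma exists_independent_mod_g (habc : a * b * c ≠ 0)
    (hdeg : (3 * a * b * c) ^ 3 ≠ (a ^ 3 + b ^ 3 + c ^ 3) ^ 3)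
    (hne : ¬ (a ^ 3 = c ^ 3 ∧ b ^ 3 = c ^ 3))
    (hfin : Module.Finite (Subalgebra.center k (Sklyanin k a b c)) (Sklyanin k a b c)) :
    ∃ d, ∃ z : Fin 2 → Subalgebra.center k (Sklyanin k a b c),
      (∀ i, (z i : Sklyanin k a b c) ∈ deg k a b c d) ∧
      ∀ α β : k, α • (z 0 : Sklyanin k a b c) + β • (z 1 : Sklyanin k a b c) ∈ gDeg k a b c d →
        α = 0 ∧ β = 0 := by
  by_contra! hcon
  have hζ (n : ℕ) : ∃ ζ, ∀ z ∈ Subalgebra.center k (Sklyanin k a b c), z ∈ deg k a b c n →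
      ∃ r : k, z - r • ζ ∈ gDeg k a b c n := by
    by_cases h : ∀ z ∈ Subalgebra.center k (Sklyanin k a b c), z ∈ deg k a b c n →
      z ∈ gDeg k a b c n
    · exact ⟨0, fun z hz hzn => ⟨0, by simpa using h z hz hzn⟩⟩
    · push Not at h
      obtain ⟨ζ, hζ, hζn, hζg⟩ := h
      refine ⟨ζ, fun z hz hzn => ?_⟩
      obtain ⟨α, β, h, hαβ⟩ := hcon n ![⟨ζ, hζ⟩, ⟨z, hz⟩] (by
        intro i; fin_cases i; exacts [hζn, hzn])
      change α • ζ + β • z ∈ _ at h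
      have hβ : β ≠ 0 := by
        rintro rfl
        rw [zero_smul, add_zero] at h
        refine hαβ ?_ rfl
        by_contra hα
        exact hζg (((gDeg k a b c n).smul_mem_iff hα).1 h)
      refine ⟨-(β⁻¹ * α), ?_⟩
      have := (gDeg k a b c n).smul_mem β⁻¹ h
      rwa [smul_add, smul_smul, smul_smul, inv_mul_cancel₀ hβ, one_smul, add_comm,
        ← sub_neg_eq_add, ← neg_smul] at this
  choose ζ hζ using hζ
  obtain ⟨N, hN⟩ := exists_finrank_bound hfin ζ hζ
  have h₁ := hN (N + 3)
  have h₂ := finrank_gDeg_le (k := k) (a := a) (b := b) (c := c) N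
  have h₃ := (hilbert_aux habc hdeg hne (N + 3)).1
  have h₄ := (hilbert_aux habc hdeg hne N).1
  nlinarith

variable {d : ℕ} {z : Fin 2 → Subalgebra.center k (Sklyanin k a b c)}

lemma aeval_homogenize_not_mem (habc : a * b * c ≠ 0)
    (hdeg : (3 * a * b * c) ^ 3 ≠ (a ^ 3 + b ^ 3 + c ^ 3) ^ 3)
    (hne : ¬ (a ^ 3 = c ^ 3 ∧ b ^ 3 = c ^ 3))
    (hz : ∀ i, (z i : Sklyanin k a b c) ∈ deg k a b c d)
    (hind : ∀ α β : k, α • (z 0 : Sklyanin k a b c) + β • (z 1 : Sklyanin k a b c) ∈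
      gDeg k a b c d → α = 0 ∧ β = 0) (n : ℕ) {p : Polynomial k} (hp : p ≠ 0)
    (hpn : p.natDegree ≤ n) :
    (MvPolynomial.aeval z (p.homogenize n) : Sklyanin k a b c) ∉ gDeg k a b c (d * n) := by
  induction n generalizing p with
  | zero =>
    obtain ⟨r, rfl⟩ : ∃ r, p = Polynomial.C r := ⟨_, Polynomial.eq_C_of_natDegree_le_zero hpn⟩
    rw [Polynomial.homogenize_C, pow_zero, mul_one, ← MvPolynomial.algebraMap_eq,
      AlgHom.commutes]
    intro h
    change algebraMap k (Sklyanin k a b c) r = 0 at h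
    rw [map_eq_zero_iff _ (FaithfulSMul.algebraMap_injective k _)] at h
    exact hp (by rw [h, map_zero])
  | succ n ih =>
    have step {q l : Polynomial k} (hq : q ≠ 0) (hqn : q.natDegree ≤ n) (hl : l.natDegree ≤ 1)
        (hlg : (MvPolynomial.aeval z (l.homogenize 1) : Sklyanin k a b c) ∉ gDeg k a b c d) :
        (MvPolynomial.aeval z ((q * l).homogenize (n + 1)) : Sklyanin k a b c) ∉
          gDeg k a b c (d * (n + 1)) := by
      rw [Polynomial.homogenize_mul _ _ hqn hl, map_mul]
      intro h
      refine (mem_gDeg_or_mem_gDeg habc hdeg hne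
        (aeval_mem_deg hz (Polynomial.isHomogeneous_homogenize q)) ?_ h).elim (ih hq hqn) hlg
      simpa using aeval_mem_deg hz (Polynomial.isHomogeneous_homogenize (n := 1) l)
    by_cases hpn' : p.natDegree ≤ n
    · rw [← mul_one p]
      refine step hp hpn' (by simp) fun h => ?_
      rw [Polynomial.homogenize_one, pow_one, MvPolynomial.aeval_X] at h
      exact one_ne_zero (hind 0 1 (by simpa using h)).2
    · obtain ⟨r, hr⟩ := IsAlgClosed.exists_root p
        (fun h => hpn' (by rw [Polynomial.natDegree_eq_of_degree_eq_some h]; exact Nat.zero_le _))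
      obtain ⟨q, rfl⟩ := Polynomial.dvd_iff_isRoot.2 hr
      have hq : q ≠ 0 := right_ne_zero_of_mul hp
      rw [Polynomial.natDegree_mul (Polynomial.X_sub_C_ne_zero r) hq,
        Polynomial.natDegree_X_sub_C] at hpn
      rw [mul_comm (Polynomial.X - Polynomial.C r) q]
      have hqn : q.natDegree ≤ n := by omega
      refine step hq hqn (Polynomial.natDegree_X_sub_C_le r) fun h => ?_
      have e : (Polynomial.X - Polynomial.C r).homogenize 1 =
          MvPolynomial.X 0 - MvPolynomial.C r * MvPolynomial.X 1 := by
        rw [Polynomial.homogenize_sub, Polynomial.homogenize_X one_ne_zero,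
          Polynomial.homogenize_C, pow_one, Nat.sub_self, pow_zero, mul_one]
      rw [e, map_sub, map_mul, MvPolynomial.aeval_X, MvPolynomial.aeval_X,
        ← MvPolynomial.algebraMap_eq, AlgHom.commutes, ← Algebra.smul_def] at h
      refine one_ne_zero (hind 1 (-r) ?_).1
      rw [one_smul, neg_smul, ← sub_eq_add_neg]
      exact h

lemma eq_zero_of_aeval_eq_g_mul (habc : a * b * c ≠ 0)
    (hdeg : (3 * a * b * c) ^ 3 ≠ (a ^ 3 + b ^ 3 + c ^ 3) ^ 3)
    (hne : ¬ (a ^ 3 = c ^ 3 ∧ b ^ 3 = c ^ 3))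
    (hz : ∀ i, (z i : Sklyanin k a b c) ∈ deg k a b c d)
    (hind : ∀ α β : k, α • (z 0 : Sklyanin k a b c) + β • (z 1 : Sklyanin k a b c) ∈
      gDeg k a b c d → α = 0 ∧ β = 0) {F : MvPolynomial (Fin 2) k} {s : Sklyanin k a b c}
    (h : (MvPolynomial.aeval z F : Sklyanin k a b c) = g k a b c * s) : F = 0 := by
  have hd : d ≠ 0 := by
    rintro rfl
    obtain ⟨r, hr⟩ := mem_deg_zero (hz 0)
    obtain ⟨t, ht⟩ := mem_deg_zero (hz 1)
    have hr0 : -r = 0 := (hind t (-r) (by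
      rw [hr, ht]
      simp [Algebra.smul_def, ← map_mul, mul_comm])).2
    rw [neg_eq_zero.1 hr0, map_zero] at hr
    exact one_ne_zero (hind 1 0 (by simp [hr])).1
  rw [← MvPolynomial.sum_homogeneousComponent F]
  refine Finset.sum_eq_zero fun n _ => ?_
  have hn := MvPolynomial.homogeneousComponent_isHomogeneous n F
  rw [← Polynomial.homogenize_eq_of_isHomogeneous hn rfl]
  by_contra h0
  set p : Polynomial k :=
    MvPolynomial.aeval ![Polynomial.X, 1] (MvPolynomial.homogeneousComponent n F) with hp
  have hpn : p.natDegree ≤ n := by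
    rw [hp, MvPolynomial.aeval_def, MvPolynomial.eval₂_eq']
    refine Polynomial.natDegree_sum_le_of_forall_le _ _ fun m hm => ?_
    have hmn : m.weight 1 = n := hn (MvPolynomial.mem_support_iff.1 hm)
    rw [Finsupp.weight_apply, Finsupp.sum_fintype _ _ (by simp), Fin.sum_univ_two] at hmn
    simp only [Pi.one_apply, smul_eq_mul, mul_one] at hmn
    simp only [Fin.prod_univ_two, Matrix.cons_val_zero, Matrix.cons_val_one, one_pow, mul_one]
    exact (Polynomial.natDegree_C_mul_X_pow_le _ _).trans (by omega)
  refine aeval_homogenize_not_mem habc hdeg hne hz hind n (p := p) ?_ hpn ?_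
  · intro hp0
    rw [hp0, Polynomial.homogenize_zero] at h0
    exact h0 rfl
  · rw [Polynomial.homogenize_eq_of_isHomogeneous hn rfl, ← comp_aeval hd hz, h]
    exact comp_g_mul_mem _ _

/-- The center contains two elements which together with `g` are algebraically independent. -/
lemma exists_algebraicIndependent (habc : a * b * c ≠ 0)
    (hdeg : (3 * a * b * c) ^ 3 ≠ (a ^ 3 + b ^ 3 + c ^ 3) ^ 3)
    (hne : ¬ (a ^ 3 = c ^ 3 ∧ b ^ 3 = c ^ 3))
    (hfin : Module.Finite (Subalgebra.center k (Sklyanin k a b c)) (Sklyanin k a b c)) :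
    ∃ z : Fin 2 → Subalgebra.center k (Sklyanin k a b c),
      AlgebraicIndependent k fun o : Option (Fin 2) => o.elim ⟨g k a b c, g_mem_center⟩ z := by
  obtain ⟨d, z, hz, hind⟩ := exists_independent_mod_g habc hdeg hne hfin
  have := noZeroDivisors habc hdeg hne
  have hz' : AlgebraicIndependent k z := by
    rw [algebraicIndependent_iff]
    intro F hF
    refine eq_zero_of_aeval_eq_g_mul habc hdeg hne hz hind (s := 0) ?_
    rw [hF, mul_zero]; rfl
  refine ⟨z, (hz'.option_iff_transcendental _).2 ?_⟩
  have hg : g k a b c ≠ 0 := fun h =>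
    one_ne_zero (eq_zero_of_g_mul habc hdeg hne (m := 0) (u := 1) (by
      simpa using algebraMap_mem_deg (k := k) (a := a) (b := b) (c := c) 1) (by rw [h, zero_mul]))
  rw [transcendental_iff]
  intro P hP
  induction hN : P.natDegree using Nat.strong_induction_on generalizing P with
  | _ N ih =>
    have hP' := hP
    rw [← P.divX_mul_X_add, map_add, map_mul, Polynomial.aeval_X, Polynomial.aeval_C] at hP
    obtain ⟨F, hF⟩ : ∃ F, MvPolynomial.aeval z F = (P.coeff 0 : Subalgebra.center k _) := by
      exact (Algebra.adjoin_range_eq_range_aeval k z).le (P.coeff 0).2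
    have hF0 : F = 0 := by
      refine eq_zero_of_aeval_eq_g_mul habc hdeg hne hz hind
        (s := -(Polynomial.aeval (⟨g k a b c, g_mem_center⟩ :
          Subalgebra.center k (Sklyanin k a b c)) P.divX : Sklyanin k a b c)) ?_
      rw [hF, g_comm, neg_mul]
      exact eq_neg_of_add_eq_zero_right (congrArg Subtype.val hP)
    have h0 : P.coeff 0 = 0 := Subtype.ext (by rw [← hF, hF0, map_zero]; rfl)
    have hdiv : Polynomial.aeval (⟨g k a b c, g_mem_center⟩ :
          Subalgebra.center k (Sklyanin k a b c)) P.divX = 0 := by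
      rw [h0, map_zero, add_zero] at hP
      refine Subtype.ext ((mul_eq_zero.1 (congrArg Subtype.val hP)).resolve_right hg)
    by_cases hd : P.natDegree = 0
    · rw [Polynomial.eq_C_of_natDegree_eq_zero hd, h0, map_zero]
    · have := ih _ (by rw [Polynomial.natDegree_divX_eq_natDegree_tsub_one]; omega) P.divX hdiv rfl
      rw [← P.divX_mul_X_add, this, h0, zero_mul, map_zero, add_zero]

end independent

end Sklyanin

namespace Sklyanin

open Polynomial

section fieldDerivations

variable {k K : Type*} [Field k] [Field K] [Algebra k K]

theorem existsUnique_derivation_extending {A : Type*} [CommRing A] [Algebra k A] [Algebra A K]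
    [IsScalarTower k A K] [Algebra.FormallyEtale A K] (d : Derivation k A K) :
    ∃! D : Derivation k K K, ∀ f : A, D (algebraMap A K f) = d f := by
  have hb := KaehlerDifferential.isBaseChange_of_formallyEtale k A K
  refine ⟨(hb.lift d.liftKaehlerDifferential).compDer (KaehlerDifferential.D k K), fun f => ?_,
    fun D' hD' => ?_⟩
  · have h := hb.lift_eq d.liftKaehlerDifferential (KaehlerDifferential.D k A f)
    rw [KaehlerDifferential.map_D] at h
    simpa using h
  · have h : D'.liftKaehlerDifferential = hb.lift d.liftKaehlerDifferential := by
      refine hb.algHom_ext _ _ fun w => ?_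
      rw [hb.lift_eq]
      have : (D'.liftKaehlerDifferential.restrictScalars A) ∘ₗ (KaehlerDifferential.map k k A K)
          = d.liftKaehlerDifferential := by
        apply Derivation.liftKaehlerDifferential_unique
        ext f
        simp [hD']
      exact LinearMap.congr_fun this w
    rw [← h]
    ext f
    simp

theorem existsUnique_derivation_of_isTranscendenceBasis [CharZero k] {ι : Type*} {x : ι → K}
    (hx : IsTranscendenceBasis k x) (c : ι → K) :
    ∃! D : Derivation k K K, ∀ i, D (x i) = c i := by
  let : Algebra (MvPolynomial ι k) K := (MvPolynomial.aeval x).toRingHom.toAlgebra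
  have hmap (f : MvPolynomial ι k) : algebraMap (MvPolynomial ι k) K f = MvPolynomial.aeval x f :=
    rfl
  have : IsScalarTower k (MvPolynomial ι k) K :=
    IsScalarTower.of_algebraMap_eq fun r => by rw [hmap]; simp
  have : FaithfulSMul (MvPolynomial ι k) K :=
    (faithfulSMul_iff_algebraMap_injective _ _).2 hx.1
  let := FractionRing.liftAlgebra (MvPolynomial ι k) K
  have := FractionRing.isScalarTower_liftAlgebra (MvPolynomial ι k) K
  have : Algebra.IsAlgebraic (MvPolynomial ι k) K := by
    have := hx.isAlgebraic
    refine Algebra.IsAlgebraic.of_ringHom_of_comp_eq hx.1.aevalEquiv (RingHom.id K)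
      hx.1.aevalEquiv.surjective Function.injective_id ?_
    refine RingHom.ext fun f => ?_
    simp only [RingHom.coe_comp, RingHom.coe_coe, Function.comp_apply, RingHom.id_apply, hmap]
    exact hx.1.algebraMap_aevalEquiv f
  have : Algebra.IsAlgebraic (FractionRing (MvPolynomial ι k)) K :=
    (IsFractionRing.comap_isAlgebraic_iff (A := MvPolynomial ι k)).1 inferInstance
  have : CharZero (FractionRing (MvPolynomial ι k)) :=
    charZero_of_injective_algebraMap (algebraMap k _).injective
  have : Algebra.FormallyEtale (FractionRing (MvPolynomial ι k)) K :=
    Algebra.FormallyEtale.of_isSeparable _ K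
  have : Algebra.FormallyEtale (MvPolynomial ι k) (FractionRing (MvPolynomial ι k)) :=
    Algebra.FormallyEtale.of_isLocalization (nonZeroDivisors _)
  have : Algebra.FormallyEtale (MvPolynomial ι k) K :=
    .comp _ (FractionRing (MvPolynomial ι k)) _
  have hX (i : ι) : algebraMap (MvPolynomial ι k) K (MvPolynomial.X i) = x i := by simp [hmap]
  obtain ⟨D, hD, hu⟩ := existsUnique_derivation_extending (K := K) (MvPolynomial.mkDerivation k c)
  refine ⟨D, fun i => ?_, fun D' hD' => hu D' fun f => ?_⟩
  · rw [← hX, hD, MvPolynomial.mkDerivation_X]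
  · have : D'.compAlgebraMap (MvPolynomial ι k) = MvPolynomial.mkDerivation k c :=
      MvPolynomial.derivation_ext fun i => by
        rw [MvPolynomial.mkDerivation_X, ← hD' i, ← hX]; rfl
    rw [← this]; rfl

theorem exists_commuting_derivations [CharZero k] (x : Option (Fin 2) → K)
    (hx : AlgebraicIndependent k x) :
    ∃ d : Fin 2 → Derivation k K K, (∀ i, d i (x none) = 0) ∧
      (∀ i j, d i (x (some j)) = if i = j then 1 else 0) ∧
      ∀ f, d 0 (d 1 f) = d 1 (d 0 f) := by
  classical
  obtain ⟨t, hxt, ht⟩ := exists_isTranscendenceBasis_superset hx.coe_range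
  have hmem (o) : x o ∈ t := hxt ⟨o, rfl⟩
  choose d hd _ using fun i : Fin 2 => existsUnique_derivation_of_isTranscendenceBasis ht
    fun s => if (s : K) = x (some i) then 1 else 0
  have hd' (i o) : d i (x o) = if o = some i then 1 else 0 := by
    rw [hd i ⟨x o, hmem o⟩]
    simp [hx.injective.eq_iff]
  refine ⟨d, fun i => by simp [hd'], fun i j => by simp [hd', eq_comm], fun f => ?_⟩
  have h0 : ⁅d 0, d 1⁆ = 0 := by
    refine (existsUnique_derivation_of_isTranscendenceBasis ht fun _ => 0).unique (fun s => ?_)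
      fun _ => rfl
    rw [Derivation.commutator_apply, hd, hd]
    split_ifs <;> simp
  have := DFunLike.congr_fun h0 f
  rwa [Derivation.commutator_apply, Derivation.zero_apply, sub_eq_zero] at this

end fieldDerivations

end Sklyanin

namespace Sklyanin

section extension

theorem exists_mul_eq_one_of_noZeroDivisors (K : Type*) {D : Type*} [Field K] [Ring D]
    [Algebra K D] [Module.Finite K D] [NoZeroDivisors D] {w : D} (hw : w ≠ 0) :
    ∃ v, v * w = 1 ∧ w * v = 1 := by
  have hinj : Function.Injective (LinearMap.mulLeft K w) := fun _ _ h => mul_left_cancel₀ hw h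
  obtain ⟨v, hv⟩ := LinearMap.injective_iff_surjective.1 hinj 1
  rw [LinearMap.mulLeft_apply] at hv
  refine ⟨v, ?_, hv⟩
  have : w * (v * w - 1) = 0 := by rw [mul_sub, ← mul_assoc, hv]; simp
  exact sub_eq_zero.1 ((mul_eq_zero.1 this).resolve_left hw)

variable (K D : Type*) [Field K] [Ring D] [Algebra K D]

/-- The form `(u, v) ↦ tr (w ↦ u * v * w)`. -/
def mulTraceForm : LinearMap.BilinForm K D :=
  LinearMap.mk₂ K (fun u v => LinearMap.trace K D (LinearMap.mulLeft K (u * v)))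
    (fun u u' v => by
      rw [← map_add]; congr 1; ext; simp [add_mul, mul_assoc])
    (fun r u v => by
      rw [← map_smul]; congr 1; ext; simp [mul_assoc])
    (fun u v v' => by
      rw [← map_add]; congr 1; ext; simp [mul_add, add_mul, mul_assoc])
    (fun r u v => by
      rw [← map_smul]; congr 1; ext; simp [mul_assoc])

theorem mulTraceForm_apply (u v : D) :
    mulTraceForm K D u v = LinearMap.trace K D (LinearMap.mulLeft K (u * v)) := rfl

theorem mulTraceForm_comm (u v : D) : mulTraceForm K D u v = mulTraceForm K D v u := by
  rw [mulTraceForm_apply, mulTraceForm_apply, LinearMap.mulLeft_mul, LinearMap.mulLeft_mul]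
  exact LinearMap.trace_mul_comm K _ _

theorem mulTraceForm_mul_left (u v w : D) :
    mulTraceForm K D (u * v) w = mulTraceForm K D u (v * w) := by
  rw [mulTraceForm_apply, mulTraceForm_apply, mul_assoc]

variable [Module.Finite K D]

theorem mulTraceForm_nondegenerate [CharZero K] [NoZeroDivisors D] [Nontrivial D] :
    (mulTraceForm K D).Nondegenerate := by
  have hsep : ∀ u, (∀ v, mulTraceForm K D u v = 0) → u = 0 := by
    intro u hu
    by_contra hne
    obtain ⟨v, -, hv⟩ := exists_mul_eq_one_of_noZeroDivisors K hne
    have h := hu v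
    rw [mulTraceForm_apply, hv, LinearMap.mulLeft_one, LinearMap.trace_id] at h
    exact Module.finrank_pos.ne' (Nat.cast_eq_zero.1 h)
  exact ⟨hsep, fun v hv => hsep v fun u => by rw [mulTraceForm_comm]; exact hv u⟩

theorem exists_separability_element [CharZero K] [NoZeroDivisors D] [Nontrivial D] :
    ∃ (n : ℕ) (p q : Fin n → D), ∑ i, p i * q i = 1 ∧
      ∀ (w : D) (F : D →ₗ[K] D), ∑ i, w * p i * F (q i) = ∑ i, p i * F (q i * w) := by
  have hB := mulTraceForm_nondegenerate K D
  set e := Module.finBasis K D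
  set e' := (mulTraceForm K D).dualBasis hB e
  have hdual : ∀ i j, mulTraceForm K D (e' i) (e j) = if j = i then 1 else 0 :=
    LinearMap.BilinForm.apply_dualBasis_left hB e
  have hcas (w : D) (F : D →ₗ[K] D) : ∑ i, w * e i * F (e' i) = ∑ i, e i * F (e' i * w) := by
    have hrepr (v : D) : v = ∑ j, mulTraceForm K D (e' j) v • e j := by
      conv_lhs => rw [← e.sum_repr v]
      refine Finset.sum_congr rfl fun j _ => ?_
      congr 1
      conv_rhs => rw [← e.sum_repr v, map_sum]
      simp [hdual, -LinearMap.BilinForm.dualBasis_repr_apply, -Module.Basis.sum_repr]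
    have hrepr' (v : D) : v = ∑ j, mulTraceForm K D v (e j) • e' j := by
      conv_lhs => rw [← e'.sum_repr v]
      exact Finset.sum_congr rfl fun j _ => by
        rw [LinearMap.BilinForm.dualBasis_repr_apply]
    calc ∑ i, w * e i * F (e' i)
        = ∑ i, ∑ j, mulTraceForm K D (e' j) (w * e i) • (e j * F (e' i)) :=
          Finset.sum_congr rfl fun i _ => by
            conv_lhs => rw [hrepr (w * e i)]
            rw [Finset.sum_mul]
            exact Finset.sum_congr rfl fun j _ => smul_mul_assoc _ _ _
      _ = ∑ j, ∑ i, mulTraceForm K D (e' j) (w * e i) • (e j * F (e' i)) := Finset.sum_comm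
      _ = ∑ j, e j * F (e' j * w) := Finset.sum_congr rfl fun j _ => by
            conv_rhs => rw [hrepr' (e' j * w)]
            rw [map_sum, Finset.mul_sum]
            exact Finset.sum_congr rfl fun i _ => by
              rw [map_smul, mul_smul_comm, mulTraceForm_mul_left]
  set u := ∑ i, e i * e' i with hu
  have hcen (w : D) : w * u = u * w := by
    have := hcas w LinearMap.id
    simp only [LinearMap.id_apply, mul_assoc, ← Finset.mul_sum] at this
    rw [hu, this, Finset.sum_mul]
    simp only [mul_assoc]
  have hu0 : u ≠ 0 := by
    intro h0
    have h1 : mulTraceForm K D 1 u = 0 := by rw [h0, map_zero]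
    rw [hu, map_sum] at h1
    have h2 (i) : mulTraceForm K D 1 (e i * e' i) = 1 := by
      rw [← mulTraceForm_mul_left, one_mul, mulTraceForm_comm, hdual, if_pos rfl]
    simp only [h2, Finset.sum_const, Finset.card_univ, Fintype.card_fin, nsmul_eq_mul,
      mul_one, Nat.cast_eq_zero] at h1
    exact Module.finrank_pos.ne' h1
  obtain ⟨v, hvu, huv⟩ := exists_mul_eq_one_of_noZeroDivisors K hu0
  have hv (w : D) : w * v = v * w := by
    calc w * v = v * u * (w * v) := by rw [hvu, one_mul]
      _ = v * (u * w) * v := by simp only [mul_assoc]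
      _ = v * w * (u * v) := by rw [← hcen]; simp only [mul_assoc]
      _ = v * w := by rw [huv, mul_one]
  refine ⟨_, fun i => v * e i, e', ?_, fun w F => ?_⟩
  · simp only [mul_assoc, ← Finset.mul_sum]
    exact hvu
  · have := congrArg (v * ·) (hcas w F)
    simp only [Finset.mul_sum] at this
    simp only [← mul_assoc, hv] at this ⊢
    exact this

variable {K D}

/-- A derivation of the central subfield extends to an additive derivation of `D`. -/
theorem exists_additive_derivation [CharZero K] [NoZeroDivisors D] [Nontrivial D]
    {k : Type*} [CommRing k] [Algebra k K] (d : Derivation k K K) :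
    ∃ δ : D →+ D, (∀ u v, δ (u * v) = u * δ v + δ u * v) ∧
      ∀ f, δ (algebraMap K D f) = algebraMap K D (d f) := by
  obtain ⟨n, p, q, hpq, hcas⟩ := exists_separability_element K D
  set e := Module.finBasis K D
  let t : D →+ D :=
    { toFun := fun u => ∑ i, d (e.repr u i) • e i
      map_zero' := by simp
      map_add' := fun u v => by simp [add_smul, Finset.sum_add_distrib] }
  have ht (f : K) (u : D) : t (f • u) = f • t u + d f • u := by
    change ∑ i, d (e.repr (f • u) i) • e i = f • ∑ i, d (e.repr u i) • e i + d f • u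
    conv_rhs => enter [2]; rw [← e.sum_repr u]
    rw [Finset.smul_sum, Finset.smul_sum, ← Finset.sum_add_distrib]
    refine Finset.sum_congr rfl fun i _ => ?_
    simp [add_smul, smul_smul, mul_comm]
  let c (v : D) : D →ₗ[K] D :=
    { toFun := fun u => t (u * v) - u * t v - t u * v
      map_add' := fun u u' => by simp only [add_mul, map_add]; abel
      map_smul' := fun f u => by
        simp only [smul_mul_assoc, ht, add_mul, RingHom.id_apply, smul_sub]; abel }
  have hc (u v) : c v u = t (u * v) - u * t v - t u * v := rfl
  let φ : D →+ D :=
    { toFun := fun v => ∑ i, p i * c v (q i)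
      map_zero' := by simp [hc]
      map_add' := fun v v' => by
        rw [← Finset.sum_add_distrib]
        refine Finset.sum_congr rfl fun i _ => ?_
        simp only [hc, mul_add, map_add, mul_sub]; abel }
  have hφ (v) : φ v = ∑ i, p i * c v (q i) := rfl
  have hφmul (u v) : φ (u * v) + c v u = u * φ v + φ u * v := by
    have h1 : u * φ v = ∑ i, p i * c v (q i * u) := by
      rw [← hcas u (c v), hφ, Finset.mul_sum]
      exact Finset.sum_congr rfl fun i _ => (mul_assoc _ _ _).symm
    have h2 : c v u = ∑ i, p i * (q i * c v u) := by
      simp only [← mul_assoc, ← Finset.sum_mul, hpq, one_mul]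
    rw [h1, h2, hφ, hφ, Finset.sum_mul, ← Finset.sum_add_distrib, ← Finset.sum_add_distrib]
    refine Finset.sum_congr rfl fun i _ => ?_
    rw [mul_assoc, ← mul_add, ← mul_add]
    congr 1
    simp only [hc, mul_sub, sub_mul, mul_assoc]
    abel
  have hmul (u v) : (t + φ) (u * v) = u * (t + φ) v + (t + φ) u * v := by
    have h1 := hφmul u v
    rw [hc] at h1
    rw [AddMonoidHom.add_apply, AddMonoidHom.add_apply, AddMonoidHom.add_apply, mul_add, add_mul,
      ← add_add_add_comm, ← h1]
    abel
  have hone : (t + φ) 1 = 0 := by simpa using hmul 1 1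
  have hsmul (f : K) (u : D) : φ (f • u) = f • φ u := by
    rw [hφ, hφ, Finset.smul_sum]
    refine Finset.sum_congr rfl fun i _ => ?_
    rw [← mul_smul_comm]
    congr 1
    simp only [hc, mul_smul_comm, ht, mul_add, smul_sub]
    abel
  refine ⟨t + φ, hmul, fun f => ?_⟩
  rw [Algebra.algebraMap_eq_smul_one, AddMonoidHom.add_apply, ht, hsmul, add_right_comm, ← smul_add,
    ← AddMonoidHom.add_apply, hone, smul_zero, zero_add, ← Algebra.algebraMap_eq_smul_one]

end extension

end Sklyanin

namespace Sklyanin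

section denominators

open TensorProduct nonZeroDivisors

variable {Z S : Type*} [CommRing Z] [IsDomain Z] [Ring S] [Algebra Z S]

theorem includeRight_injective [Module.IsTorsionFree Z S] :
    Function.Injective
      (Algebra.TensorProduct.includeRight : S →ₐ[Z] FractionRing Z ⊗[Z] S) := by
  intro u v huv
  obtain ⟨r, hr⟩ := (IsLocalizedModule.eq_iff_exists Z⁰
    (TensorProduct.mk Z (FractionRing Z) S 1)).1 huv
  exact smul_right_injective S (nonZeroDivisors.coe_ne_zero r) hr

theorem exists_smul_eq_includeRight (t : FractionRing Z ⊗[Z] S) :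
    ∃ (r : Z) (s : S), r ≠ 0 ∧
      r • t = (Algebra.TensorProduct.includeRight : S →ₐ[Z] FractionRing Z ⊗[Z] S) s := by
  obtain ⟨⟨s, r⟩, h⟩ := IsLocalizedModule.surj Z⁰ (TensorProduct.mk Z (FractionRing Z) S 1) t
  exact ⟨r, s, nonZeroDivisors.coe_ne_zero r, h⟩

theorem noZeroDivisors_fractionRing_tensor [Module.IsTorsionFree Z S] [NoZeroDivisors S] :
    NoZeroDivisors (FractionRing Z ⊗[Z] S) where
  eq_zero_or_eq_zero_of_mul_eq_zero := by
    intro t t' h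
    obtain ⟨r, s, hr, hs⟩ := exists_smul_eq_includeRight t
    obtain ⟨r', s', hr', hs'⟩ := exists_smul_eq_includeRight t'
    have hz (r : Z) (hr : r ≠ 0) (t : FractionRing Z ⊗[Z] S) (h : r • t = 0) : t = 0 := by
      rw [← algebraMap_smul (FractionRing Z) r t] at h
      exact (smul_eq_zero.1 h).resolve_left
        (IsFractionRing.to_map_ne_zero_of_mem_nonZeroDivisors (mem_nonZeroDivisors_of_ne_zero hr))
    have : s * s' = 0 := by
      apply includeRight_injective (Z := Z)
      rw [map_mul, ← hs, ← hs', smul_mul_smul_comm, h, smul_zero, map_zero]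
    rcases mul_eq_zero.1 this with h0 | h0
    · left; exact hz r hr t (by rw [hs, h0, map_zero])
    · right; exact hz r' hr' t' (by rw [hs', h0, map_zero])

/-- A derivation of the fraction field of the centre becomes, after clearing denominators, the
restriction of a derivation of the whole algebra. -/
theorem exists_derivation_clearing_denominators {k : Type*} [Field k] [CharZero k] [Algebra k Z]
    [Algebra k S] [IsScalarTower k Z S] [Module.IsTorsionFree Z S] [NoZeroDivisors S]
    [Nontrivial S] [Module.Finite Z S]
    (hcen : ∀ s : S, (∀ t, s * t = t * s) → ∃ r, algebraMap Z S r = s)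
    {G : Set S} (hG : G.Finite) (hadj : Algebra.adjoin k G = ⊤)
    (d : Derivation k (FractionRing Z) (FractionRing Z)) :
    ∃ (h : Z) (Δ : S →ₗ[k] S), h ≠ 0 ∧ (∀ s t, Δ (s * t) = s * Δ t + Δ s * t) ∧
      ∀ r, ∃ w, Δ (algebraMap Z S r) = algebraMap Z S w ∧
        algebraMap Z (FractionRing Z) w =
          algebraMap Z (FractionRing Z) h * d (algebraMap Z (FractionRing Z) r) := by
  classical
  have hnzd := noZeroDivisors_fractionRing_tensor (Z := Z) (S := S)
  set ι : S →ₐ[Z] FractionRing Z ⊗[Z] S := Algebra.TensorProduct.includeRight with hι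
  have hinj : Function.Injective ι := includeRight_injective
  have : Nontrivial (FractionRing Z ⊗[Z] S) := hinj.nontrivial
  have : CharZero (FractionRing Z) := charZero_of_injective_algebraMap (algebraMap k _).injective
  obtain ⟨δ, hδ, hδK⟩ := exists_additive_derivation (D := FractionRing Z ⊗[Z] S) d
  have hιmap (r : Z) : ι (algebraMap Z S r) =
      algebraMap (FractionRing Z) (FractionRing Z ⊗[Z] S) (algebraMap Z (FractionRing Z) r) := by
    rw [AlgHom.commutes, ← IsScalarTower.algebraMap_apply]
  have hsm (r : Z) (t : FractionRing Z ⊗[Z] S) : r • t =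
      algebraMap (FractionRing Z) (FractionRing Z ⊗[Z] S) (algebraMap Z (FractionRing Z) r) * t := by
    rw [← algebraMap_smul (FractionRing Z) r t]
    exact Algebra.smul_def (algebraMap Z (FractionRing Z) r) t
  have hδk (r : k) (s : S) : δ (ι (r • s)) = algebraMap k Z r • δ (ι s) := by
    rw [← algebraMap_smul Z r s, map_smul, hsm, hsm, hδ, hδK,
      ← IsScalarTower.algebraMap_apply k Z (FractionRing Z), d.map_algebraMap, map_zero, zero_mul,
      add_zero]
  obtain ⟨h, h0, hh⟩ : ∃ h : Z, h ≠ 0 ∧ ∀ s ∈ G, ∃ s', ι s' = h • δ (ι s) := by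
    choose r s hr hs using fun t => exists_smul_eq_includeRight (Z := Z) (δ (ι t))
    refine ⟨∏ t ∈ hG.toFinset, r t, Finset.prod_ne_zero_iff.2 fun t _ => hr t, fun t ht => ?_⟩
    refine ⟨(∏ t ∈ hG.toFinset.erase t, r t) • s t, ?_⟩
    rw [map_smul, ← hs, smul_smul, Finset.prod_erase_mul _ _ (hG.mem_toFinset.2 ht)]
  have hall (s : S) : ∃ s', ι s' = h • δ (ι s) := by
    have hs : s ∈ Algebra.adjoin k G := hadj ▸ Algebra.mem_top
    induction hs using Algebra.adjoin_induction with
    | mem s hs => exact hh s hs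
    | algebraMap r =>
      refine ⟨0, ?_⟩
      have h1 : δ 1 = 0 := by simpa using hδ 1 1
      rw [Algebra.algebraMap_eq_smul_one, hδk, map_one, h1, smul_zero, smul_zero, map_zero]
    | add s t _ _ ihs iht =>
      obtain ⟨s', hs'⟩ := ihs
      obtain ⟨t', ht'⟩ := iht
      exact ⟨s' + t', by rw [map_add, hs', ht', map_add, map_add, smul_add]⟩
    | mul s t _ _ ihs iht =>
      obtain ⟨s', hs'⟩ := ihs
      obtain ⟨t', ht'⟩ := iht
      refine ⟨s * t' + s' * t, ?_⟩
      rw [map_add, map_mul, map_mul, hs', ht', map_mul, hδ, smul_add, mul_smul_comm,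
        smul_mul_assoc]
  choose Δ hΔ using hall
  have hΔmul (s t) : Δ (s * t) = s * Δ t + Δ s * t := by
    apply hinj
    rw [hΔ, map_add, map_mul ι, map_mul ι, map_mul ι, hΔ, hΔ, hδ, smul_add, mul_smul_comm,
      smul_mul_assoc]
  refine ⟨h, { toFun := Δ, map_add' := fun s t => ?_, map_smul' := fun r s => ?_ }, h0, hΔmul,
    fun r => ?_⟩
  · apply hinj
    rw [hΔ, map_add, map_add, map_add, hΔ, hΔ, smul_add]
  · apply hinj
    rw [RingHom.id_apply, ← algebraMap_smul Z r (Δ s), map_smul, hΔ, hΔ, hδk, smul_comm]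
  · obtain ⟨w, hw⟩ := hcen (Δ (algebraMap Z S r)) fun t => by
      have h1 := hΔmul (algebraMap Z S r) t
      rw [Algebra.commutes r t, hΔmul, Algebra.commutes r (Δ t), add_comm] at h1
      exact (add_left_cancel h1).symm
    refine ⟨w, hw.symm, ?_⟩
    apply (algebraMap (FractionRing Z) (FractionRing Z ⊗[Z] S)).injective
    rw [← hιmap, hw, hΔ, hιmap, hδK, map_mul, hsm]

end denominators

end Sklyanin

namespace Sklyanin

section bracket

/-- Two commuting derivations of a field, scaled by `H`, define a bracket satisfying the Jacobi
identity. -/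
theorem jacobi_of_commuting_derivations {k K : Type*} [CommRing k] [Field K] [Algebra k K]
    (d e : Derivation k K K) (hde : ∀ f, d (e f) = e (d f)) (H : K) (β : K → K → K)
    (hβ : ∀ u v, β u v = H * (d u * e v - e u * d v)) (u v w : K) :
    β u (β v w) + β v (β w u) + β w (β u v) = 0 := by
  simp only [hβ, Derivation.leibniz, map_sub, smul_eq_mul, hde]
  ring

/-- Poisson order structure attached to algebraically independent central elements. -/
theorem exists_poisson_order {k Z S : Type*} [Field k] [CharZero k] [CommRing Z] [IsDomain Z]
    [Ring S] [Algebra Z S] [Algebra k Z] [Algebra k S] [IsScalarTower k Z S]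
    [Module.IsTorsionFree Z S] [NoZeroDivisors S] [Nontrivial S] [Module.Finite Z S]
    (hcen : ∀ s : S, (∀ t, s * t = t * s) → ∃ r, algebraMap Z S r = s)
    {G : Set S} (hG : G.Finite) (hadj : Algebra.adjoin k G = ⊤)
    (x : Option (Fin 2) → Z) (hx : AlgebraicIndependent k x) :
    ∃ (D : Z →ₗ[k] S →ₗ[k] S) (br : Z → Z → Z),
      (∀ z s t, D z (s * t) = D z s * t + s * D z t) ∧
      (∀ z z', algebraMap Z S (br z z') = D z (algebraMap Z S z')) ∧
      (∀ z z', br z z' = -br z' z) ∧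
      (∀ z z' z'', br z (z' * z'') = br z z' * z'' + z' * br z z'') ∧
      (∀ z z' z'', br z (br z' z'') + br z' (br z'' z) + br z'' (br z z') = 0) ∧
      D (x none) = 0 ∧ br (x (some 0)) (x (some 1)) ≠ 0 := by
  have hSinj : Function.Injective (algebraMap Z S) := FaithfulSMul.algebraMap_injective Z S
  have hKinj : Function.Injective (algebraMap Z (FractionRing Z)) := IsFractionRing.injective _ _
  obtain ⟨d, hd0, hd, hdd⟩ := exists_commuting_derivations
    (fun o => algebraMap Z (FractionRing Z) (x o))
    (hx.map' (f := IsScalarTower.toAlgHom k Z (FractionRing Z)) hKinj)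
  choose h Δ hne hΔ w hw hwK using fun i =>
    exists_derivation_clearing_denominators (S := S) hcen hG hadj (d i)
  let D : Z →ₗ[k] S →ₗ[k] S := LinearMap.mk₂ k
    (fun z s => Δ 0 (algebraMap Z S z) * Δ 1 s - Δ 1 (algebraMap Z S z) * Δ 0 s)
    (fun z z' s => by simp only [map_add, add_mul]; abel)
    (fun r z s => by
      rw [show algebraMap Z S (r • z) = r • algebraMap Z S z from
        (IsScalarTower.toAlgHom k Z S).toLinearMap.map_smul r z]
      simp only [map_smul, smul_mul_assoc, smul_sub])
    (fun z s t => by simp only [map_add, mul_add]; abel)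
    (fun r z s => by simp only [map_smul, mul_smul_comm, smul_sub])
  have hD (z : Z) (s : S) :
      D z s = algebraMap Z S (w 0 z) * Δ 1 s - algebraMap Z S (w 1 z) * Δ 0 s := by
    rw [← hw, ← hw]; rfl
  let br (z z' : Z) : Z := w 0 z * w 1 z' - w 1 z * w 0 z'
  have hbr (z z') : algebraMap Z S (br z z') = D z (algebraMap Z S z') := by
    simp only [br, hD, hw, map_sub, map_mul]
  have hDmul (z : Z) (s t : S) : D z (s * t) = D z s * t + s * D z t := by
    simp only [hD, hΔ, mul_add, sub_mul, mul_sub, mul_assoc]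
    rw [Algebra.left_comm s, Algebra.left_comm s]
    abel
  let β (u v : FractionRing Z) : FractionRing Z :=
    algebraMap Z (FractionRing Z) (h 0 * h 1) * (d 0 u * d 1 v - d 1 u * d 0 v)
  have hbrK (z z') : algebraMap Z (FractionRing Z) (br z z') =
      β (algebraMap Z _ z) (algebraMap Z _ z') := by
    simp only [br, β, map_sub, map_mul, hwK]
    ring
  refine ⟨D, br, hDmul, hbr, fun z z' => by simp only [br]; ring, fun z z' z'' => ?_,
    fun z z' z'' => ?_, ?_, ?_⟩
  · apply hSinj
    simp only [map_add, map_mul, hbr, hDmul]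
  · apply hKinj
    simp only [map_add, hbrK, map_zero]
    exact jacobi_of_commuting_derivations (d 0) (d 1) hdd _ β (fun _ _ => rfl) _ _ _
  · have hw0 (i) : w i (x none) = 0 := by
      apply hKinj
      rw [hwK, hd0, mul_zero, map_zero]
    ext s
    simp [hD, hw0]
  · intro h0
    have := hbrK (x (some 0)) (x (some 1))
    rw [h0, map_zero] at this
    simp [β, hd, hne] at this

/-- A ring is an algebra over its centre. -/
abbrev centerAlgebra (k S : Type*) [CommRing k] [Ring S] [Algebra k S] :
    Algebra (Subalgebra.center k S) S where
  toSMul := (Subalgebra.moduleLeft (Subalgebra.center k S)).toSMul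
  algebraMap := (Subalgebra.center k S).val.toRingHom
  commutes' r s := (Subalgebra.mem_center_iff.1 r.2 s).symm
  smul_def' _ _ := rfl

theorem exists_poisson_order_center {k S : Type*} [Field k] [CharZero k] [Ring S] [Algebra k S]
    [NoZeroDivisors S] [Nontrivial S] [Module.Finite (Subalgebra.center k S) S]
    {G : Set S} (hG : G.Finite) (hadj : Algebra.adjoin k G = ⊤)
    (x : Option (Fin 2) → Subalgebra.center k S) (hx : AlgebraicIndependent k x) :
    ∃ (D : Subalgebra.center k S →ₗ[k] S →ₗ[k] S)
      (br : Subalgebra.center k S → Subalgebra.center k S → Subalgebra.center k S),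
      (∀ z s t, D z (s * t) = D z s * t + s * D z t) ∧
      (∀ z z', (br z z' : S) = D z z') ∧
      (∀ z z', br z z' = -br z' z) ∧
      (∀ z z' z'', br z (z' * z'') = br z z' * z'' + z' * br z z'') ∧
      (∀ z z' z'', br z (br z' z'') + br z' (br z'' z) + br z'' (br z z') = 0) ∧
      D (x none) = 0 ∧ br (x (some 0)) (x (some 1)) ≠ 0 := by
  have : NoZeroDivisors (Subalgebra.center k S) :=
    Subtype.val_injective.noZeroDivisors _ rfl fun _ _ => rfl
  have : IsDomain (Subalgebra.center k S) := NoZeroDivisors.to_isDomain _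
  have : Module.IsTorsionFree (Subalgebra.center k S) S := by
    refine .of_smul_eq_zero fun r s h => ?_
    simpa [Subalgebra.smul_def] using h
  let := centerAlgebra k S
  have : IsScalarTower k (Subalgebra.center k S) S := IsScalarTower.of_algebraMap_eq fun _ => rfl
  exact exists_poisson_order
    (fun s hs => ⟨⟨s, Subalgebra.mem_center_iff.2 fun t => (hs t).symm⟩, rfl⟩) hG hadj x hx

end bracket

end Sklyanin

set_option synthInstance.maxHeartbeats 1000000 in
set_option maxHeartbeats 1000000 in
/-- **Theorem 1(1,2) + Lemma (g Poisson central) + nontriviality** for PI 3-dimensional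
Sklyanin algebras: if `S = S(a,b,c)` is module-finite over its center `Z`, then there is a
`k`-linear map `∂ : Z → Der_k(S)` such that each `∂_z` preserves `Z`, the induced bracket
`{z,z'} = ∂_z(z')` makes `Z` a Poisson algebra, the central element `g` is in the Poisson
center (`∂_g = 0`), and the bracket is not identically zero. -/
theorem sklyanin_poisson_order_exists
    (k : Type*) [Field k] [IsAlgClosed k] [CharZero k]
    (a b c : k) (habc : a * b * c ≠ 0)
    (hdeg : (3 * a * b * c) ^ 3 ≠ (a ^ 3 + b ^ 3 + c ^ 3) ^ 3)
    (hfin : Module.Finite ↥(Subalgebra.center k (Sklyanin k a b c)) (Sklyanin k a b c)) :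
    ∃ (D : ↥(Subalgebra.center k (Sklyanin k a b c)) →ₗ[k]
          Sklyanin k a b c →ₗ[k] Sklyanin k a b c)
      (br : ↥(Subalgebra.center k (Sklyanin k a b c)) →
          ↥(Subalgebra.center k (Sklyanin k a b c)) →
          ↥(Subalgebra.center k (Sklyanin k a b c))),
      -- each ∂_z is a derivation of S
      (∀ (z : ↥(Subalgebra.center k (Sklyanin k a b c))) (s t : Sklyanin k a b c),
        D z (s * t) = D z s * t + s * D z t) ∧
      -- ∂_z preserves Z, and br is the induced bracket {z,z'} = ∂_z(z')
      (∀ z z' : ↥(Subalgebra.center k (Sklyanin k a b c)),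
        (br z z' : Sklyanin k a b c) = D z (z' : Sklyanin k a b c)) ∧
      -- antisymmetry
      (∀ z z', br z z' = - br z' z) ∧
      -- Leibniz rule
      (∀ z z' z'', br z (z' * z'') = br z z' * z'' + z' * br z z'') ∧
      -- Jacobi identity
      (∀ z z' z'', br z (br z' z'') + br z' (br z'' z) + br z'' (br z z') = 0) ∧
      -- g is in the Poisson center: ∂_g = 0
      (∃ hg : Sklyanin.g k a b c ∈ Subalgebra.center k (Sklyanin k a b c),
        D ⟨Sklyanin.g k a b c, hg⟩ = 0) ∧
      -- the bracket on Z is not identically zero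
      (∃ z z', br z z' ≠ 0) := by
  have hne : ¬ (a ^ 3 = c ^ 3 ∧ b ^ 3 = c ^ 3) := by
    rintro ⟨ha, hb⟩
    apply hdeg
    rw [ha, hb, mul_pow, mul_pow, mul_pow, ha, hb]
    ring
  have := Sklyanin.noZeroDivisors habc hdeg hne
  obtain ⟨z, hz⟩ := Sklyanin.exists_algebraicIndependent habc hdeg hne hfin
  obtain ⟨D, br, hD, hbr, hanti, hleib, hjac, hg, hnz⟩ :=
    Sklyanin.exists_poisson_order_center (Set.finite_range Sklyanin.gen)
      Sklyanin.adjoin_range_gen _ hz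
  exact ⟨D, br, hD, hbr, hanti, hleib, hjac, ⟨Sklyanin.g_mem_center, hg⟩, _, _, hnz⟩

end
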